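/- Let (ρ, θ) be a classical solution of the textile system on Q_T with ρ > 0 on [0,1]×[0,T]. Suppose there are constants 0 < m ≤ M, M₁, M₂, M₃ ≥ 0 such that m ≤ θ(x,t) ≤ M on [0,1]×[0,T], sup_{t∈[0,T]} ∫₀¹ ρ(x,t) dx ≤ M₁, ∫₀ᵀ∫₀¹ ρ² θ_x² dx dt ≤ M₂, and ∫₀¹ ρ₀ |ln ρ₀| dx ≤ M₃. Then there exists a constant C, depending only on m, M, M₁, M₂, M₃, σ, λ, κ₁, κ₂, α⁰, α¹, β⁰, β¹, ρ̄⁰, ρ̄¹, θ̄⁰, θ̄¹, p_s and T, such that sup_{t∈[0,T]} ∫₀¹ ρ(x,t) |ln ρ(x,t)| dx + ∫₀ᵀ∫₀¹ θ ρ_x² dx dt ≤ C; in particular ∫₀ᵀ∫₀¹ ρ_x² dx dt ≤ C/m. -/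

import Mathlib

open Set Filter MeasureTheory Topology

theorem vitali_zero {α ι : Type*} [MeasurableSpace α] {μ : Measure α} [IsFiniteMeasure μ]
    {l : Filter ι} [l.IsCountablyGenerated] (u : ι → α → ℝ) (C : ℝ) 
    (hm : ∀ᶠ i in l, AEStronglyMeasurable (u i) μ)
    (hi : ∀ᶠ i in l, Integrable (fun x => (u i x)^2) μ)
    (hb : ∀ᶠ i in l, ∫ x, (u i x)^2 ∂μ ≤ C)
    (ht : ∀ᵐ x ∂μ, Tendsto (fun i => u i x) l (𝓝 0)) :
    Tendsto (fun i => ∫ x, u i x ∂μ) l (𝓝 0) := by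
  rw [Metric.tendsto_nhds]
  intro ε hε
  set C' := max C 0 with hC'
  have hC'0 : 0 ≤ C' := le_max_right _ _
  set R := 2 * (C' + 1) / ε with hR
  have hRpos : 0 < R := by positivity
  have hdom : Tendsto (fun i => ∫ x, min |u i x| R ∂μ) l (𝓝 (∫ x, (0:ℝ) ∂μ)) := by
    apply tendsto_integral_filter_of_dominated_convergence (fun _ => R)
    · filter_upwards [hm] with i h
      exact (h.norm.inf aestronglyMeasurable_const)
    · refine Eventually.of_forall fun i => Eventually.of_forall fun x => ?_
      rw [Real.norm_eq_abs, abs_of_nonneg (le_min (abs_nonneg _) hRpos.le)]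
      exact min_le_right _ _
    · exact integrable_const _
    · filter_upwards [ht] with x hx
      have h1 : Tendsto (fun i => min |u i x| R) l (𝓝 (min |(0:ℝ)| R)) :=
        (hx.abs).min tendsto_const_nhds
      simpa [hRpos.le] using h1
  simp only [integral_zero] at hdom
  have h2 := (Metric.tendsto_nhds.1 hdom) (ε/2) (by positivity)
  filter_upwards [h2, hm, hi, hb] with i h2 hm hi hb
  have hInteg : Integrable (fun x => min |u i x| R) μ := by
    refine Integrable.mono' (integrable_const R) (hm.norm.inf aestronglyMeasurable_const) ?_
    refine Eventually.of_forall fun x => ?_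
    rw [Real.norm_eq_abs, abs_of_nonneg (le_min (abs_nonneg _) hRpos.le)]
    exact min_le_right _ _
  have hpt : ∀ x, |u i x| ≤ min |u i x| R + (u i x)^2 / R := by
    intro x
    rcases le_total |u i x| R with h | h
    · rw [min_eq_left h]
      have : 0 ≤ (u i x)^2 / R := by positivity
      linarith
    · rw [min_eq_right h]
      have : |u i x| ≤ (u i x)^2 / R := by
        rw [le_div_iff₀ hRpos, ← sq_abs]
        nlinarith [abs_nonneg (u i x)]
      linarith
  have h3 : |∫ x, u i x ∂μ| ≤ ∫ x, min |u i x| R ∂μ + (∫ x, (u i x)^2 ∂μ) / R := by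
    have := norm_integral_le_of_norm_le (f := u i) (μ := μ) (hInteg.add (hi.div_const R)) (Eventually.of_forall hpt)
    refine this.trans (le_of_eq ?_)
    rw [← integral_div]
    exact integral_add hInteg (hi.div_const R)
  have h4 : (∫ x, (u i x)^2 ∂μ) / R ≤ C' / R := by
    gcongr; exact hb.trans (le_max_left _ _)
  have h5 : C' / R < ε / 2 := by
    rw [div_lt_iff₀ hRpos, hR]; field_simp; linarith
  rw [Real.dist_eq, sub_zero] at h2 ⊢
  have := le_abs_self (∫ x, min |u i x| R ∂μ)
  linarith

theorem deriv_int {α : Type*} [MeasurableSpace α] {μ : Measure α} [IsFiniteMeasure μ]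
    {l : Filter ℝ} [l.IsCountablyGenerated] [l.NeBot] (t : ℝ) (hl : l ≤ 𝓝[>] t)
    (h : ℝ → α → ℝ) (h' : α → ℝ) (N C : ℝ)
    (hN : ∀ᵐ x ∂μ, |h' x| ≤ N)
    (ht : ∀ᵐ x ∂μ, Tendsto (fun s => (h s x - h t x) / (s - t)) l (𝓝 (h' x)))
    (hm : ∀ᶠ s in l, AEStronglyMeasurable (h s) μ) (hmt : AEStronglyMeasurable (h t) μ)
    (hi : ∀ᶠ s in l, Integrable (fun x => (h s x - h t x)^2) μ)
    (hb : ∀ᶠ s in l, ∫ x, (h s x - h t x)^2 ∂μ ≤ C * (s - t)^2) :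
    Tendsto (fun s => ∫ x, (h s x - h t x) / (s - t) ∂μ) l (𝓝 (∫ x, h' x ∂μ)) := by
  have hl0 : ∀ᶠ s in l, t < s := hl self_mem_nhdsWithin
  have hmq : ∀ᶠ s in l, AEStronglyMeasurable (fun x => (h s x - h t x) / (s - t)) μ := by
    filter_upwards [hm] with s hs
    exact ((hs.sub hmt).mul_const _ : AEStronglyMeasurable (fun x => (h s x - h t x) * (s - t)⁻¹) μ)
  have hm' : AEStronglyMeasurable h' μ := by
    classical
    obtain ⟨v, hv⟩ := l.exists_seq_tendsto
    obtain ⟨n0, hn0⟩ := eventually_atTop.1 (hv.eventually hmq)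
    refine aestronglyMeasurable_of_tendsto_ae atTop
      (f := fun n x => (h (v (n + n0)) x - h t x) / (v (n + n0) - t)) 
      (fun n => hn0 _ (Nat.le_add_left _ _)) ?_
    filter_upwards [ht] with x hx
    exact hx.comp (hv.comp (tendsto_add_atTop_nat n0))
  have hi' : Integrable h' μ := Integrable.mono' (integrable_const N) hm' hN
  have hi2 : Integrable (fun x => (h' x)^2) μ := by
    refine Integrable.mono' (integrable_const (N^2)) (hm'.pow 2) ?_
    filter_upwards [hN] with x hx
    rw [Real.norm_eq_abs, abs_pow]
    gcongr
  have key := vitali_zero (μ := μ) (l := l) (fun s x => (h s x - h t x) / (s - t) - h' x)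
    (2 * C + 2 * ∫ x, (h' x)^2 ∂μ)
    (by filter_upwards [hmq] with s hs using hs.sub hm')
    (by
      filter_upwards [hmq, hi] with s hs hi
      have h1 : Integrable (fun x => 2 * ((h s x - h t x)^2 / (s-t)^2) + 2 * (h' x)^2) μ :=
        ((hi.div_const _).const_mul 2).add (hi2.const_mul 2)
      refine h1.mono' ((hs.sub hm').pow 2) (Eventually.of_forall fun x => ?_)
      rw [Real.norm_eq_abs, abs_of_nonneg (sq_nonneg _), ← div_pow]
      nlinarith [sq_nonneg ((h s x - h t x) / (s - t) + h' x)])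
    (by
      filter_upwards [hmq, hi, hb, hl0] with s hs hi hb hts
      have h1 : Integrable (fun x => 2 * ((h s x - h t x)^2 / (s-t)^2) + 2 * (h' x)^2) μ :=
        ((hi.div_const _).const_mul 2).add (hi2.const_mul 2)
      have h2 : ∫ x, ((h s x - h t x) / (s - t) - h' x)^2 ∂μ ≤
          ∫ x, (2 * ((h s x - h t x)^2 / (s-t)^2) + 2 * (h' x)^2) ∂μ := by
        refine integral_mono_of_nonneg (Eventually.of_forall fun x => sq_nonneg _) h1
          (Eventually.of_forall fun x => ?_)
        simp only [← div_pow]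
        nlinarith [sq_nonneg ((h s x - h t x) / (s - t) + h' x)]
      refine h2.trans ?_
      rw [integral_add ((hi.div_const _).const_mul 2) (hi2.const_mul 2), integral_const_mul,
        integral_const_mul, integral_div]
      have : (∫ x, (h s x - h t x)^2 ∂μ) / (s-t)^2 ≤ C := by
        rw [div_le_iff₀ (by have := sub_pos.2 hts; positivity)]; exact hb
      linarith)
    (by
      filter_upwards [ht] with x hx
      simpa using hx.sub_const (h' x))
  have hiq : ∀ᶠ s in l, Integrable (fun x => (h s x - h t x) / (s - t)) μ := by
    filter_upwards [hm, hi] with s hs hi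
    refine Integrable.div_const ?_ _
    refine ((memLp_two_iff_integrable_sq (hs.sub hmt)).2 hi).integrable (by norm_num)
  have h3 : Tendsto (fun s => (∫ x, ((h s x - h t x) / (s - t) - h' x) ∂μ) + ∫ x, h' x ∂μ) l
      (𝓝 (∫ x, h' x ∂μ)) := by simpa using key.add_const (∫ x, h' x ∂μ)
  refine h3.congr' ?_
  filter_upwards [hiq] with s hs
  rw [integral_sub hs hi']; ring

/-- joint continuity gives slice continuity -/
theorem slice_x {u : ℝ → ℝ → ℝ} {T : ℝ}
    (hu : ContinuousOn (fun p : ℝ × ℝ => u p.1 p.2) (Icc 0 1 ×ˢ Icc 0 T)) {t : ℝ} (ht : t ∈ Icc 0 T) :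
    ContinuousOn (fun x => u x t) (Icc 0 1) :=
  hu.comp (f := fun x : ℝ => (x, t)) (by fun_prop) (fun x hx => ⟨hx, ht⟩)

theorem slice_t {u : ℝ → ℝ → ℝ} {T : ℝ}
    (hu : ContinuousOn (fun p : ℝ × ℝ => u p.1 p.2) (Icc 0 1 ×ˢ Icc 0 T)) {x : ℝ} (hx : x ∈ Icc (0:ℝ) 1) :
    ContinuousOn (fun t => u x t) (Icc 0 T) :=
  hu.comp (f := fun t : ℝ => (x, t)) (by fun_prop) (fun t ht => ⟨hx, ht⟩)

/-- uniform continuity in time -/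
theorem unif_t {u : ℝ → ℝ → ℝ} {T : ℝ}
    (hu : ContinuousOn (fun p : ℝ × ℝ => u p.1 p.2) (Icc 0 1 ×ˢ Icc 0 T)) {ε : ℝ} (hε : 0 < ε) :
    ∃ δ > 0, ∀ x ∈ Icc (0:ℝ) 1, ∀ s ∈ Icc 0 T, ∀ t ∈ Icc 0 T, |s - t| < δ → |u x s - u x t| < ε := by
  have h := (isCompact_Icc.prod isCompact_Icc).uniformContinuousOn_of_continuous hu
  rw [Metric.uniformContinuousOn_iff] at h
  obtain ⟨δ, hδ, h⟩ := h ε hε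
  refine ⟨δ, hδ, fun x hx s hs t ht hst => ?_⟩
  have := h (x, s) ⟨hx, hs⟩ (x, t) ⟨hx, ht⟩ (by simp [Prod.dist_eq, Real.dist_eq, hst, hδ])
  simpa [Real.dist_eq] using this

theorem baire_closed {X : Type*} [MetricSpace X] [CompleteSpace X] (E : Set X) (hE : IsClosed E)
    (hne : E.Nonempty) (F : ℕ → Set X) (hF : ∀ n, IsClosed (E ∩ F n)) (hcov : E ⊆ ⋃ n, F n) :
    ∃ n, ∃ p ∈ E, ∃ r > 0, ∀ q ∈ E, dist q p < r → q ∈ F n := by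
  have : CompleteSpace E := hE.completeSpace_coe
  have : Nonempty E := hne.to_subtype
  have h := nonempty_interior_of_iUnion_of_closed (X := E) (f := fun n => {q : E | (q:X) ∈ F n})
    (fun n => by
      have : {q : E | (q:X) ∈ F n} = (fun q : E => (q:X)) ⁻¹' (E ∩ F n) := by
        ext q; simp
      rw [this]
      exact (hF n).preimage continuous_subtype_val)
    (by
      ext q; simp only [mem_iUnion, mem_ofPred_eq, mem_univ, iff_true]
      simpa using hcov q.2)
  obtain ⟨n, p, hp⟩ := h
  rw [mem_interior_iff_mem_nhds, Metric.mem_nhds_iff] at hp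
  obtain ⟨r, hr, hp⟩ := hp
  refine ⟨n, p, p.2, r, hr, fun q hq hd => ?_⟩
  exact hp (show (⟨q, hq⟩ : E) ∈ Metric.ball p r from hd)

theorem cont_int {F : ℝ → ℝ → ℝ} {T : ℝ}
    (hF : ContinuousOn (fun p : ℝ × ℝ => F p.1 p.2) (Icc 0 1 ×ˢ Icc 0 T)) {K : Set ℝ}
    (hK : MeasurableSet K) (hK1 : K ⊆ Icc 0 1) :
    ContinuousOn (fun s => ∫ x in K, F x s) (Icc 0 T) := by
  obtain ⟨B, hB⟩ := (isCompact_Icc.prod isCompact_Icc).exists_bound_of_continuousOn hF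
  have hfin : volume K ≠ ⊤ := ((measure_mono hK1).trans_lt (by simp)).ne
  apply continuousOn_of_dominated (bound := fun _ => B)
  · intro s hs
    exact ((slice_x hF hs).mono hK1).aestronglyMeasurable hK
  · intro s hs
    refine (ae_restrict_iff' hK).2 (Eventually.of_forall fun x hx => ?_)
    exact hB (x, s) ⟨hK1 hx, hs⟩
  · exact integrableOn_const hfin
  · refine (ae_restrict_iff' hK).2 (Eventually.of_forall fun x hx => ?_)
    exact slice_t hF (hK1 hx)

def LocLip (u : ℝ → ℝ → ℝ) (S : Set ℝ) (p : ℝ × ℝ) : Prop :=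
  ∃ ε > 0, ∃ C : ℝ, ∀ t ∈ S, ∀ c ∈ S, |t - p.2| < ε → |c - p.2| < ε →
    ∫ x in Icc 0 1 ∩ Icc (p.1 - ε) (p.1 + ε), (u x c - u x t)^2 ≤ C * (c - t)^2

theorem int_sq {u : ℝ → ℝ → ℝ} {T : ℝ}
    (hu : ContinuousOn (fun p : ℝ × ℝ => u p.1 p.2) (Icc 0 1 ×ˢ Icc 0 T)) {t c : ℝ}
    (ht : t ∈ Icc 0 T) (hc : c ∈ Icc 0 T) :
    IntegrableOn (fun x => (u x c - u x t)^2) (Icc 0 1) :=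
  (((slice_x hu hc).sub (slice_x hu ht)).pow 2).integrableOn_compact isCompact_Icc

theorem loc_cover {u : ℝ → ℝ → ℝ} {T : ℝ}
    (hu : ContinuousOn (fun p : ℝ × ℝ => u p.1 p.2) (Icc 0 1 ×ˢ Icc 0 T)) {S : Set ℝ}
    (hST : S ⊆ Ioo 0 T) {K : Set ℝ} (hK : IsCompact K) (hK1 : K ⊆ Icc 0 1) {t0 : ℝ}
    (hL : ∀ x ∈ K, LocLip u S (x, t0)) :
    ∃ ε > 0, ∃ C : ℝ, ∀ t ∈ S, ∀ c ∈ S, |t - t0| < ε → |c - t0| < ε →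
      ∫ x in K, (u x c - u x t)^2 ≤ C * (c - t)^2 := by
  have hI : ∀ t ∈ S, ∀ c ∈ S, IntegrableOn (fun x => (u x c - u x t)^2) (Icc 0 1) :=
    fun t ht c hc => int_sq hu (Ioo_subset_Icc_self (hST ht)) (Ioo_subset_Icc_self (hST hc))
  have main := hK.induction_on (p := fun A => ∃ ε > 0, ∃ C : ℝ, ∀ t ∈ S, ∀ c ∈ S, |t - t0| < ε →
      |c - t0| < ε → ∫ x in Icc 0 1 ∩ A, (u x c - u x t)^2 ≤ C * (c - t)^2)
    ⟨1, one_pos, 0, by simp⟩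
    (by
      rintro s t hst ⟨ε, hε, C, h⟩
      refine ⟨ε, hε, C, fun a ha b hb h1 h2 => le_trans ?_ (h a ha b hb h1 h2)⟩
      refine setIntegral_mono_set ((hI a ha b hb).mono_set inter_subset_left)
        (Eventually.of_forall fun x => sq_nonneg _) ?_
      exact (inter_subset_inter_right _ hst).eventuallyLE)
    (by
      rintro s t ⟨ε, hε, C, h⟩ ⟨ε', hε', C', h'⟩
      refine ⟨min ε ε', lt_min hε hε', C + C', fun a ha b hb h1 h2 => ?_⟩
      have e1 := h a ha b hb (h1.trans_le (min_le_left _ _)) (h2.trans_le (min_le_left _ _))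
      have e2 := h' a ha b hb (h1.trans_le (min_le_right _ _)) (h2.trans_le (min_le_right _ _))
      have i1 := (hI a ha b hb).mono_set (inter_subset_left (s := Icc (0:ℝ) 1) (t := s))
      have i2 := (hI a ha b hb).mono_set (inter_subset_left (s := Icc (0:ℝ) 1) (t := t))
      rw [inter_union_distrib_left]
      have e3 : ∫ x in (Icc 0 1 ∩ s ∪ Icc 0 1 ∩ t), (u x b - u x a)^2 ≤
          ∫ x, (u x b - u x a)^2 ∂(volume.restrict (Icc 0 1 ∩ s) + volume.restrict (Icc 0 1 ∩ t)) :=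
        integral_mono_measure (Measure.restrict_union_le _ _)
          (Eventually.of_forall fun x => sq_nonneg _) (Integrable.add_measure i1 i2)
      rw [integral_add_measure i1 i2] at e3
      linarith)
    (by
      intro x hx
      obtain ⟨ε, hε, C, h⟩ := hL x hx
      exact ⟨Icc (x - ε) (x + ε), mem_nhdsWithin_of_mem_nhds
        (Icc_mem_nhds (by linarith) (by linarith)), ε, hε, C, h⟩)
  rwa [inter_eq_right.2 hK1] at main

/-- the bound away from the exceptional set, by real induction along `S` -/
theorem compact_bound {u ut : ℝ → ℝ → ℝ} {T : ℝ}
    (hu : ContinuousOn (fun p : ℝ × ℝ => u p.1 p.2) (Icc 0 1 ×ˢ Icc 0 T)) {S : Set ℝ}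
    (hS : IsCompact S) (hST : S ⊆ Ioo 0 T)
    (hd : ∀ x ∈ Icc (0:ℝ) 1, ∀ t ∈ S, HasDerivAt (fun s => u x s) (ut x t) t)
    (C : ℝ) (hC : 0 ≤ C) (hN : ∀ t ∈ S, ∀ x ∈ Ioo (0:ℝ) 1, |ut x t| ≤ C)
    (hgap : ∀ c ∈ S, ∀ d ∈ S, c < d → (∀ s ∈ Ioo c d, s ∉ S) →
      ∫ x in Icc 0 1, (u x d - u x c)^2 ≤ C^2 * (d - c)^2)
    {K : Set ℝ} (hK : IsCompact K) (hK1 : K ⊆ Icc 0 1) {t c : ℝ} (ht : t ∈ S) (hc : c ∈ S)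
    (htc : t < c) (hL : ∀ x ∈ K, ∀ s ∈ S, s ∈ Icc t c → LocLip u S (x, s)) :
    ∫ x in K, (u x c - u x t)^2 ≤ C^2 * (c - t)^2 := by
  have hST' : S ⊆ Icc 0 T := hST.trans Ioo_subset_Icc_self
  set w : ℝ → ℝ := fun x => u x c - u x t with hw
  have hwc : ContinuousOn w (Icc 0 1) := (slice_x hu (hST' hc)).sub (slice_x hu (hST' ht))
  have hcs : ∀ s ∈ S, ContinuousOn (fun x => u x s) (Icc 0 1) := fun s hs => slice_x hu (hST' hs)
  obtain ⟨B, hB⟩ := isCompact_Icc.exists_bound_of_continuousOn hwc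
  have hKm := hK.measurableSet
  have hfinK : volume K ≤ 1 := (measure_mono hK1).trans (by simp)
  have : IsFiniteMeasure (volume.restrict K) := ⟨by
    rw [Measure.restrict_apply_univ]; exact hfinK.trans_lt (by simp)⟩
  have hInteg : ∀ g : ℝ → ℝ, ContinuousOn g (Icc 0 1) → IntegrableOn g K := fun g hg =>
    (hg.integrableOn_compact isCompact_Icc).mono_set hK1
  set τ := c - t with hτ
  have hτ0 : 0 < τ := sub_pos.2 htc
  set W2 := ∫ x in K, (w x)^2 with hW2
  have hiW : IntegrableOn (fun x => (w x)^2) K := hInteg _ (hwc.pow 2)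
  set f : ℝ → ℝ := fun s => ∫ x in K, w x * u x s with hf
  have hfcont : ContinuousOn f (Icc 0 T) := by
    apply cont_int _ hKm hK1
    exact (hwc.comp continuousOn_fst (fun p hp => hp.1)).mul hu
  have hfdiff : ∀ s ∈ S, ∀ s' ∈ S, f s' - f s = ∫ x in K, w x * (u x s' - u x s) := by
    intro s hs s' hs'
    rw [hf]
    simp only
    have i1 : IntegrableOn (fun x => w x * u x s') K := hInteg _ (hwc.mul (hcs s' hs'))
    have i2 : IntegrableOn (fun x => w x * u x s) K := hInteg _ (hwc.mul (hcs s hs))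
    rw [← integral_sub i1 i2]
    congr 1; ext x; ring
  have hW : f c - f t = W2 := by
    rw [hfdiff t ht c hc]; congr 1; ext x; simp only [hw]; ring
  set Q := W2 / (2 * τ) + τ * C^2 / 2 with hQ
  suffices hη : ∀ η > 0, f c - f t ≤ (Q + η) * τ by
    have h1 : f c - f t ≤ Q * τ := by
      refine le_of_forall_pos_le_add fun e he => ?_
      have := hη (e / τ) (by positivity)
      have h2 : (Q + e / τ) * τ = Q * τ + e := by field_simp
      linarith
    have h2 : Q * τ = W2 / 2 + C^2 * τ^2 / 2 := by rw [hQ]; field_simp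
    rw [hW, h2] at h1
    linarith
  intro η hη
  set G := {s ∈ S ∩ Icc t c | f s - f t ≤ (Q + η) * (s - t)} with hG
  have hGcl : IsCompact G := by
    have hSI : IsCompact (S ∩ Icc t c) := hS.inter isCompact_Icc
    refine hSI.of_isClosed_subset ?_ (fun x hx => hx.1)
    have : ContinuousOn (fun s => f s - f t - (Q + η) * (s - t)) (S ∩ Icc t c) := by
      have := hfcont.mono (show S ∩ Icc t c ⊆ Icc 0 T from fun x hx => hST' hx.1)
      fun_prop
    have h2 := this.preimage_isClosed_of_isClosed hSI.isClosed (isClosed_Iic (a := (0:ℝ)))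
    convert h2 using 1
    ext s; simp [hG]
  have hGne : G.Nonempty := ⟨t, ⟨ht, left_mem_Icc.2 htc.le⟩, by simp⟩
  obtain ⟨s0, hs0, hmax⟩ := hGcl.exists_isGreatest hGne
  obtain ⟨⟨hs0S, hs0I⟩, hs0f⟩ := hs0
  rcases hs0I.2.eq_or_lt with h | hlt
  · rw [← h]; rw [h] at hs0f; rw [h]; exact hs0f
  exfalso
  -- it suffices to find a later point with small slope
  have hnext : ∃ s' ∈ S, s0 < s' ∧ s' ≤ c ∧ f s' - f s0 ≤ (Q + η) * (s' - s0) := by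
    by_cases hne : (𝓝[S ∩ Ioi s0] s0).NeBot
    · -- accumulation from the right
      obtain ⟨ε, hε, C', hC'⟩ := loc_cover hu hST hK hK1 (t0 := s0) (fun x hx => hL x hx s0 hs0S hs0I)
      have hle : 𝓝[S ∩ Ioi s0] s0 ≤ 𝓝[>] s0 := nhdsWithin_mono _ inter_subset_right
      have hevS : ∀ᶠ s in 𝓝[S ∩ Ioi s0] s0, s ∈ S ∧ s0 < s := self_mem_nhdsWithin
      have hevε : ∀ᶠ s in 𝓝[S ∩ Ioi s0] s0, |s - s0| < ε :=
        mem_nhdsWithin_of_mem_nhds (by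
          have := Metric.ball_mem_nhds s0 hε
          filter_upwards [this] with s hs; simpa [Real.dist_eq] using hs)
      have hevc : ∀ᶠ s in 𝓝[S ∩ Ioi s0] s0, s < c := mem_nhdsWithin_of_mem_nhds (Iio_mem_nhds hlt)
      have haeK : ∀ᵐ x ∂(volume.restrict K), x ∈ K ∧ x ∈ Ioo (0:ℝ) 1 := by
        have h0 : ∀ᵐ x ∂(volume.restrict K), x ≠ 0 :=
          ae_restrict_of_ae (by simp [ae_iff])
        have h1 : ∀ᵐ x ∂(volume.restrict K), x ≠ 1 :=
          ae_restrict_of_ae (by simp [ae_iff])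
        filter_upwards [h0, h1, ae_restrict_mem hKm] with x h0 h1 hx
        exact ⟨hx, lt_of_le_of_ne (hK1 hx).1 (Ne.symm h0), lt_of_le_of_ne (hK1 hx).2 h1⟩
      have key := deriv_int (μ := volume.restrict K) (l := 𝓝[S ∩ Ioi s0] s0) s0 hle
        (fun s x => w x * u x s) (fun x => w x * ut x s0) (B * C) (B^2 * C')
        (by
          filter_upwards [haeK] with x hx
          rw [abs_mul]
          have h1 := hB x (hK1 hx.1)
          rw [Real.norm_eq_abs] at h1
          exact mul_le_mul h1 (hN s0 hs0S x hx.2) (abs_nonneg _) ((abs_nonneg _).trans h1))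
        (by
          filter_upwards [haeK] with x hx
          have h1 := (hasDerivAt_iff_tendsto_slope.1 (hd x (hK1 hx.1) s0 hs0S))
          have h2 : 𝓝[S ∩ Ioi s0] s0 ≤ 𝓝[≠] s0 := nhdsWithin_mono _ (fun y hy => (ne_of_gt hy.2))
          have h3 := (h1.mono_left h2).const_mul (w x)
          refine h3.congr fun s => ?_
          rw [slope_def_field]; ring)
        (by
          filter_upwards [hevS] with s hs
          exact (hInteg _ (hwc.mul (hcs s hs.1))).aestronglyMeasurable)
        ((hInteg _ (hwc.mul (hcs s0 hs0S))).aestronglyMeasurable)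
        (by
          filter_upwards [hevS] with s hs
          exact hInteg _ (((hwc.mul (hcs s hs.1)).sub (hwc.mul (hcs s0 hs0S))).pow 2))
        (by
          filter_upwards [hevS, hevε] with s hs hsε
          have h1 := hC' s0 hs0S s hs.1 (by simpa using hε) hsε
          have h2 : ∫ x in K, (w x * u x s - w x * u x s0)^2 ≤ ∫ x in K, B^2 * (u x s - u x s0)^2 := by
            refine setIntegral_mono_on (hInteg _ (((hwc.mul (hcs s hs.1)).sub (hwc.mul (hcs s0 hs0S))).pow 2))
              ((hInteg _ (((hcs s hs.1).sub (hcs s0 hs0S)).pow 2)).const_mul _) hKm ?_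
            intro x hx
            rw [← mul_sub, mul_pow]
            have h1 := hB x (hK1 hx)
            rw [Real.norm_eq_abs] at h1
            have h9 : (w x)^2 ≤ B^2 := by
              rw [← sq_abs]; exact pow_le_pow_left₀ (abs_nonneg _) h1 2
            exact mul_le_mul_of_nonneg_right h9 (sq_nonneg _)
          rw [integral_const_mul] at h2
          calc _ ≤ _ := h2
            _ ≤ B^2 * (C' * (s - s0)^2) := by gcongr
            _ = _ := by ring)
      have hder : ∫ x in K, w x * ut x s0 ≤ Q := by
        have h1 : ∫ x in K, w x * ut x s0 ≤ ∫ x in K, ((w x)^2 / (2 * τ) + τ * C^2 / 2) := by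
          by_cases hi : IntegrableOn (fun x => w x * ut x s0) K
          · refine integral_mono_ae hi ((hiW.div_const _).add (integrable_const _)) ?_
            filter_upwards [haeK] with x hx
            have h3 := hN s0 hs0S x hx.2
            have h4 : (ut x s0)^2 ≤ C^2 := by rw [← sq_abs]; gcongr
            have h5 : w x * ut x s0 ≤ (w x)^2 / (2 * τ) + τ * (ut x s0)^2 / 2 := by
              have : (w x)^2 / (2 * τ) + τ * (ut x s0)^2 / 2 - w x * ut x s0 =
                (w x - τ * ut x s0)^2 / (2 * τ) := by field_simp; ring
              have h6 : 0 ≤ (w x - τ * ut x s0)^2 / (2 * τ) := by positivity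
              linarith
            have h7 : τ * (ut x s0)^2 ≤ τ * C^2 := by gcongr
            linarith
          · rw [integral_undef hi]
            exact integral_nonneg fun x => by positivity
        refine h1.trans ?_
        rw [integral_add (hiW.div_const _) (integrable_const _), integral_div, integral_const]
        have h2 : (volume.restrict K).real univ ≤ 1 := by
          rw [measureReal_def, Measure.restrict_apply_univ]
          exact ENNReal.toReal_le_of_le_ofReal zero_le_one (by simpa using hfinK)
        rw [hQ, smul_eq_mul]
        have h3 : 0 ≤ τ * C^2 / 2 := by positivity
        nlinarith
      have hev := (key.eventually (Iio_mem_nhds (show ∫ x in K, w x * ut x s0 < Q + η by linarith)))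
      obtain ⟨s', hs'1, hs'2, hs'3⟩ := (hev.and (hevS.and hevc)).exists
      refine ⟨s', hs'2.1, hs'2.2, hs'3.le, ?_⟩
      have hpos : 0 < s' - s0 := sub_pos.2 hs'2.2
      change _ < _ at hs'1
      rw [integral_div, div_lt_iff₀ hpos] at hs'1
      rw [hfdiff s0 hs0S s' hs'2.1]
      simp only [mul_sub] at hs'1 ⊢
      linarith
    · -- a gap
      have h1 : ∃ ε > 0, ∀ s ∈ S, s0 < s → s0 + ε ≤ s := by
        by_contra hcon
        push Not at hcon
        apply hne
        rw [← mem_closure_iff_nhdsWithin_neBot, Metric.mem_closure_iff]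
        intro ε hε
        obtain ⟨s, hs, h1, h2⟩ := hcon ε hε
        refine ⟨s, ⟨hs, h1⟩, ?_⟩
        rw [dist_comm, Real.dist_eq, abs_of_pos (by linarith)]; linarith
      obtain ⟨ε, hε, h1⟩ := h1
      have hcomp : IsCompact (S ∩ Icc (s0 + ε) c) := hS.inter isCompact_Icc
      obtain ⟨d, hd', hmin⟩ := hcomp.exists_isLeast ⟨c, hc, h1 c hc hlt, le_rfl⟩
      have hs0d : s0 < d := by linarith [hd'.2.1]
      refine ⟨d, hd'.1, hs0d, hd'.2.2, ?_⟩
      have hg := hgap s0 hs0S d hd'.1 hs0d (fun s hs hsS => by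
        have := hmin ⟨hsS, h1 s hsS hs.1, hs.2.le.trans hd'.2.2⟩
        linarith [hs.2])
      have hpos : 0 < d - s0 := sub_pos.2 hs0d
      have hv : ContinuousOn (fun x => (u x d - u x s0)^2) (Icc 0 1) :=
        (((hcs d hd'.1).sub (hcs s0 hs0S)).pow 2)
      have hg2 : ∫ x in K, (u x d - u x s0)^2 ≤ C^2 * (d - s0)^2 :=
        (setIntegral_mono_set (hv.integrableOn_compact isCompact_Icc)
          (Eventually.of_forall fun x => sq_nonneg _) hK1.eventuallyLE).trans hg
      rw [hfdiff s0 hs0S d hd'.1]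
      set h := d - s0
      have h3 : ∫ x in K, w x * (u x d - u x s0) ≤
          ∫ x in K, (h / (2 * τ) * (w x)^2 + τ / (2 * h) * (u x d - u x s0)^2) := by
        refine integral_mono (hInteg _ (hwc.mul ((hcs d hd'.1).sub (hcs s0 hs0S))))
          ((hiW.const_mul _).add ((hInteg _ hv).const_mul _)) fun x => ?_
        have : h / (2 * τ) * (w x)^2 + τ / (2 * h) * (u x d - u x s0)^2 - w x * (u x d - u x s0) =
          (h * w x - τ * (u x d - u x s0))^2 / (2 * τ * h) := by field_simp; ring
        have h6 : 0 ≤ (h * w x - τ * (u x d - u x s0))^2 / (2 * τ * h) := by positivity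
        linarith
      rw [integral_add (hiW.const_mul _) ((hInteg _ hv).const_mul _), integral_const_mul,
        integral_const_mul] at h3
      have h4 : τ / (2 * h) * ∫ x in K, (u x d - u x s0)^2 ≤ τ / (2 * h) * (C^2 * h^2) := by gcongr
      have h5 : τ / (2 * h) * (C^2 * h^2) + h / (2 * τ) * W2 = Q * h := by
        rw [hQ]; field_simp; ring
      have h6 : 0 ≤ η * h := by positivity
      simp only [← hW2] at h3
      nlinarith
  obtain ⟨s', hs'S, h1, h2, h3⟩ := hnext
  have : s' ∈ G := ⟨⟨hs'S, hs0I.1.trans h1.le, h2⟩, by nlinarith⟩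
  exact absurd (hmax this) (not_le.2 h1)

theorem LocLip.open {u : ℝ → ℝ → ℝ} {T : ℝ}
    (hu : ContinuousOn (fun p : ℝ × ℝ => u p.1 p.2) (Icc 0 1 ×ˢ Icc 0 T)) {S : Set ℝ}
    (hST : S ⊆ Icc 0 T) : IsOpen {p | LocLip u S p} := by
  rw [Metric.isOpen_iff]
  rintro p ⟨ε, hε, C, h⟩
  refine ⟨ε / 2, by positivity, fun q hq => ?_⟩
  rw [Metric.mem_ball, Prod.dist_eq, max_lt_iff, Real.dist_eq, Real.dist_eq] at hq
  obtain ⟨h1, h2⟩ := hq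
  rw [abs_lt] at h1 h2
  refine ⟨ε / 2, by positivity, C, fun t ht c hc h3 h4 => le_trans ?_ (h t ht c hc ?_ ?_)⟩
  · refine setIntegral_mono_set ((int_sq hu (hST ht) (hST hc)).mono_set inter_subset_left)
      (Eventually.of_forall fun x => sq_nonneg _) ?_
    refine (inter_subset_inter_right _ ?_).eventuallyLE
    exact Icc_subset_Icc (by linarith) (by linarith)
  · rw [abs_lt] at h3 ⊢; constructor <;> linarith
  · rw [abs_lt] at h4 ⊢; constructor <;> linarith

theorem pt_lip {f : ℝ → ℝ} {T t : ℝ} (hf : ContinuousOn f (Icc 0 T)) (ht : t ∈ Ioo 0 T)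
    (hd : DifferentiableAt ℝ f t) : ∃ n : ℕ, ∀ s ∈ Icc 0 T, |f s - f t| ≤ n * |s - t| := by
  have h1 : ContinuousOn (dslope f t) (Icc 0 T) :=
    (continuousOn_dslope (Icc_mem_nhds ht.1 ht.2)).2 ⟨hf, hd⟩
  obtain ⟨B, hB⟩ := isCompact_Icc.exists_bound_of_continuousOn h1
  obtain ⟨n, hn⟩ := exists_nat_ge B
  refine ⟨n, fun s hs => ?_⟩
  have h2 := sub_smul_dslope f t s
  rw [← h2, smul_eq_mul, abs_mul, mul_comm]
  exact mul_le_mul_of_nonneg_right ((hB s hs).trans hn) (abs_nonneg _)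

theorem locLip_all {u ut : ℝ → ℝ → ℝ} {T : ℝ}
    (hu : ContinuousOn (fun p : ℝ × ℝ => u p.1 p.2) (Icc 0 1 ×ˢ Icc 0 T)) {S : Set ℝ}
    (hS : IsCompact S) (hST : S ⊆ Ioo 0 T)
    (hd : ∀ x ∈ Icc (0:ℝ) 1, ∀ t ∈ S, HasDerivAt (fun s => u x s) (ut x t) t)
    (C : ℝ) (hC : 0 ≤ C) (hN : ∀ t ∈ S, ∀ x ∈ Ioo (0:ℝ) 1, |ut x t| ≤ C)
    (hgap : ∀ c ∈ S, ∀ d ∈ S, c < d → (∀ s ∈ Ioo c d, s ∉ S) →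
      ∫ x in Icc 0 1, (u x d - u x c)^2 ≤ C^2 * (d - c)^2) :
    ∀ p ∈ Icc (0:ℝ) 1 ×ˢ S, LocLip u S p := by
  have hST' : S ⊆ Icc 0 T := hST.trans Ioo_subset_Icc_self
  set E : Set (ℝ × ℝ) := (Icc (0:ℝ) 1 ×ˢ S) ∩ {p | LocLip u S p}ᶜ with hE
  have hEc : IsCompact E :=
    (isCompact_Icc.prod hS).inter_right (LocLip.open hu hST').isClosed_compl
  by_contra hcon
  push Not at hcon
  obtain ⟨p, hp1, hp2⟩ := hcon
  have hEsub : E ⊆ Icc (0:ℝ) 1 ×ˢ Icc 0 T := fun q hq => ⟨hq.1.1, hST' hq.1.2⟩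
  obtain ⟨n, p, hp, r, hr, hF⟩ := baire_closed E hEc.isClosed ⟨p, hp1, hp2⟩
    (fun n => {p | ∀ s ∈ Icc 0 T, |u p.1 s - u p.1 p.2| ≤ n * |s - p.2|})
    (by
      intro n
      have : E ∩ {p : ℝ × ℝ | ∀ s ∈ Icc 0 T, |u p.1 s - u p.1 p.2| ≤ n * |s - p.2|} =
        E ∩ ⋂ s ∈ Icc 0 T, (E ∩ (fun p : ℝ × ℝ => |u p.1 s - u p.1 p.2| - n * |s - p.2|) ⁻¹' Iic 0) := by
        ext q
        simp only [mem_inter_iff, mem_ofPred_eq, mem_iInter, mem_preimage, mem_Iic, sub_nonpos]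
        constructor
        · rintro ⟨h1, h2⟩
          exact ⟨h1, fun s hs => ⟨h1, h2 s hs⟩⟩
        · rintro ⟨h1, h2⟩
          exact ⟨h1, fun s hs => (h2 s hs).2⟩
      rw [this]
      refine hEc.isClosed.inter (isClosed_biInter fun s hs => ?_)
      refine ContinuousOn.preimage_isClosed_of_isClosed ?_ hEc.isClosed isClosed_Iic
      have h1 : ContinuousOn (fun p : ℝ × ℝ => u p.1 s) E :=
        (slice_x hu hs).comp continuousOn_fst (fun q hq => hq.1.1)
      have h2 : ContinuousOn (fun p : ℝ × ℝ => u p.1 p.2) E := hu.mono hEsub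
      have h3 : Continuous (fun p : ℝ × ℝ => (n:ℝ) * |s - p.2|) := by fun_prop
      exact (h1.sub h2).abs.sub h3.continuousOn)
    (by
      intro q hq
      obtain ⟨n, hn⟩ := pt_lip (slice_t hu hq.1.1) (hST hq.1.2) (hd _ hq.1.1 _ hq.1.2).differentiableAt
      exact mem_iUnion.2 ⟨n, hn⟩)
  apply hp.2
  set ε := r / 2 with hε
  have hε0 : 0 < ε := by positivity
  set J := Icc (0:ℝ) 1 ∩ Icc (p.1 - ε) (p.1 + ε) with hJ
  have hJc : IsCompact J := isCompact_Icc.inter isCompact_Icc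
  have hJ1 : J ⊆ Icc 0 1 := inter_subset_left
  have main : ∀ t ∈ S, ∀ c ∈ S, |t - p.2| < ε → |c - p.2| < ε → t < c →
      ∫ x in J, (u x c - u x t)^2 ≤ (n^2 + C^2) * (c - t)^2 := by
    intro t ht c hc ht1 hc1 htc
    set A : Set ℝ := Prod.fst '' (E ∩ J ×ˢ Icc t c) with hA
    have hAc : IsCompact A :=
      (hEc.inter_right (hJc.isClosed.prod isClosed_Icc)).image continuous_fst
    have hAJ : A ⊆ J := by
      rintro _ ⟨q, hq, rfl⟩
      exact hq.2.1
    have hInteg : IntegrableOn (fun x => (u x c - u x t)^2) (Icc 0 1) := int_sq hu (hST' ht) (hST' hc)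
    have hA1 : ∀ x ∈ A, (u x c - u x t)^2 ≤ n^2 * (c - t)^2 := by
      rintro _ ⟨q, hq, rfl⟩
      have hq2 := hq.2.2
      have hq1 := hq.2.1.2
      have hqF := hF q hq.1 (by
        rw [abs_lt] at ht1 hc1
        rw [Prod.dist_eq, max_lt_iff, Real.dist_eq, Real.dist_eq, abs_lt, abs_lt]
        refine ⟨⟨?_, ?_⟩, ?_, ?_⟩ <;> linarith [hq1.1, hq1.2, hq2.1, hq2.2])
      have e1 := hqF c (hST' hc)
      have e2 := hqF t (hST' ht)
      rw [abs_of_nonneg (by linarith [hq2.2] : 0 ≤ c - q.2)] at e1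
      rw [abs_sub_comm t q.2, abs_of_nonneg (by linarith [hq2.1] : 0 ≤ q.2 - t)] at e2
      rw [abs_le] at e1 e2
      rw [← mul_pow]
      apply sq_le_sq' <;> nlinarith [e1.1, e1.2, e2.1, e2.2]
    have e1 : ∫ x in A, (u x c - u x t)^2 ≤ n^2 * (c - t)^2 := by
      have : ∫ x in A, (u x c - u x t)^2 ≤ ∫ x in A, (n^2 * (c - t)^2 : ℝ) := by
        refine setIntegral_mono_on (hInteg.mono_set (hAJ.trans hJ1)) ?_ hAc.measurableSet hA1
        exact integrableOn_const (hAc.measure_lt_top.ne)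
      refine this.trans ?_
      rw [setIntegral_const, smul_eq_mul]
      have h2 : volume.real A ≤ 1 := by
        rw [measureReal_def]
        refine ENNReal.toReal_le_of_le_ofReal zero_le_one ?_
        exact (measure_mono (hAJ.trans hJ1)).trans (by simp)
      have h3 : (0:ℝ) ≤ n^2 * (c - t)^2 := by positivity
      nlinarith
    set Kk : ℕ → Set ℝ := fun k => {x ∈ J | ∀ y ∈ A, 1 / ((k:ℝ) + 1) ≤ dist x y} with hKk
    have hKc : ∀ k, IsCompact (Kk k) := by
      intro k
      refine hJc.of_isClosed_subset ?_ (fun x hx => hx.1)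
      have : Kk k = J ∩ ⋂ y ∈ A, {x | 1 / ((k:ℝ) + 1) ≤ dist x y} := by
        ext x; simp [hKk]
      rw [this]
      refine hJc.isClosed.inter (isClosed_biInter fun y _ => ?_)
      exact isClosed_le continuous_const (by fun_prop)
    have e2 : ∀ k, ∫ x in Kk k, (u x c - u x t)^2 ≤ C^2 * (c - t)^2 := by
      intro k
      refine compact_bound hu hS hST hd C hC hN hgap (hKc k) (fun x hx => hJ1 hx.1) ht hc htc ?_
      intro x hx s hs hst
      by_contra hL
      have : x ∈ A := ⟨(x, s), ⟨⟨⟨hJ1 hx.1, hs⟩, hL⟩, hx.1, hst⟩, rfl⟩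
      have h2 := hx.2 x this
      rw [dist_self] at h2
      have : 0 < 1 / ((k:ℝ) + 1) := by positivity
      linarith
    have hU : ⋃ k, Kk k = J \ A := by
      ext x
      simp only [mem_iUnion, mem_diff]
      constructor
      · rintro ⟨k, hx⟩
        refine ⟨hx.1, fun hxA => ?_⟩
        have h2 := hx.2 x hxA
        rw [dist_self] at h2
        have : 0 < 1 / ((k:ℝ) + 1) := by positivity
        linarith
      · rintro ⟨h1, h2⟩
        rw [← hAc.isClosed.closure_eq, Metric.mem_closure_iff] at h2
        push Not at h2
        obtain ⟨e, he, h2⟩ := h2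
        obtain ⟨k, hk⟩ := exists_nat_one_div_lt he
        exact ⟨k, h1, fun y hy => hk.le.trans (h2 y hy)⟩
    have hmono : Monotone Kk := by
      intro k l hkl x hx
      refine ⟨hx.1, fun y hy => le_trans ?_ (hx.2 y hy)⟩
      apply one_div_le_one_div_of_le (by positivity)
      have : (k:ℝ) ≤ l := by exact_mod_cast hkl
      linarith
    have hlim := tendsto_setIntegral_of_monotone (μ := volume) (f := fun x => (u x c - u x t)^2)
      (fun k => (hKc k).measurableSet) hmono (by
        rw [hU]; exact hInteg.mono_set (diff_subset.trans hJ1))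
    have e3 := le_of_tendsto' hlim e2
    rw [hU] at e3
    have e4 := integral_diff hAc.measurableSet (hInteg.mono_set hJ1) hAJ
    rw [e4] at e3
    linarith
  refine ⟨ε, hε0, n^2 + C^2, fun t ht c hc h1 h2 => ?_⟩
  rcases lt_trichotomy t c with h | h | h
  · exact main t ht c hc h1 h2 h
  · subst h; simp
  · have := main c hc t ht h2 h1 h
    have e : ∀ x, (u x c - u x t)^2 = (u x t - u x c)^2 := fun x => by ring
    simp only [e]
    rw [show (c - t)^2 = (t - c)^2 by ring]
    exact this

theorem abs_lip {u ut : ℝ → ℝ → ℝ} {T : ℝ}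
    (hu : ContinuousOn (fun p : ℝ × ℝ => u p.1 p.2) (Icc 0 1 ×ˢ Icc 0 T)) {S : Set ℝ}
    (hS : IsCompact S) (hST : S ⊆ Ioo 0 T)
    (hd : ∀ x ∈ Icc (0:ℝ) 1, ∀ t ∈ S, HasDerivAt (fun s => u x s) (ut x t) t)
    (C : ℝ) (hC : 0 ≤ C) (hN : ∀ t ∈ S, ∀ x ∈ Ioo (0:ℝ) 1, |ut x t| ≤ C)
    (hgap : ∀ c ∈ S, ∀ d ∈ S, c < d → (∀ s ∈ Ioo c d, s ∉ S) →
      ∫ x in Icc 0 1, (u x d - u x c)^2 ≤ C^2 * (d - c)^2) {t0 : ℝ} (ht0 : t0 ∈ S) :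
    ∃ ε > 0, ∃ C : ℝ, ∀ c ∈ S, |c - t0| < ε →
      ∫ x in Icc 0 1, (u x c - u x t0)^2 ≤ C * (c - t0)^2 := by
  obtain ⟨ε, hε, C', h⟩ := loc_cover hu hST isCompact_Icc subset_rfl (t0 := t0)
    (fun x hx => locLip_all hu hS hST hd C hC hN hgap (x, t0) ⟨hx, ht0⟩)
  exact ⟨ε, hε, C', fun c hc h1 => h t0 ht0 c hc (by simpa using hε) h1⟩

def RGood (u : ℝ → ℝ → ℝ) (t : ℝ) : Prop :=
  ∃ C : ℝ, ∀ᶠ s in 𝓝[>] t, ∫ x in Icc 0 1, (u x s - u x t)^2 ≤ C * (s - t)^2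

theorem ae_Ioo01 : ∀ᵐ x ∂(volume.restrict (Icc (0:ℝ) 1)), x ∈ Ioo (0:ℝ) 1 := by
  have h0 : ∀ᵐ x ∂(volume.restrict (Icc (0:ℝ) 1)), x ≠ 0 :=
    ae_restrict_of_ae (by simp [ae_iff])
  have h1 : ∀ᵐ x ∂(volume.restrict (Icc (0:ℝ) 1)), x ≠ 1 :=
    ae_restrict_of_ae (by simp [ae_iff])
  filter_upwards [h0, h1, ae_restrict_mem measurableSet_Icc] with x h0 h1 hx
  exact ⟨lt_of_le_of_ne hx.1 (Ne.symm h0), lt_of_le_of_ne hx.2 h1⟩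

theorem rd {u g : ℝ → ℝ → ℝ} {T : ℝ}
    (hu : ContinuousOn (fun p : ℝ × ℝ => u p.1 p.2) (Icc 0 1 ×ˢ Icc 0 T)) {t : ℝ}
    (ht : t ∈ Ioo 0 T) (hG : RGood u t)
    (hg : ContinuousOn (fun p : ℝ × ℝ => g p.1 (u p.1 p.2)) (Icc 0 1 ×ˢ Icc 0 T))
    (L : ℝ) (hL : ∀ x ∈ Icc (0:ℝ) 1, ∀ s ∈ Icc 0 T, |g x (u x s) - g x (u x t)| ≤ L * |u x s - u x t|)
    (h' : ℝ → ℝ) (hd : ∀ x ∈ Ioo (0:ℝ) 1, HasDerivAt (fun s => g x (u x s)) (h' x) t)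
    (N : ℝ) (hN : ∀ x ∈ Ioo (0:ℝ) 1, |h' x| ≤ N) :
    HasDerivWithinAt (fun s => ∫ x in Icc 0 1, g x (u x s)) (∫ x in Icc 0 1, h' x) (Ioi t) t := by
  obtain ⟨C, hC⟩ := hG
  have htI : t ∈ Icc 0 T := Ioo_subset_Icc_self ht
  have hev : ∀ᶠ s in 𝓝[>] t, s ∈ Icc 0 T :=
    mem_nhdsWithin_of_mem_nhds (Icc_mem_nhds ht.1 ht.2)
  have hgs : ∀ s ∈ Icc 0 T, ContinuousOn (fun x => g x (u x s)) (Icc 0 1) :=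
    fun s hs => slice_x (u := fun x t => g x (u x t)) hg hs
  have hgi : ∀ s ∈ Icc 0 T, IntegrableOn (fun x => g x (u x s)) (Icc 0 1) :=
    fun s hs => (hgs s hs).integrableOn_compact isCompact_Icc
  have hgi2 : ∀ s ∈ Icc 0 T, IntegrableOn (fun x => (g x (u x s) - g x (u x t))^2) (Icc 0 1) :=
    fun s hs => (((hgs s hs).sub (hgs t htI)).pow 2).integrableOn_compact isCompact_Icc
  have key := deriv_int (μ := volume.restrict (Icc (0:ℝ) 1)) (l := 𝓝[>] t) t le_rfl
    (fun s x => g x (u x s)) h' N (L^2 * C)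
    (by filter_upwards [ae_Ioo01] with x hx using hN x hx)
    (by
      filter_upwards [ae_Ioo01] with x hx
      have h1 := (hasDerivAt_iff_tendsto_slope.1 (hd x hx))
      have h2 : 𝓝[>] t ≤ 𝓝[≠] t := nhdsWithin_mono _ (fun y hy => (ne_of_gt hy))
      refine (h1.mono_left h2).congr fun s => ?_
      rw [slope_def_field])
    (by filter_upwards [hev] with s hs using (hgi s hs).aestronglyMeasurable)
    ((hgi t htI).aestronglyMeasurable)
    (by filter_upwards [hev] with s hs using hgi2 s hs)
    (by
      filter_upwards [hev, hC] with s hs hC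
      have h2 : ∫ x in Icc 0 1, (g x (u x s) - g x (u x t))^2 ≤
          ∫ x in Icc 0 1, L^2 * (u x s - u x t)^2 := by
        refine setIntegral_mono_on (hgi2 s hs) ((int_sq hu htI hs).const_mul _) measurableSet_Icc ?_
        intro x hx
        have := hL x hx s hs
        rw [← sq_abs, ← sq_abs (u x s - u x t), ← mul_pow]
        exact pow_le_pow_left₀ (abs_nonneg _) this 2
      rw [integral_const_mul] at h2
      calc _ ≤ _ := h2
        _ ≤ L^2 * (C * (s - t)^2) := by gcongr
        _ = _ := by ring)
  rw [hasDerivWithinAt_iff_tendsto_slope' (by simp)]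
  refine key.congr' ?_
  filter_upwards [hev] with s hs
  rw [slope_def_field, integral_div, integral_sub (hgi s hs) (hgi t htI)]

/-- right derivative of a weighted squared distance -/
theorem rd_sq {u : ℝ → ℝ → ℝ} {T : ℝ}
    (hu : ContinuousOn (fun p : ℝ × ℝ => u p.1 p.2) (Icc 0 1 ×ˢ Icc 0 T)) {t : ℝ}
    (ht : t ∈ Ioo 0 T) (hG : RGood u t) {r : ℝ → ℝ} (hr : ContinuousOn r (Icc 0 1))
    {ut : ℝ → ℝ} (hd : ∀ x ∈ Ioo (0:ℝ) 1, HasDerivAt (fun s => u x s) (ut x) t)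
    (N : ℝ) (hN : ∀ x ∈ Ioo (0:ℝ) 1, |ut x| ≤ N) :
    HasDerivWithinAt (fun s => ∫ x in Icc 0 1, (u x s - r x)^2)
      (∫ x in Icc 0 1, 2 * (u x t - r x) * ut x) (Ioi t) t := by
  have htI : t ∈ Icc 0 T := Ioo_subset_Icc_self ht
  have hw : ContinuousOn (fun p : ℝ × ℝ => u p.1 p.2 - r p.1) (Icc 0 1 ×ˢ Icc 0 T) :=
    hu.sub (hr.comp continuousOn_fst (fun p hp => hp.1))
  obtain ⟨B, hB⟩ := (isCompact_Icc.prod isCompact_Icc).exists_bound_of_continuousOn hw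
  simp only [Real.norm_eq_abs] at hB
  refine rd (g := fun x v => (v - r x)^2) hu ht hG (hw.pow 2) (2 * B) ?_ _ ?_ (2 * B * N) ?_
  · intro x hx s hs
    have h1 := hB (x, s) ⟨hx, hs⟩
    have h2 := hB (x, t) ⟨hx, htI⟩
    simp only at h1 h2
    rw [show (u x s - r x)^2 - (u x t - r x)^2 = ((u x s - r x) + (u x t - r x)) * (u x s - u x t) by
      ring, abs_mul]
    refine mul_le_mul_of_nonneg_right ((abs_add_le _ _).trans ?_) (abs_nonneg _)
    linarith
  · intro x hx
    have := ((hd x hx).sub_const (r x)).pow 2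
    exact this.congr_deriv (by norm_num)
  · intro x hx
    have h2 := hB (x, t) ⟨Ioo_subset_Icc_self hx, htI⟩
    simp only at h2
    rw [abs_mul, abs_mul, abs_two]
    have := hN x hx
    have hB0 : 0 ≤ B := (abs_nonneg _).trans h2
    gcongr

theorem abs_mul_le2 {x y X Y : ℝ} (hx : |x| ≤ X) (hy : |y| ≤ Y) : |x * y| ≤ X * Y := by
  rw [abs_mul]; exact mul_le_mul hx hy (abs_nonneg _) ((abs_nonneg _).trans hx)

theorem young (c a X : ℝ) (hc : 0 < c) : |a| * |X| ≤ c / 4 * a^2 + X^2 / c := by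
  rw [← sq_abs a, ← sq_abs X]
  have : c / 4 * |a|^2 + |X|^2 / c - |a| * |X| = (c * |a| / 2 - |X|)^2 / c := by field_simp; ring
  have h2 : 0 ≤ (c * |a| / 2 - |X|)^2 / c := by positivity
  linarith

theorem m3 {x y z R : ℝ} (hx : |x| ≤ R) (hy : |y| ≤ R) (hz : |z| ≤ R) : |x * y * z| ≤ R^3 := by
  have := abs_mul_le2 (abs_mul_le2 hx hy) hz
  calc _ ≤ _ := this
    _ = _ := by ring

theorem Fr_bound {r q r1 q1 r2 q2 R : ℝ} (hr : |r| ≤ R) (hq : |q| ≤ R) (hr1 : |r1| ≤ R)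
    (hq1 : |q1| ≤ R) (hr2 : |r2| ≤ R) (hq2 : |q2| ≤ R) :
    |r1 * (r1 * q + r * q1) + r * (r2 * q + 2 * r1 * q1 + r * q2)| ≤ 6 * R^3 := by
  have h1 := abs_le.1 (m3 hr1 hr1 hq)
  have h2 := abs_le.1 (m3 hr1 hr hq1)
  have h3 := abs_le.1 (m3 hr hr2 hq)
  have h4 := abs_le.1 (m3 hr hr hq2)
  rw [abs_le]
  constructor <;> nlinarith [h1.1, h1.2, h2.1, h2.2, h3.1, h3.2, h4.1, h4.2]

theorem Gq_bound {κ₁ κ₂ r r1 q1 q2 R : ℝ} (hκ₁ : 0 < κ₁) (hκ₂ : 0 < κ₂) (hr : |r| ≤ R) (hr1 : |r1| ≤ R)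
    (hq1 : |q1| ≤ R) (hq2 : |q2| ≤ R) :
    |(κ₁ + κ₂ * r^2) * q2 + 2 * κ₂ * r * r1 * q1| ≤ κ₁ * R + 3 * κ₂ * R^3 := by
  have h1 := abs_le.1 (m3 hr hr hq2)
  have h2 := abs_le.1 (m3 hr hr1 hq1)
  have h3 := abs_le.1 hq2
  rw [abs_le]
  constructor <;> nlinarith [mul_le_mul_of_nonneg_left h1.1 hκ₂.le, mul_le_mul_of_nonneg_left h1.2 hκ₂.le,
    mul_le_mul_of_nonneg_left h2.1 hκ₂.le, mul_le_mul_of_nonneg_left h2.2 hκ₂.le,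
    mul_le_mul_of_nonneg_left h3.1 hκ₁.le, mul_le_mul_of_nonneg_left h3.2 hκ₁.le]

theorem L1 {ρ θ r q r1 q1 a b c R e : ℝ} (hc : 0 < c) (hρ : |ρ| ≤ R)
    (hr : |r| ≤ R) (hq : |q| ≤ R) (hr1 : |r1| ≤ R) (hq1 : |q1| ≤ R)
    (hw : |ρ - r| ≤ e) (hz : |θ - q| ≤ e) (he : e ≤ 2) :
    -(a * (ρ * ((a + r1) * θ + ρ * (b + q1)) - r * (r1 * q + r * q1))) ≤
      -(ρ * θ * a^2) - ρ^2 * a * b + c / 4 * a^2 + (25 * R^4 * 2 / c) * e := by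
  have he0 : 0 ≤ e := (abs_nonneg _).trans hw
  have hR0 : 0 ≤ R := (abs_nonneg _).trans hr
  set X := (ρ * (θ - q) + q * (ρ - r)) * r1 + ((ρ - r) * (ρ + r)) * q1 with hX
  have hXb : |X| ≤ 5 * R^2 * e := by
    have e1 := abs_mul_le2 (abs_mul_le2 hρ hz) hr1
    have e2 := abs_mul_le2 (abs_mul_le2 hq hw) hr1
    have e3 : |ρ + r| ≤ 2 * R := (abs_add_le _ _).trans (by linarith)
    have e4 := abs_mul_le2 (abs_mul_le2 hw e3) hq1
    rw [abs_le] at e1 e2 e4 ⊢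
    have : 0 ≤ R^2 * e := by positivity
    rw [hX]
    constructor <;> nlinarith [e1.1, e1.2, e2.1, e2.2, e4.1, e4.2]
  have h1 : -(a * (ρ * ((a + r1) * θ + ρ * (b + q1)) - r * (r1 * q + r * q1))) =
      -(ρ * θ * a^2) - ρ^2 * a * b - a * X := by rw [hX]; ring
  have h2 : -(a * X) ≤ |a| * |X| := by rw [← abs_mul]; exact neg_le_abs _
  have h3 := young c a X hc
  have h4 : X^2 ≤ 25 * R^4 * 2 * e := by
    rw [← sq_abs]
    calc |X|^2 ≤ (5 * R^2 * e)^2 := pow_le_pow_left₀ (abs_nonneg _) hXb 2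
      _ = 25 * R^4 * e * e := by ring
      _ ≤ 25 * R^4 * e * 2 := by gcongr
      _ = _ := by ring
  have h5 : X^2 / c ≤ 25 * R^4 * 2 * e / c := by gcongr
  have h6 : (25 * R^4 * 2 / c) * e = 25 * R^4 * 2 * e / c := by ring
  linarith

theorem Y_bound {κ₁ κ₂ ρ r q1 R e : ℝ} (hκ₂ : 0 < κ₂) (hρ : |ρ| ≤ R) (hr : |r| ≤ R)
    (hq1 : |q1| ≤ R) (hw : |ρ - r| ≤ e) :
    |((κ₁ + κ₂ * ρ^2) - (κ₁ + κ₂ * r^2)) * q1| ≤ 2 * κ₂ * R^2 * e := by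
  have e3 : |ρ + r| ≤ 2 * R := (abs_add_le _ _).trans (by linarith)
  have e4 := abs_mul_le2 (abs_mul_le2 (abs_mul_le2 hw e3) hq1) (abs_of_pos hκ₂).le
  rw [show ((κ₁ + κ₂ * ρ^2) - (κ₁ + κ₂ * r^2)) * q1 = (ρ - r) * (ρ + r) * q1 * κ₂ by ring]
  refine e4.trans (le_of_eq ?_); ring

theorem L3 {κ₁ κ₂ ρ r q1 b c R e K u s : ℝ} (hc : 0 < c) (hκ₂ : 0 < κ₂)
    (hρ : |ρ| ≤ R) (hr : |r| ≤ R) (hq1 : |q1| ≤ R) (hw : |ρ - r| ≤ e) (he : e ≤ 2)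
    (hK : 0 < K) (hu : 0 < u) (hus : u ≤ s) :
    -(K * b * u * ((κ₁ + κ₂ * ρ^2) * (b + q1) - (κ₁ + κ₂ * r^2) * q1)) ≤
      -(K * u * κ₁ * b^2) + c / 4 * b^2 + ((K * s)^2 * 4 * κ₂^2 * R^4 * 2 / c) * e := by
  have he0 : 0 ≤ e := (abs_nonneg _).trans hw
  have hR0 : 0 ≤ R := (abs_nonneg _).trans hr
  set Y := ((κ₁ + κ₂ * ρ^2) - (κ₁ + κ₂ * r^2)) * q1 with hY
  have hYb : |Y| ≤ 2 * κ₂ * R^2 * e := Y_bound hκ₂ hρ hr hq1 hw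
  have h1 : -(K * b * u * ((κ₁ + κ₂ * ρ^2) * (b + q1) - (κ₁ + κ₂ * r^2) * q1)) =
      -(K * u * κ₁ * b^2) - K * u * κ₂ * ρ^2 * b^2 - b * (K * u * Y) := by rw [hY]; ring
  have h0 : 0 ≤ K * u * κ₂ * ρ^2 * b^2 := by positivity
  have h2 : -(b * (K * u * Y)) ≤ |b| * |K * u * Y| := by rw [← abs_mul]; exact neg_le_abs _
  have h3 := young c b (K * u * Y) hc
  have h4 : (K * u * Y)^2 ≤ (K * s)^2 * 4 * κ₂^2 * R^4 * 2 * e := by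
    rw [mul_pow, ← sq_abs Y]
    calc (K * u)^2 * |Y|^2 ≤ (K * s)^2 * (2 * κ₂ * R^2 * e)^2 := by gcongr
      _ = (K * s)^2 * 4 * κ₂^2 * R^4 * e * e := by ring
      _ ≤ (K * s)^2 * 4 * κ₂^2 * R^4 * e * 2 := by gcongr
      _ = _ := by ring
  have h5 : (K * u * Y)^2 / c ≤ (K * s)^2 * 4 * κ₂^2 * R^4 * 2 * e / c := by gcongr
  have h6 : ((K * s)^2 * 4 * κ₂^2 * R^4 * 2 / c) * e = (K * s)^2 * 4 * κ₂^2 * R^4 * 2 * e / c := by ring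
  linarith

theorem L4 {κ₁ κ₂ ρ r r1 q1 z a b R e K u s P δ : ℝ} (hκ₁ : 0 < κ₁) (hκ₂ : 0 < κ₂) (hP : |ρ| ≤ P)
    (hρ : |ρ| ≤ R) (hr : |r| ≤ R) (hr1 : |r1| ≤ R) (hq1 : |q1| ≤ R) (hw : |ρ - r| ≤ e) (he : e ≤ 2)
    (hz : |z| ≤ δ) (hze : |z| ≤ e) (hK : 0 < K) (hu : 0 < u) (hus : u ≤ s) :
    K * z * u^2 * (a + r1) * ((κ₁ + κ₂ * ρ^2) * (b + q1) - (κ₁ + κ₂ * r^2) * q1) ≤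
      δ * (K * s^2 * (1 + (κ₁ + κ₂ * P^2)^2)) * (a^2 + b^2) +
        (K * s^2 * (R^2 + (4 * κ₂ * R^2)^2)) * e := by
  have he0 : 0 ≤ e := (abs_nonneg _).trans hw
  have hR0 : 0 ≤ R := (abs_nonneg _).trans hr
  have hY := Y_bound (κ₁ := κ₁) hκ₂ hρ hr hq1 hw
  set Y := ((κ₁ + κ₂ * ρ^2) - (κ₁ + κ₂ * r^2)) * q1 with hYd
  set κM := κ₁ + κ₂ * P^2 with hκM
  have hκM0 : 0 < κM := by positivity
  have hκ : κ₁ + κ₂ * ρ^2 ≤ κM := by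
    have : ρ^2 ≤ P^2 := by rw [← sq_abs ρ]; exact pow_le_pow_left₀ (abs_nonneg _) hP 2
    rw [hκM]; gcongr
  have hκ0 : 0 ≤ κ₁ + κ₂ * ρ^2 := by positivity
  set S := 4 * κ₂ * R^2 with hS
  have hS0 : 0 ≤ S := by positivity
  have h1 : |(κ₁ + κ₂ * ρ^2) * (b + q1) - (κ₁ + κ₂ * r^2) * q1| ≤ κM * |b| + S := by
    rw [show (κ₁ + κ₂ * ρ^2) * (b + q1) - (κ₁ + κ₂ * r^2) * q1 = (κ₁ + κ₂ * ρ^2) * b + Y by rw [hYd]; ring]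
    refine (abs_add_le _ _).trans (add_le_add ?_ ?_)
    · rw [abs_mul, abs_of_nonneg hκ0]; gcongr
    · refine hY.trans ?_
      have : 2 * κ₂ * R^2 * e ≤ 2 * κ₂ * R^2 * 2 := by gcongr
      rw [hS]; linarith
  have h2 : |a + r1| ≤ |a| + R := (abs_add_le _ _).trans (by linarith)
  have h3 := abs_mul_le2 h2 h1
  have h4 : (|a| + R) * (κM * |b| + S) ≤ (1 + κM^2) * (a^2 + b^2) + (R^2 + S^2) := by
    have e1 := sq_abs a
    have e2 := sq_abs b
    nlinarith [sq_nonneg (|a| + R - (κM * |b| + S)), sq_nonneg (|a| - R), sq_nonneg (κM * |b| - S),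
      mul_nonneg (sq_nonneg κM) (sq_nonneg a), sq_nonneg b]
  have h5 : K * z * u^2 * (a + r1) * ((κ₁ + κ₂ * ρ^2) * (b + q1) - (κ₁ + κ₂ * r^2) * q1) ≤
      (K * s^2) * (|z| * ((1 + κM^2) * (a^2 + b^2) + (R^2 + S^2))) := by
    calc _ ≤ |K * z * u^2 * (a + r1) * ((κ₁ + κ₂ * ρ^2) * (b + q1) - (κ₁ + κ₂ * r^2) * q1)| := le_abs_self _
      _ = K * u^2 * (|z| * |(a + r1) * ((κ₁ + κ₂ * ρ^2) * (b + q1) - (κ₁ + κ₂ * r^2) * q1)|) := by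
        rw [show K * z * u^2 * (a + r1) * ((κ₁ + κ₂ * ρ^2) * (b + q1) - (κ₁ + κ₂ * r^2) * q1) =
          (K * u^2) * (z * ((a + r1) * ((κ₁ + κ₂ * ρ^2) * (b + q1) - (κ₁ + κ₂ * r^2) * q1))) by ring,
          abs_mul, abs_mul z, abs_of_pos (by positivity : 0 < K * u^2)]
      _ ≤ _ := by
        have := h3.trans h4
        gcongr
  have h6 : |z| * ((1 + κM^2) * (a^2 + b^2) + (R^2 + S^2)) ≤
      δ * ((1 + κM^2) * (a^2 + b^2)) + e * (R^2 + S^2) := by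
    rw [mul_add]; gcongr
  have h7 : (K * s^2) * (|z| * ((1 + κM^2) * (a^2 + b^2) + (R^2 + S^2))) ≤
      (K * s^2) * (δ * ((1 + κM^2) * (a^2 + b^2)) + e * (R^2 + S^2)) := by gcongr
  refine (h5.trans h7).trans (le_of_eq ?_); ring

theorem L6 {ρ θ r1 q1 z a b R e K u s P δ : ℝ} (hP : |ρ| ≤ P) (hP' : |θ| ≤ P)
    (hr1 : |r1| ≤ R) (hq1 : |q1| ≤ R)
    (hz : |z| ≤ δ) (hze : |z| ≤ e) (hK : 0 < K) (hu : 0 < u) (hus : u ≤ s) :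
    K * z * u * (ρ * ((a + r1) * θ + ρ * (b + q1)) * (b + q1)) ≤
      δ * (K * s * (4 * P^2)) * (a^2 + b^2) + (K * s * (8 * P^2 * R^2)) * e := by
  have hR0 : 0 ≤ R := (abs_nonneg _).trans hr1
  have hP0 : 0 ≤ P := (abs_nonneg _).trans hP
  have hs0 : 0 ≤ s := hu.le.trans hus
  have hKs : 0 ≤ K * s := mul_nonneg hK.le hs0
  have h1 : |ρ * ((a + r1) * θ + ρ * (b + q1)) * (b + q1)| ≤ 4 * P^2 * (a^2 + b^2) + 8 * P^2 * R^2 := by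
    have e1 : |(a + r1)| ≤ |a| + R := (abs_add_le _ _).trans (by linarith)
    have e2 : |(b + q1)| ≤ |b| + R := (abs_add_le _ _).trans (by linarith)
    have e3 := (abs_add_le ((a + r1) * θ) (ρ * (b + q1))).trans
      (add_le_add (abs_mul_le2 e1 hP') (abs_mul_le2 hP e2))
    have e4 := abs_mul_le2 (abs_mul_le2 hP e3) e2
    refine e4.trans ?_
    have e5 : (|a| + R + (|b| + R)) * (|b| + R) ≤ 4 * (a^2 + b^2) + 8 * R^2 := by
      rw [← sq_abs a, ← sq_abs b]
      nlinarith [sq_nonneg (|a| - |b|), sq_nonneg (|a| - R), sq_nonneg (|b| - R), sq_nonneg |a|]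
    have e6 : P^2 * ((|a| + R + (|b| + R)) * (|b| + R)) ≤ P^2 * (4 * (a^2 + b^2) + 8 * R^2) := by gcongr
    nlinarith
  calc _ ≤ |K * z * u * (ρ * ((a + r1) * θ + ρ * (b + q1)) * (b + q1))| := le_abs_self _
    _ = (K * u) * (|z| * |ρ * ((a + r1) * θ + ρ * (b + q1)) * (b + q1)|) := by
      rw [show K * z * u * (ρ * ((a + r1) * θ + ρ * (b + q1)) * (b + q1)) =
        (K * u) * (z * (ρ * ((a + r1) * θ + ρ * (b + q1)) * (b + q1))) by ring, abs_mul, abs_mul z,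
        abs_of_pos (by positivity : 0 < K * u)]
    _ ≤ (K * s) * (|z| * (4 * P^2 * (a^2 + b^2) + 8 * P^2 * R^2)) := by gcongr
    _ ≤ (K * s) * (δ * (4 * P^2 * (a^2 + b^2)) + e * (8 * P^2 * R^2)) := by
      rw [mul_add |z|]; gcongr
    _ = _ := by ring

theorem L0 {p P σ κ₁ K u ρ θ a b : ℝ} (hp : 0 < p) (hP : 0 < P) (hσ : 0 < σ) (hκ₁ : 0 < κ₁)
    (hK : K = (P^4 / (2 * p^2) + p^2 / 2) * (P + σ) / κ₁) (hK0 : 0 < K)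
    (h1 : p ≤ ρ) (h2 : ρ ≤ P) (h3 : p ≤ θ) (hul : 1 / (P + σ) ≤ u) :
    p^2 / 2 * (a^2 + b^2) ≤ ρ * θ * a^2 + ρ^2 * a * b + K * u * κ₁ * b^2 := by
  have e1 : p^2 ≤ ρ * θ := by nlinarith
  have e2 : P^4 / (2 * p^2) + p^2 / 2 ≤ K * u * κ₁ := by
    calc P^4 / (2 * p^2) + p^2 / 2 = K * (1 / (P + σ)) * κ₁ := by rw [hK]; field_simp
      _ ≤ K * u * κ₁ := by gcongr
  have e3 : ρ^2 ≤ P^2 := by gcongr; linarith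
  have e4 : -(ρ^2 * a * b) ≤ p^2 / 2 * a^2 + P^4 / (2 * p^2) * b^2 := by
    have e5 : -(ρ^2 * a * b) ≤ |a| * (P^2 * |b|) := by
      calc -(ρ^2 * a * b) ≤ |ρ^2 * a * b| := neg_le_abs _
        _ = ρ^2 * (|a| * |b|) := by rw [abs_mul, abs_mul, abs_of_nonneg (sq_nonneg ρ)]; ring
        _ ≤ P^2 * (|a| * |b|) := by gcongr
        _ = _ := by ring
    have e6 : p^2 / 2 * |a|^2 + P^4 / (2 * p^2) * |b|^2 - |a| * (P^2 * |b|) =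
      (p^2 * |a| - P^2 * |b|)^2 / (2 * p^2) := by field_simp; ring
    have e7 : 0 ≤ (p^2 * |a| - P^2 * |b|)^2 / (2 * p^2) := by positivity
    rw [sq_abs, sq_abs] at e6
    linarith
  have e8 : p^2 * a^2 ≤ ρ * θ * a^2 := by gcongr
  have e9 : (P^4 / (2 * p^2) + p^2 / 2) * b^2 ≤ K * u * κ₁ * b^2 := by gcongr
  linarith [show p^2 / 2 * (a^2 + b^2) = p^2 / 2 * a^2 + p^2 / 2 * b^2 by ring,
    show (P^4 / (2 * p^2) + p^2 / 2) * b^2 = P^4 / (2 * p^2) * b^2 + p^2 / 2 * b^2 by ring]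

set_option maxHeartbeats 1000000 in
theorem energy_alg {p P σ κ₁ κ₂ : ℝ} (hp : 0 < p) (hpP : p ≤ P) (hσ : 0 < σ) (hκ₁ : 0 < κ₁) (hκ₂ : 0 < κ₂) :
    ∃ K > 0, ∃ δ > 0, δ ≤ 1 ∧ ∃ c0 > 0, ∀ N lam Gb : ℝ, 0 < lam → ∃ C ≥ 0,
      ∀ ρ θ ρ1 θ1 r q r1 q1 r2 q2 γ : ℝ, p ≤ ρ → ρ ≤ P → p ≤ θ → θ ≤ P →
      |ρ - r| ≤ δ → |θ - q| ≤ δ → |r1| ≤ N → |q1| ≤ N → |r2| ≤ N → |q2| ≤ N → |γ| ≤ Gb →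
      (ρ - r) * (r1 * (r1 * q + r * q1) + r * (r2 * q + 2 * r1 * q1 + r * q2) - γ)
      - (ρ1 - r1) * (ρ * (ρ1 * θ + ρ * θ1) - r * (r1 * q + r * q1))
      + K * (θ - q) * (1 / (ρ + σ)) * (ρ * (ρ1 * θ + ρ * θ1) * θ1 + (lam + θ) * γ
          + ((κ₁ + κ₂ * r^2) * q2 + 2 * κ₂ * r * r1 * q1))
      - K * (θ1 - q1) * (1 / (ρ + σ)) * ((κ₁ + κ₂ * ρ^2) * θ1 - (κ₁ + κ₂ * r^2) * q1)
      + K * (θ - q) * (1 / (ρ + σ))^2 * ρ1 * ((κ₁ + κ₂ * ρ^2) * θ1 - (κ₁ + κ₂ * r^2) * q1)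
      ≤ - c0 * ((ρ1 - r1)^2 + (θ1 - q1)^2) + C * (|ρ - r| + |θ - q|) := by
  have hP : 0 < P := hp.trans_le hpP
  set c := p^2 / 2 with hc
  have hc0 : 0 < c := by positivity
  set K := (P^4 / (2 * p^2) + p^2 / 2) * (P + σ) / κ₁ with hK
  have hK0 : 0 < K := by positivity
  set s := 1 / σ with hs
  have hs0 : 0 < s := by positivity
  set H := K * s^2 * (1 + (κ₁ + κ₂ * P^2)^2) + K * s * (4 * P^2) with hH
  have hH0 : 0 < H := by positivity
  refine ⟨K, hK0, min 1 (c / (4 * H)), by positivity, min_le_left _ _, c / 2, by positivity, ?_⟩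
  intro N lam Gb hlam
  set R := max (P + 1) N with hR
  have hR0 : 0 < R := by have := le_max_left (P + 1) N; linarith
  set C := (25 * R^4 * 2 / c) + ((K * s)^2 * 4 * κ₂^2 * R^4 * 2 / c) +
    (K * s^2 * (R^2 + (4 * κ₂ * R^2)^2)) + (K * s * (8 * P^2 * R^2)) + (6 * R^3 + |Gb|) +
    K * s * ((lam + R) * |Gb| + (κ₁ * R + 3 * κ₂ * R^3)) with hC
  refine ⟨C, by positivity, ?_⟩
  intro ρ θ ρ1 θ1 r q r1 q1 r2 q2 γ h1 h2 h3 h4 hw hz hr1 hq1 hr2 hq2 hγ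
  set δ := min 1 (c / (4 * H)) with hδ
  have hδ1 : δ ≤ 1 := min_le_left _ _
  have hδH : δ * H ≤ c / 4 := by
    have : δ ≤ c / (4 * H) := min_le_right _ _
    calc δ * H ≤ c / (4 * H) * H := by gcongr
      _ = c / 4 := by field_simp
  have hPR : P + 1 ≤ R := le_max_left _ _
  have hNR : N ≤ R := le_max_right _ _
  have hρP : |ρ| ≤ P := by rw [abs_of_pos (by linarith)]; exact h2
  have hθP : |θ| ≤ P := by rw [abs_of_pos (by linarith)]; exact h4
  have hρR : |ρ| ≤ R := hρP.trans (by linarith)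
  have hθR : |θ| ≤ R := hθP.trans (by linarith)
  have hrR : |r| ≤ R := by
    have := abs_le.1 hw
    rw [abs_le]; constructor <;> linarith
  have hqR : |q| ≤ R := by
    have := abs_le.1 hz
    rw [abs_le]; constructor <;> linarith
  replace hr1 := hr1.trans hNR
  replace hq1 := hq1.trans hNR
  replace hr2 := hr2.trans hNR
  replace hq2 := hq2.trans hNR
  replace hγ := hγ.trans (le_abs_self Gb)
  set e := |ρ - r| + |θ - q| with he
  have hwe : |ρ - r| ≤ e := by have := abs_nonneg (θ - q); linarith
  have hze : |θ - q| ≤ e := by have := abs_nonneg (ρ - r); linarith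
  have he2 : e ≤ 2 := by linarith
  set u := 1 / (ρ + σ) with hu
  have hu0 : 0 < u := by have : 0 < ρ + σ := by linarith
                         positivity
  have hus : u ≤ s := by
    rw [hu, hs]; exact one_div_le_one_div_of_le hσ (by linarith)
  have hul : 1 / (P + σ) ≤ u := by
    rw [hu]; exact one_div_le_one_div_of_le (by linarith) (by linarith)
  obtain ⟨a, ha⟩ : ∃ a, ρ1 = a + r1 := ⟨ρ1 - r1, by ring⟩
  obtain ⟨b, hb⟩ : ∃ b, θ1 = b + q1 := ⟨θ1 - q1, by ring⟩
  subst ha hb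
  simp only [add_sub_cancel_right]
  have B1 := L1 (a := a) (b := b) hc0 hρR hrR hqR hr1 hq1 hwe hze he2
  have B3 := L3 (κ₁ := κ₁) (b := b) hc0 hκ₂ hρR hrR hq1 hwe he2 hK0 hu0 hus
  have B4 := L4 (a := a) (b := b) hκ₁ hκ₂ hρP hρR hrR hr1 hq1 hwe he2 hz hze hK0 hu0 hus
  have B6 := L6 (a := a) (b := b) hρP hθP hr1 hq1 hz hze hK0 hu0 hus
  have hF := Fr_bound hrR hqR hr1 hq1 hr2 hq2
  have hG := Gq_bound hκ₁ hκ₂ hrR hr1 hq1 hq2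
  have B2 : (ρ - r) * (r1 * (r1 * q + r * q1) + r * (r2 * q + 2 * r1 * q1 + r * q2) - γ) ≤
      (6 * R^3 + |Gb|) * e := by
    have := abs_mul_le2 hwe ((abs_sub _ _).trans (add_le_add hF hγ))
    linarith [le_abs_self ((ρ - r) * (r1 * (r1 * q + r * q1) + r * (r2 * q + 2 * r1 * q1 + r * q2) - γ))]
  have B5 : K * (θ - q) * u * ((lam + θ) * γ + ((κ₁ + κ₂ * r^2) * q2 + 2 * κ₂ * r * r1 * q1)) ≤
      (K * s * ((lam + R) * |Gb| + (κ₁ * R + 3 * κ₂ * R^3))) * e := by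
    have e1 : |lam + θ| ≤ lam + R := by rw [abs_of_pos (by linarith)]; linarith [le_abs_self θ]
    have e2 := (abs_add_le ((lam + θ) * γ) ((κ₁ + κ₂ * r^2) * q2 + 2 * κ₂ * r * r1 * q1)).trans
      (add_le_add (abs_mul_le2 e1 hγ) hG)
    have e3 : |u| ≤ s := by rwa [abs_of_pos hu0]
    have e4 := abs_mul_le2 (abs_mul_le2 (abs_mul_le2 (abs_of_pos hK0).le hze) e3) e2
    refine (le_abs_self _).trans (e4.trans (le_of_eq ?_)); ring
  have B0 := L0 (a := a) (b := b) hp hP hσ hκ₁ hK hK0 h1 h2 h3 hul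
  rw [← hc] at B0
  have hδH' : δ * H * (a^2 + b^2) ≤ c / 4 * (a^2 + b^2) := by gcongr
  have hexp : δ * H * (a^2 + b^2) = δ * (K * s^2 * (1 + (κ₁ + κ₂ * P^2)^2)) * (a^2 + b^2) +
    δ * (K * s * (4 * P^2)) * (a^2 + b^2) := by rw [hH]; ring
  have hCe : C * e = (25 * R^4 * 2 / c) * e + ((K * s)^2 * 4 * κ₂^2 * R^4 * 2 / c) * e +
    (K * s^2 * (R^2 + (4 * κ₂ * R^2)^2)) * e + (K * s * (8 * P^2 * R^2)) * e + (6 * R^3 + |Gb|) * e +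
    K * s * ((lam + R) * |Gb| + (κ₁ * R + 3 * κ₂ * R^3)) * e := by rw [hC]; ring
  have hab := add_nonneg (sq_nonneg a) (sq_nonneg b)
  have hsplit : K * (θ - q) * u * (ρ * ((a + r1) * θ + ρ * (b + q1)) * (b + q1) + (lam + θ) * γ
          + ((κ₁ + κ₂ * r^2) * q2 + 2 * κ₂ * r * r1 * q1)) =
     K * (θ - q) * u * (ρ * ((a + r1) * θ + ρ * (b + q1)) * (b + q1)) +
     K * (θ - q) * u * ((lam + θ) * γ + ((κ₁ + κ₂ * r^2) * q2 + 2 * κ₂ * r * r1 * q1)) := by ring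
  have e1 : c * (a^2 + b^2) = c * a^2 + c * b^2 := by ring
  have e2 : c / 4 * (a^2 + b^2) = c / 4 * a^2 + c / 4 * b^2 := by ring
  have e3 : -(c / 2) * (a^2 + b^2) = -(c * (a^2 + b^2)) + c / 4 * (a^2 + b^2) + (c / 4 * a^2 + c / 4 * b^2) := by ring
  rw [hsplit, hCe, e3]
  linarith

structure C2 (f f1 f2 : ℝ → ℝ) : Prop where
  c0 : ContinuousOn f (Icc 0 1)
  c1 : ContinuousOn f1 (Icc 0 1)
  c2 : ContinuousOn f2 (Icc 0 1)
  d1 : ∀ x ∈ Ioo (0:ℝ) 1, HasDerivAt f (f1 x) x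
  d2 : ∀ x ∈ Ioo (0:ℝ) 1, HasDerivAt f1 (f2 x) x

theorem ftc01 {P P' : ℝ → ℝ} (h0 : ContinuousOn P (Icc 0 1)) (h1 : ContinuousOn P' (Icc 0 1))
    (hd : ∀ x ∈ Ioo (0:ℝ) 1, HasDerivAt P (P' x) x) : ∫ x in Icc 0 1, P' x = P 1 - P 0 := by
  rw [integral_Icc_eq_integral_Ioc, ← intervalIntegral.integral_of_le zero_le_one]
  refine intervalIntegral.integral_eq_sub_of_hasDerivAt_of_le zero_le_one h0 hd ?_
  rw [intervalIntegrable_iff_integrableOn_Icc_of_le zero_le_one]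
  exact h1.integrableOn_compact isCompact_Icc

theorem flux_bdry {w F Fr Cb B : ℝ} (h : |F| ≤ Cb ∨ w = 0) (hFr : |Fr| ≤ B) :
    |w * (F - Fr)| ≤ (|Cb| + B) * |w| := by
  rcases h with h | h
  · rw [abs_mul, mul_comm]
    refine mul_le_mul_of_nonneg_right ?_ (abs_nonneg _)
    exact (abs_sub _ _).trans (add_le_add (h.trans (le_abs_self _)) hFr)
  · subst h; simp

set_option maxHeartbeats 1000000 in
theorem energy_slice {p P σ κ₁ κ₂ : ℝ} (hp : 0 < p) (hpP : p ≤ P) (hσ : 0 < σ) (hκ₁ : 0 < κ₁) (hκ₂ : 0 < κ₂) :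
    ∃ K > 0, ∃ δ > 0, δ ≤ 1 ∧ ∃ c0 > 0, ∀ N lam Gb Cb : ℝ, 0 < lam → ∃ C ≥ 0,
      ∀ ρ θ ρ1 θ1 ρ2 θ2 ρt θt r q r1 q1 r2 q2 γ : ℝ → ℝ,
      C2 ρ ρ1 ρ2 → C2 θ θ1 θ2 → C2 r r1 r2 → C2 q q1 q2 → ContinuousOn γ (Icc 0 1) →
      (∀ x ∈ Icc (0:ℝ) 1, p ≤ ρ x ∧ ρ x ≤ P ∧ p ≤ θ x ∧ θ x ≤ P ∧ |ρ x - r x| ≤ δ ∧ |θ x - q x| ≤ δ ∧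
        |r1 x| ≤ N ∧ |q1 x| ≤ N ∧ |r2 x| ≤ N ∧ |q2 x| ≤ N ∧ |γ x| ≤ Gb) →
      (∀ x ∈ Ioo (0:ℝ) 1, ρt x = ρ1 x * (ρ1 x * θ x + ρ x * θ1 x) +
        ρ x * (ρ2 x * θ x + 2 * ρ1 x * θ1 x + ρ x * θ2 x) - γ x) →
      (∀ x ∈ Ioo (0:ℝ) 1, θt x = (1 / (ρ x + σ)) * (ρ x * (ρ1 x * θ x + ρ x * θ1 x) * θ1 x +
        ((κ₁ + κ₂ * ρ x^2) * θ2 x + 2 * κ₂ * ρ x * ρ1 x * θ1 x) + (lam + θ x) * γ x)) →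
      (∀ x, x = 0 ∨ x = 1 → |ρ x * (ρ1 x * θ x + ρ x * θ1 x)| ≤ Cb ∨ ρ x - r x = 0) →
      (∀ x, x = 0 ∨ x = 1 → |(κ₁ + κ₂ * ρ x^2) * θ1 x| ≤ Cb ∨ θ x - q x = 0) →
      ∫ x in Icc 0 1, ((ρ x - r x) * ρt x + K * (θ x - q x) * θt x) ≤
        - c0 * (∫ x in Icc 0 1, ((ρ1 x - r1 x)^2 + (θ1 x - q1 x)^2)) +
        C * ((∫ x in Icc 0 1, (|ρ x - r x| + |θ x - q x|)) +
          (|ρ 0 - r 0| + |ρ 1 - r 1| + |θ 0 - q 0| + |θ 1 - q 1|)) := by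
  obtain ⟨K, hK, δ, hδ, hδ1, c0, hc0, halg⟩ := energy_alg hp hpP hσ hκ₁ hκ₂
  refine ⟨K, hK, δ, hδ, hδ1, c0, hc0, ?_⟩
  intro N lam Gb Cb hlam
  obtain ⟨C, hC, halg⟩ := halg N lam Gb hlam
  set R := max (P + 1) N with hR
  have hP0 : 0 < P := by linarith
  have hR0 : 0 < R := by have := le_max_left (P + 1) N; linarith
  set C1 := (|Cb| + 2 * R^3) + K * (1 / σ) * (|Cb| + (κ₁ + κ₂ * R^2) * R) with hC1
  have hC10 : 0 ≤ C1 := by positivity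
  refine ⟨C + C1, by positivity, ?_⟩
  intro ρ θ ρ1 θ1 ρ2 θ2 ρt θt r q r1 q1 r2 q2 γ hρ hθ hr hq hγ hbd hρt hθt hbρ hbθ
  obtain ⟨ρc0, ρc1, ρc2, ρd1, ρd2⟩ := hρ
  obtain ⟨θc0, θc1, θc2, θd1, θd2⟩ := hθ
  obtain ⟨rc0, rc1, rc2, rd1, rd2⟩ := hr
  obtain ⟨qc0, qc1, qc2, qd1, qd2⟩ := hq
  have hne : ∀ x ∈ Icc (0:ℝ) 1, ρ x + σ ≠ 0 := fun x hx => by have := (hbd x hx).1; linarith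
  obtain ⟨u, hu⟩ : ∃ u : ℝ → ℝ, u = fun x => 1 / (ρ x + σ) := ⟨_, rfl⟩
  have huc : ContinuousOn u (Icc 0 1) := by
    rw [hu]; exact continuousOn_const.div (ρc0.add continuousOn_const) hne
  have hud : ∀ x ∈ Ioo (0:ℝ) 1, HasDerivAt u (-(ρ1 x * (u x)^2)) x := by
    intro x hx
    have h1 := ((ρd1 x hx).add_const σ).inv (hne x (Ioo_subset_Icc_self hx))
    rw [hu]
    simp only [one_div]
    refine h1.congr_deriv ?_
    field_simp
  have hux : ∀ x, 1 / (ρ x + σ) = u x := fun x => by rw [hu]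
  simp only [hux] at hθt
  set Pf : ℝ → ℝ := fun x => (ρ x - r x) * (ρ x * (ρ1 x * θ x + ρ x * θ1 x) -
      r x * (r1 x * q x + r x * q1 x)) + K * ((θ x - q x) * (u x * ((κ₁ + κ₂ * ρ x^2) * θ1 x -
      (κ₁ + κ₂ * r x^2) * q1 x))) with hPf
  set Pd : ℝ → ℝ := fun x => (ρ1 x - r1 x) * (ρ x * (ρ1 x * θ x + ρ x * θ1 x) -
      r x * (r1 x * q x + r x * q1 x)) + (ρ x - r x) * (
        (ρ1 x * (ρ1 x * θ x + ρ x * θ1 x) + ρ x * (ρ2 x * θ x + 2 * ρ1 x * θ1 x + ρ x * θ2 x)) -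
        (r1 x * (r1 x * q x + r x * q1 x) + r x * (r2 x * q x + 2 * r1 x * q1 x + r x * q2 x))) +
      K * ((θ1 x - q1 x) * (u x * ((κ₁ + κ₂ * ρ x^2) * θ1 x - (κ₁ + κ₂ * r x^2) * q1 x)) +
        (θ x - q x) * (-(ρ1 x * (u x)^2) * ((κ₁ + κ₂ * ρ x^2) * θ1 x - (κ₁ + κ₂ * r x^2) * q1 x) +
          u x * (((κ₁ + κ₂ * ρ x^2) * θ2 x + 2 * κ₂ * ρ x * ρ1 x * θ1 x) -
            ((κ₁ + κ₂ * r x^2) * q2 x + 2 * κ₂ * r x * r1 x * q1 x)))) with hPd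
  set Q : ℝ → ℝ := fun x =>
      (ρ x - r x) * (r1 x * (r1 x * q x + r x * q1 x) + r x * (r2 x * q x + 2 * r1 x * q1 x + r x * q2 x) - γ x)
      - (ρ1 x - r1 x) * (ρ x * (ρ1 x * θ x + ρ x * θ1 x) - r x * (r1 x * q x + r x * q1 x))
      + K * (θ x - q x) * (u x) * (ρ x * (ρ1 x * θ x + ρ x * θ1 x) * θ1 x + (lam + θ x) * γ x
          + ((κ₁ + κ₂ * r x^2) * q2 x + 2 * κ₂ * r x * r1 x * q1 x))
      - K * (θ1 x - q1 x) * (u x) * ((κ₁ + κ₂ * ρ x^2) * θ1 x - (κ₁ + κ₂ * r x^2) * q1 x)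
      + K * (θ x - q x) * (u x)^2 * ρ1 x * ((κ₁ + κ₂ * ρ x^2) * θ1 x - (κ₁ + κ₂ * r x^2) * q1 x) with hQ
  have hPfc : ContinuousOn Pf (Icc 0 1) := by rw [hPf]; fun_prop
  have hPdc : ContinuousOn Pd (Icc 0 1) := by rw [hPd]; fun_prop
  have hQc : ContinuousOn Q (Icc 0 1) := by rw [hQ]; fun_prop
  have hder : ∀ x ∈ Ioo (0:ℝ) 1, HasDerivAt Pf (Pd x) x := by
    intro x hx
    have a1 := ρd1 x hx
    have a2 := ρd2 x hx
    have a3 := θd1 x hx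
    have a4 := θd2 x hx
    have a5 := rd1 x hx
    have a6 := rd2 x hx
    have a7 := qd1 x hx
    have a8 := qd2 x hx
    have a9 := hud x hx
    have F1 := a1.mul ((a2.mul a3).add (a1.mul a4))
    have F2 := a5.mul ((a6.mul a7).add (a5.mul a8))
    have G1 := (((a1.pow 2).const_mul κ₂).const_add κ₁).mul a4
    have G2 := (((a5.pow 2).const_mul κ₂).const_add κ₁).mul a8
    have := ((a1.sub a5).mul (F1.sub F2)).add (((a3.sub a7).mul (a9.mul (G1.sub G2))).const_mul K)
    refine this.congr_deriv ?_
    simp only [hPd, Pi.mul_apply, Pi.add_apply, Pi.sub_apply, Pi.pow_apply, Nat.cast_ofNat]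
    ring
  have hftc := ftc01 hPfc hPdc hder
  have hii : ∀ g : ℝ → ℝ, ContinuousOn g (Icc 0 1) → IntegrableOn g (Icc 0 1) :=
    fun g hg => hg.integrableOn_compact isCompact_Icc
  have hLHS : ∫ x in Icc 0 1, ((ρ x - r x) * ρt x + K * (θ x - q x) * θt x) =
      ∫ x in Icc 0 1, (Pd x + Q x) := by
    refine integral_congr_ae ?_
    filter_upwards [ae_Ioo01] with x hx
    rw [hρt x hx, hθt x hx, hPd, hQ]
    ring
  have hc1 : ContinuousOn (fun x => (ρ1 x - r1 x)^2 + (θ1 x - q1 x)^2) (Icc 0 1) := by fun_prop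
  have hc2 : ContinuousOn (fun x => |ρ x - r x| + |θ x - q x|) (Icc 0 1) := by fun_prop
  have hQle : ∫ x in Icc 0 1, Q x ≤ ∫ x in Icc 0 1, (- c0 * ((ρ1 x - r1 x)^2 + (θ1 x - q1 x)^2) +
      C * (|ρ x - r x| + |θ x - q x|)) := by
    refine setIntegral_mono_on (hii _ hQc) (((hii _ hc1).const_mul _).add ((hii _ hc2).const_mul _))
      measurableSet_Icc ?_
    intro x hx
    obtain ⟨b1, b2, b3, b4, b5, b6, b7, b8, b9, b10, b11⟩ := hbd x hx
    have := halg (ρ x) (θ x) (ρ1 x) (θ1 x) (r x) (q x) (r1 x) (q1 x) (r2 x) (q2 x) (γ x)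
      b1 b2 b3 b4 b5 b6 b7 b8 b9 b10 b11
    rw [hux x] at this
    exact this
  rw [integral_add ((hii _ hc1).const_mul _) ((hii _ hc2).const_mul _), integral_const_mul,
    integral_const_mul] at hQle
  rw [hLHS, integral_add (hii _ hPdc) (hii _ hQc), hftc]
  have hbd2 : ∀ x, x = 0 ∨ x = 1 → |Pf x| ≤ C1 * (|ρ x - r x| + |θ x - q x|) := by
    intro x hx
    have hxI : x ∈ Icc (0:ℝ) 1 := by rcases hx with h | h <;> subst h <;> simp
    obtain ⟨b1, b2, b3, b4, b5, b6, b7, b8, b9, b10, b11⟩ := hbd x hxI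
    have hPR : P + 1 ≤ R := le_max_left _ _
    have hNR : N ≤ R := le_max_right _ _
    have hrR : |r x| ≤ R := by
      have := abs_le.1 b5
      rw [abs_le]; constructor <;> linarith
    have hqR : |q x| ≤ R := by
      have := abs_le.1 b6
      rw [abs_le]; constructor <;> linarith
    have f1 : |r x * (r1 x * q x + r x * q1 x)| ≤ 2 * R^3 := by
      have e1 := abs_le.1 (m3 hrR (b7.trans hNR) hqR)
      have e2 := abs_le.1 (m3 hrR hrR (b8.trans hNR))
      rw [abs_le]; constructor <;> nlinarith [e1.1, e1.2, e2.1, e2.2]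
    have f2 : |(κ₁ + κ₂ * r x^2) * q1 x| ≤ (κ₁ + κ₂ * R^2) * R := by
      refine abs_mul_le2 ?_ (b8.trans hNR)
      rw [abs_of_pos (by positivity)]
      have : r x^2 ≤ R^2 := by rw [← sq_abs (r x)]; exact pow_le_pow_left₀ (abs_nonneg _) hrR 2
      gcongr
    have g1 := flux_bdry (hbρ x hx) f1
    have g2 := flux_bdry (hbθ x hx) f2
    have u0 : |K * u x| ≤ K * (1 / σ) := by
      have hpos : 0 < ρ x + σ := by linarith
      have : 0 < u x := by rw [← hux]; positivity
      rw [abs_of_pos (by positivity), ← hux]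
      gcongr; linarith
    have g3 := abs_mul_le2 u0 g2
    have e : Pf x = (ρ x - r x) * (ρ x * (ρ1 x * θ x + ρ x * θ1 x) - r x * (r1 x * q x + r x * q1 x)) +
      K * u x * ((θ x - q x) * ((κ₁ + κ₂ * ρ x^2) * θ1 x - (κ₁ + κ₂ * r x^2) * q1 x)) := by
      rw [hPf]; ring
    rw [e]
    refine (abs_add_le _ _).trans ((add_le_add g1 g3).trans ?_)
    have A := abs_nonneg (ρ x - r x)
    have B := abs_nonneg (θ x - q x)
    have X1 : 0 ≤ |Cb| + 2 * R^3 := by positivity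
    have X2 : 0 ≤ K * (1 / σ) * (|Cb| + (κ₁ + κ₂ * R^2) * R) := by positivity
    rw [hC1]
    nlinarith [mul_nonneg X1 B, mul_nonneg X2 A]
  have p1 := (le_abs_self _).trans (hbd2 1 (Or.inr rfl))
  have p0 := (neg_le_abs _).trans (hbd2 0 (Or.inl rfl))
  have I0 : 0 ≤ ∫ x in Icc 0 1, (|ρ x - r x| + |θ x - q x|) := integral_nonneg fun x => by positivity
  have := abs_nonneg (ρ 0 - r 0)
  have := abs_nonneg (ρ 1 - r 1)
  have := abs_nonneg (θ 0 - q 0)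
  have := abs_nonneg (θ 1 - q 1)
  have S0 : 0 ≤ |ρ 0 - r 0| + |ρ 1 - r 1| + |θ 0 - q 0| + |θ 1 - q 1| := by positivity
  have t1 := mul_nonneg hC S0
  have t2 := mul_nonneg hC10 I0
  linarith [show (C + C1) * ((∫ x in Icc 0 1, (|ρ x - r x| + |θ x - q x|)) +
          (|ρ 0 - r 0| + |ρ 1 - r 1| + |θ 0 - q 0| + |θ 1 - q 1|)) =
      C * (∫ x in Icc 0 1, (|ρ x - r x| + |θ x - q x|)) + C1 * (∫ x in Icc 0 1, (|ρ x - r x| + |θ x - q x|))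
      + C * (|ρ 0 - r 0| + |ρ 1 - r 1| + |θ 0 - q 0| + |θ 1 - q 1|) +
      (C1 * (|ρ 1 - r 1| + |θ 1 - q 1|) + C1 * (|ρ 0 - r 0| + |θ 0 - q 0|)) by ring]

structure Dat where
  (T p P σ κ₁ κ₂ lam Gb Cb : ℝ)
  (rb qb : ℝ → ℝ)
  (ρ θ ρ1 θ1 ρ2 θ2 ρt θt γ : ℝ → ℝ → ℝ)

structure Sol (D : Dat) : Prop where
  hT : 0 < D.T
  hp : 0 < D.p
  hpP : D.p ≤ D.P
  hσ : 0 < D.σ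
  hκ₁ : 0 < D.κ₁
  hκ₂ : 0 < D.κ₂
  hlam : 0 < D.lam
  cρ : ContinuousOn (fun p : ℝ × ℝ => D.ρ p.1 p.2) (Icc 0 1 ×ˢ Icc 0 D.T)
  cθ : ContinuousOn (fun p : ℝ × ℝ => D.θ p.1 p.2) (Icc 0 1 ×ˢ Icc 0 D.T)
  C2ρ : ∀ t ∈ Ioo 0 D.T, C2 (fun x => D.ρ x t) (fun x => D.ρ1 x t) (fun x => D.ρ2 x t)
  C2θ : ∀ t ∈ Ioo 0 D.T, C2 (fun x => D.θ x t) (fun x => D.θ1 x t) (fun x => D.θ2 x t)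
  cγ : ∀ t ∈ Ioo 0 D.T, ContinuousOn (fun x => D.γ x t) (Icc 0 1)
  tρ : ∀ x ∈ Icc (0:ℝ) 1, ∀ t ∈ Ioo 0 D.T, HasDerivAt (fun s => D.ρ x s) (D.ρt x t) t
  tθ : ∀ x ∈ Icc (0:ℝ) 1, ∀ t ∈ Ioo 0 D.T, HasDerivAt (fun s => D.θ x s) (D.θt x t) t
  bd : ∀ x ∈ Icc (0:ℝ) 1, ∀ t ∈ Icc 0 D.T,
    D.p ≤ D.ρ x t ∧ D.ρ x t ≤ D.P ∧ D.p ≤ D.θ x t ∧ D.θ x t ≤ D.P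
  bγ : ∀ x ∈ Icc (0:ℝ) 1, ∀ t ∈ Ioo 0 D.T, |D.γ x t| ≤ D.Gb
  eρ : ∀ x ∈ Ioo (0:ℝ) 1, ∀ t ∈ Ioo 0 D.T, D.ρt x t =
    D.ρ1 x t * (D.ρ1 x t * D.θ x t + D.ρ x t * D.θ1 x t) +
        D.ρ x t * (D.ρ2 x t * D.θ x t + 2 * D.ρ1 x t * D.θ1 x t + D.ρ x t * D.θ2 x t) - D.γ x t
  eθ : ∀ x ∈ Ioo (0:ℝ) 1, ∀ t ∈ Ioo 0 D.T, D.θt x t =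
    (1 / (D.ρ x t + D.σ)) * (D.ρ x t * (D.ρ1 x t * D.θ x t + D.ρ x t * D.θ1 x t) * D.θ1 x t +
        ((D.κ₁ + D.κ₂ * D.ρ x t^2) * D.θ2 x t + 2 * D.κ₂ * D.ρ x t * D.ρ1 x t * D.θ1 x t) +
        (D.lam + D.θ x t) * D.γ x t)
  bρ : ∀ x, x = 0 ∨ x = 1 → ∀ t ∈ Ioo 0 D.T,
    |D.ρ x t * (D.ρ1 x t * D.θ x t + D.ρ x t * D.θ1 x t)| ≤ D.Cb ∨ D.ρ x t = D.rb x
  bθ : ∀ x, x = 0 ∨ x = 1 → ∀ t ∈ Ioo 0 D.T,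
    |(D.κ₁ + D.κ₂ * D.ρ x t^2) * D.θ1 x t| ≤ D.Cb ∨ D.θ x t = D.qb x

theorem bdd_of_cont {f g : ℝ → ℝ} (hf : ContinuousOn f (Icc 0 1)) (h : ∀ x ∈ Ioo (0:ℝ) 1, g x = f x) :
    ∃ N, ∀ x ∈ Ioo (0:ℝ) 1, |g x| ≤ N := by
  obtain ⟨N, hN⟩ := isCompact_Icc.exists_bound_of_continuousOn hf
  exact ⟨N, fun x hx => by rw [h x hx]; exact hN x (Ioo_subset_Icc_self hx)⟩

theorem cont_ρt {D : Dat} (h : Sol D) {t : ℝ} (ht : t ∈ Ioo 0 D.T) : ContinuousOn (fun x =>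
    D.ρ1 x t * (D.ρ1 x t * D.θ x t + D.ρ x t * D.θ1 x t) +
        D.ρ x t * (D.ρ2 x t * D.θ x t + 2 * D.ρ1 x t * D.θ1 x t + D.ρ x t * D.θ2 x t) - D.γ x t)
    (Icc 0 1) := by
  obtain ⟨a0, a1, a2, _, _⟩ := h.C2ρ t ht
  obtain ⟨b0, b1, b2, _, _⟩ := h.C2θ t ht
  have := h.cγ t ht
  fun_prop

theorem cont_θt {D : Dat} (h : Sol D) {t : ℝ} (ht : t ∈ Ioo 0 D.T) : ContinuousOn (fun x =>
    (1 / (D.ρ x t + D.σ)) * (D.ρ x t * (D.ρ1 x t * D.θ x t + D.ρ x t * D.θ1 x t) * D.θ1 x t +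
        ((D.κ₁ + D.κ₂ * D.ρ x t^2) * D.θ2 x t + 2 * D.κ₂ * D.ρ x t * D.ρ1 x t * D.θ1 x t) +
        (D.lam + D.θ x t) * D.γ x t))
    (Icc 0 1) := by
  obtain ⟨a0, a1, a2, _, _⟩ := h.C2ρ t ht
  obtain ⟨b0, b1, b2, _, _⟩ := h.C2θ t ht
  have := h.cγ t ht
  refine ContinuousOn.mul ?_ (by fun_prop)
  refine continuousOn_const.div (a0.add continuousOn_const) ?_
  intro x hx
  have := (h.bd x hx t (Ioo_subset_Icc_self ht)).1
  have := h.hp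
  have := h.hσ
  linarith

noncomputable def Yf (D : Dat) (K : ℝ) (r q : ℝ → ℝ) (s : ℝ) : ℝ :=
  (∫ x in Icc 0 1, (D.ρ x s - r x)^2) + K * ∫ x in Icc 0 1, (D.θ x s - q x)^2

theorem Yf_cont {D : Dat} (h : Sol D) {K : ℝ} {r q : ℝ → ℝ} (hr : ContinuousOn r (Icc 0 1))
    (hq : ContinuousOn q (Icc 0 1)) : ContinuousOn (Yf D K r q) (Icc 0 D.T) := by
  unfold Yf
  refine ContinuousOn.add ?_ (continuousOn_const.mul ?_)
  · refine cont_int (F := fun x s => (D.ρ x s - r x)^2) ?_ measurableSet_Icc subset_rfl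
    exact (h.cρ.sub (hr.comp continuousOn_fst (fun p hp => hp.1))).pow 2
  · refine cont_int (F := fun x s => (D.θ x s - q x)^2) ?_ measurableSet_Icc subset_rfl
    exact (h.cθ.sub (hq.comp continuousOn_fst (fun p hp => hp.1))).pow 2

/-- sum of the integrals of gradients at time t relative to the reference -/
noncomputable def Df (D : Dat) (r1 q1 : ℝ → ℝ) (t : ℝ) : ℝ :=
  ∫ x in Icc 0 1, ((D.ρ1 x t - r1 x)^2 + (D.θ1 x t - q1 x)^2)

theorem energy_time {D : Dat} (h : Sol D) :
    ∃ K > 0, ∃ δ > 0, δ ≤ 1 ∧ ∃ c0 > 0, ∀ N : ℝ, ∃ C ≥ 0, ∀ r q r1 q1 r2 q2 : ℝ → ℝ,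
      C2 r r1 r2 → C2 q q1 q2 →
      (∀ x ∈ Icc (0:ℝ) 1, |r1 x| ≤ N ∧ |q1 x| ≤ N ∧ |r2 x| ≤ N ∧ |q2 x| ≤ N) →
      ∀ t ∈ Ioo 0 D.T, RGood D.ρ t → RGood D.θ t →
      (∀ x ∈ Icc (0:ℝ) 1, |D.ρ x t - r x| ≤ δ ∧ |D.θ x t - q x| ≤ δ) →
      (∀ x, x = 0 ∨ x = 1 → D.ρ x t = D.rb x → r x = D.rb x) →
      (∀ x, x = 0 ∨ x = 1 → D.θ x t = D.qb x → q x = D.qb x) →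
      ∃ y', HasDerivWithinAt (Yf D K r q) y' (Ioi t) t ∧ y' ≤
        - c0 * Df D r1 q1 t +
        C * ((∫ x in Icc 0 1, (|D.ρ x t - r x| + |D.θ x t - q x|)) +
          (|D.ρ 0 t - r 0| + |D.ρ 1 t - r 1| + |D.θ 0 t - q 0| + |D.θ 1 t - q 1|)) := by
  obtain ⟨K, hK, δ, hδ, hδ1, c0, hc0, hE⟩ := energy_slice h.hp h.hpP h.hσ h.hκ₁ h.hκ₂
  refine ⟨K, hK, δ, hδ, hδ1, 2 * c0, by positivity, fun N => ?_⟩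
  obtain ⟨C, hC, hE⟩ := hE N D.lam D.Gb D.Cb h.hlam
  refine ⟨2 * C, by positivity, ?_⟩
  intro r q r1 q1 r2 q2 hr hq hb t ht hGρ hGθ hclose hcρ hcθ
  have htI := Ioo_subset_Icc_self ht
  obtain ⟨N1, hN1⟩ := bdd_of_cont (cont_ρt h ht) (fun x hx => h.eρ x hx t ht)
  obtain ⟨N2, hN2⟩ := bdd_of_cont (cont_θt h ht) (fun x hx => h.eθ x hx t ht)
  have d1 := rd_sq h.cρ ht hGρ hr.c0 (fun x hx => h.tρ x (Ioo_subset_Icc_self hx) t ht) N1 hN1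
  have d2 := rd_sq h.cθ ht hGθ hq.c0 (fun x hx => h.tθ x (Ioo_subset_Icc_self hx) t ht) N2 hN2
  refine ⟨_, d1.add (d2.const_mul K), ?_⟩
  have e := hE (fun x => D.ρ x t) (fun x => D.θ x t) (fun x => D.ρ1 x t) (fun x => D.θ1 x t)
    (fun x => D.ρ2 x t) (fun x => D.θ2 x t) (fun x => D.ρt x t) (fun x => D.θt x t) r q r1 q1 r2 q2
    (fun x => D.γ x t) (h.C2ρ t ht) (h.C2θ t ht) hr hq (h.cγ t ht)
    (fun x hx => by
      obtain ⟨b1, b2, b3, b4⟩ := h.bd x hx t htI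
      obtain ⟨b7, b8, b9, b10⟩ := hb x hx
      exact ⟨b1, b2, b3, b4, (hclose x hx).1, (hclose x hx).2, b7, b8, b9, b10, h.bγ x hx t ht⟩)
    (fun x hx => h.eρ x hx t ht) (fun x hx => h.eθ x hx t ht)
    (fun x hx => (h.bρ x hx t ht).imp_right fun h1 => by rw [hcρ x hx h1, h1, sub_self])
    (fun x hx => (h.bθ x hx t ht).imp_right fun h1 => by rw [hcθ x hx h1, h1, sub_self])
  have i1 : IntegrableOn (fun x => 2 * (D.ρ x t - r x) * D.ρt x t) (Icc 0 1) := by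
    have : ContinuousOn (fun x => 2 * (D.ρ x t - r x) * (D.ρ1 x t * (D.ρ1 x t * D.θ x t + D.ρ x t * D.θ1 x t) +
        D.ρ x t * (D.ρ2 x t * D.θ x t + 2 * D.ρ1 x t * D.θ1 x t + D.ρ x t * D.θ2 x t) - D.γ x t)) (Icc 0 1) :=
      (continuousOn_const.mul ((slice_x h.cρ htI).sub hr.c0)).mul (cont_ρt h ht)
    refine (this.integrableOn_compact isCompact_Icc).congr_fun_ae ?_
    filter_upwards [ae_Ioo01] with x hx
    rw [h.eρ x hx t ht]
  have i2 : IntegrableOn (fun x => 2 * (D.θ x t - q x) * D.θt x t) (Icc 0 1) := by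
    have := (continuousOn_const (c := (2:ℝ))).mul ((slice_x h.cθ htI).sub hq.c0) |>.mul (cont_θt h ht)
    refine (this.integrableOn_compact isCompact_Icc).congr_fun_ae ?_
    filter_upwards [ae_Ioo01] with x hx
    rw [h.eθ x hx t ht]; rfl
  rw [← integral_const_mul, ← integral_add i1 (i2.const_mul K)]
  have e2 : ∫ x in Icc 0 1, (2 * (D.ρ x t - r x) * D.ρt x t + K * (2 * (D.θ x t - q x) * D.θt x t)) =
      2 * ∫ x in Icc 0 1, ((D.ρ x t - r x) * D.ρt x t + K * (D.θ x t - q x) * D.θt x t) := by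
    rw [← integral_const_mul]
    congr 1; ext x; ring
  rw [e2]
  unfold Df
  nlinarith

theorem ref_dir {u : ℝ → ℝ → ℝ} {rb f f1 f2 : ℝ → ℝ} {I : Set ℝ} {η : ℝ} (hf : C2 f f1 f2) (hη : 0 ≤ η)
    (h : ∀ i, i = 0 ∨ i = 1 → ∀ s ∈ I, |u i s - f i| ≤ η) :
    ∃ r r1, C2 r r1 f2 ∧ (∀ x ∈ Icc (0:ℝ) 1, |r x - f x| ≤ η ∧ |r1 x| ≤ |f1 x| + 2 * η) ∧
      ∀ i, i = 0 ∨ i = 1 → ∀ s ∈ I, u i s = rb i → r i = rb i := by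
  have hv : ∀ i, i = 0 ∨ i = 1 → ∃ l : ℝ, |l| ≤ η ∧ ∀ s ∈ I, u i s = rb i → f i + l = rb i := by
    intro i hi
    by_cases hex : ∃ s ∈ I, u i s = rb i
    · obtain ⟨s, hs, he⟩ := hex
      exact ⟨rb i - f i, by rw [← he]; exact h i hi s hs, fun _ _ _ => by ring⟩
    · exact ⟨0, by simpa using hη, fun s hs he => absurd ⟨s, hs, he⟩ hex⟩
  obtain ⟨l0, h0, h0'⟩ := hv 0 (Or.inl rfl)
  obtain ⟨l1, h1, h1'⟩ := hv 1 (Or.inr rfl)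
  obtain ⟨c0, c1, c2, d1, d2⟩ := hf
  refine ⟨fun x => f x + (l0 + (l1 - l0) * x), fun x => f1 x + (l1 - l0), ⟨?_, ?_, c2, ?_, ?_⟩, ?_, ?_⟩
  · fun_prop
  · fun_prop
  · intro x hx
    have := (d1 x hx).add (((hasDerivAt_id x).const_mul (l1 - l0)).const_add l0)
    refine this.congr_deriv (by simp)
  · intro x hx
    exact (d2 x hx).add_const _
  · intro x hx
    have a0 := abs_le.1 h0
    have a1 := abs_le.1 h1
    constructor
    · simp only [add_sub_cancel_left]
      rw [show l0 + (l1 - l0) * x = l0 * (1 - x) + l1 * x by ring, abs_le]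
      have := hx.1
      have := hx.2
      constructor <;> nlinarith
    · refine (abs_add_le _ _).trans ?_
      have : |l1 - l0| ≤ 2 * η := by rw [abs_le]; constructor <;> linarith
      linarith
  · rintro i (rfl | rfl) s hs he
    · have := h0' s hs he; simpa using this
    · have := h1' s hs he; simpa using this

structure Bdd (D : Dat) (N c : ℝ) : Prop where
  b : ∀ x ∈ Icc (0:ℝ) 1, |D.ρ1 x c| ≤ N ∧ |D.θ1 x c| ≤ N ∧ |D.ρ2 x c| ≤ N ∧ |D.θ2 x c| ≤ N
  l : ∀ i, i = 0 ∨ i = 1 → ∀ s ∈ Icc 0 D.T, |D.ρ i s - D.ρ i c| ≤ N * |s - c| ∧ |D.θ i s - D.θ i c| ≤ N * |s - c|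

theorem int_le_one {f : ℝ → ℝ} {B : ℝ} (hf : ContinuousOn f (Icc 0 1)) (h : ∀ x ∈ Icc (0:ℝ) 1, f x ≤ B) :
    ∫ x in Icc 0 1, f x ≤ B := by
  have : ∫ x in Icc (0:ℝ) 1, f x ≤ ∫ x in Icc (0:ℝ) 1, B :=
    setIntegral_mono_on (hf.integrableOn_compact isCompact_Icc) (by simp) measurableSet_Icc h
  simpa using this

theorem abs_young (e τ w : ℝ) (he : 0 < e) (hτ : 0 < τ) : |w| ≤ e / τ * w^2 + τ / (4 * e) := by
  rw [← sq_abs w]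
  have : e / τ * |w|^2 + τ / (4 * e) - |w| = (2 * e * |w| - τ)^2 / (4 * e * τ) := by field_simp; ring
  have h2 : 0 ≤ (2 * e * |w| - τ)^2 / (4 * e * τ) := by positivity
  linarith

theorem sq_bound_ref {a b r : ℝ → ℝ} {η : ℝ} (ha : ContinuousOn a (Icc 0 1)) (hb : ContinuousOn b (Icc 0 1))
    (hr : ContinuousOn r (Icc 0 1)) (h : ∀ x ∈ Icc (0:ℝ) 1, |r x - b x| ≤ η) :
    ∫ x in Icc 0 1, (a x - b x)^2 ≤ 2 * (∫ x in Icc 0 1, (a x - r x)^2) + 2 * η^2 := by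
  have c1 : ContinuousOn (fun x => (a x - b x)^2) (Icc 0 1) := by fun_prop
  have c2 : ContinuousOn (fun x => (a x - r x)^2) (Icc 0 1) := by fun_prop
  have i1 := c1.integrableOn_compact (μ := volume) isCompact_Icc
  have i2 := c2.integrableOn_compact (μ := volume) isCompact_Icc
  have i3 : IntegrableOn (fun _ : ℝ => 2 * η^2) (Icc 0 1) := integrableOn_const (by simp)
  have : ∫ x in Icc 0 1, (a x - b x)^2 ≤ ∫ x in Icc 0 1, (2 * (a x - r x)^2 + 2 * η^2) := by
    refine setIntegral_mono_on i1 ((i2.const_mul 2).add i3) measurableSet_Icc fun x hx => ?_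
    have h1 := h x hx
    have h2 : (r x - b x)^2 ≤ η^2 := by rw [← sq_abs]; exact pow_le_pow_left₀ (abs_nonneg _) h1 2
    nlinarith [sq_nonneg ((a x - r x) - (r x - b x))]
  rw [integral_add (i2.const_mul 2) i3, integral_const_mul] at this
  simpa using this

theorem Yf_split {D : Dat} {K : ℝ} (hK : 0 < K) {r q : ℝ → ℝ} (s : ℝ) :
    (∫ x in Icc 0 1, (D.ρ x s - r x)^2) ≤ Yf D K r q s ∧
    (∫ x in Icc 0 1, (D.θ x s - q x)^2) ≤ 1 / K * Yf D K r q s := by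
  have h1 : 0 ≤ ∫ x in Icc 0 1, (D.ρ x s - r x)^2 := integral_nonneg fun x => sq_nonneg _
  have h2 : 0 ≤ ∫ x in Icc 0 1, (D.θ x s - q x)^2 := integral_nonneg fun x => sq_nonneg _
  unfold Yf
  constructor
  · have := mul_nonneg hK.le h2
    linarith
  · rw [mul_add]
    have : 1 / K * (K * ∫ x in Icc 0 1, (D.θ x s - q x)^2) = ∫ x in Icc 0 1, (D.θ x s - q x)^2 := by
      field_simp
    rw [this]
    have : 0 ≤ 1 / K * ∫ x in Icc 0 1, (D.ρ x s - r x)^2 := by positivity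
    linarith

set_option maxHeartbeats 1000000 in
theorem gap {D : Dat} (h : Sol D) (N : ℝ) : ∃ τ0 > 0, ∃ C ≥ 0, ∀ c ∈ Ioo 0 D.T, ∀ d ∈ Ioo 0 D.T, c < d →
    d - c ≤ τ0 → Bdd D N c → (∀ s ∈ Ioo c d, RGood D.ρ s ∧ RGood D.θ s) →
    (∫ x in Icc 0 1, (D.ρ x d - D.ρ x c)^2) ≤ C * (d - c)^2 ∧
    (∫ x in Icc 0 1, (D.θ x d - D.θ x c)^2) ≤ C * (d - c)^2 := by
  obtain ⟨K, hK, δ, hδ, hδ1, c0, hc0, hE⟩ := energy_time h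
  obtain ⟨C, hC, hE⟩ := hE (N + 1)
  obtain ⟨δ1, hδ1', hu1⟩ := unif_t h.cρ (half_pos hδ)
  obtain ⟨δ2, hδ2', hu2⟩ := unif_t h.cθ (half_pos hδ)
  set e := 1 / (2 * (C + 1) * (1 + 1 / K)) with he
  have he0 : 0 < e := by positivity
  have heC : C * e * (1 + 1 / K) ≤ 1 / 2 := by
    rw [he]
    have : C * (1 / (2 * (C + 1) * (1 + 1 / K))) * (1 + 1 / K) = C / (C + 1) / 2 := by field_simp
    rw [this]
    have : C / (C + 1) ≤ 1 := by rw [div_le_one (by positivity)]; linarith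
    linarith
  set A := 2 * ((1 + K) * N^2 + C * (1 / (2 * e) + 8 * |N|)) with hA
  have hA0 : 0 ≤ A := by positivity
  refine ⟨min (δ1 / 2) (min (δ2 / 2) (δ / (2 * (|N| + 1)))), by positivity,
    2 * A + 2 * (1 / K * A) + 2 * N^2, by positivity, ?_⟩
  intro c hc d hd hcd hτ0 hB hRG
  have hcI := Ioo_subset_Icc_self hc
  have hdI := Ioo_subset_Icc_self hd
  set τ := d - c with hτ
  have hτp : 0 < τ := sub_pos.2 hcd
  have hτ1 : τ ≤ δ1 / 2 := hτ0.trans (min_le_left _ _)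
  have hτ2 : τ ≤ δ2 / 2 := hτ0.trans ((min_le_right _ _).trans (min_le_left _ _))
  have hτ3 : τ ≤ δ / (2 * (|N| + 1)) := hτ0.trans ((min_le_right _ _).trans (min_le_right _ _))
  have hN0 : 0 ≤ N := (abs_nonneg _).trans (hB.b 0 (by simp)).1
  rw [abs_of_nonneg hN0] at hτ3 hA
  set η := N * τ with hη
  have hη0 : 0 ≤ η := by positivity
  have hηδ : η ≤ δ / 2 := by
    calc η ≤ (N + 1) * τ := by rw [hη]; nlinarith
      _ ≤ (N + 1) * (δ / (2 * (N + 1))) := by gcongr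
      _ = δ / 2 := by field_simp
  have hsub : Icc c d ⊆ Icc 0 D.T := Icc_subset_Icc hc.1.le hd.2.le
  have hlip : ∀ i, i = 0 ∨ i = 1 → ∀ s ∈ Ioo c d, |D.ρ i s - D.ρ i c| ≤ η ∧ |D.θ i s - D.θ i c| ≤ η := by
    intro i hi s hs
    have h1 := hB.l i hi s (hsub (Ioo_subset_Icc_self hs))
    have h2 : |s - c| ≤ τ := by rw [abs_of_pos (by linarith [hs.1])]; linarith [hs.2]
    have h3 : N * |s - c| ≤ η := by rw [hη]; gcongr
    exact ⟨h1.1.trans h3, h1.2.trans h3⟩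
  obtain ⟨r, r1, hr, hrb, hrd⟩ := ref_dir (rb := D.rb) (h.C2ρ c hc) hη0 (fun i hi s hs => (hlip i hi s hs).1)
  obtain ⟨q, q1, hq, hqb, hqd⟩ := ref_dir (rb := D.qb) (h.C2θ c hc) hη0 (fun i hi s hs => (hlip i hi s hs).2)
  set Y := Yf D K r q with hY
  have hYc : ContinuousOn Y (Icc c d) := (Yf_cont h hr.c0 hq.c0).mono hsub
  obtain ⟨sm, hsm, hmax⟩ := isCompact_Icc.exists_isMaxOn (nonempty_Icc.2 hcd.le) hYc
  have hmax' : ∀ s ∈ Icc c d, Y s ≤ Y sm := fun s hs => hmax hs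
  have hYn : ∀ s, 0 ≤ Y s := fun s => by
    refine add_nonneg (integral_nonneg fun x => sq_nonneg _)
      (mul_nonneg hK.le (integral_nonneg fun x => sq_nonneg _))
  set φ := C * ((e / τ) * ((1 + 1 / K) * Y sm) + τ / (2 * e) + 8 * η) with hφ
  have hder : ∀ s ∈ Ioo c d, ∃ y', HasDerivWithinAt Y y' (Ioi s) s ∧ y' ≤ φ := by
    intro s hs
    have hsT : s ∈ Ioo 0 D.T := ⟨hc.1.trans hs.1, hs.2.trans hd.2⟩
    have hsI := Ioo_subset_Icc_self hsT
    have hsc : |s - c| ≤ τ := by rw [abs_of_pos (by linarith [hs.1])]; linarith [hs.2]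
    obtain ⟨y', hy, hle⟩ := hE r q r1 q1 _ _ hr hq
      (fun x hx => by
        have h1 := hB.b x hx
        have h2 := hrb x hx
        have h3 := hqb x hx
        exact ⟨by linarith [h1.1, h2.2], by linarith [h1.2.1, h3.2],
          by linarith [h1.2.2.1], by linarith [h1.2.2.2]⟩)
      s hsT (hRG s hs).1 (hRG s hs).2
      (fun x hx => by
        have a1 := hu1 x hx s hsI c hcI (by linarith)
        have a2 := hu2 x hx s hsI c hcI (by linarith)
        have b1 := (hrb x hx).1
        have b2 := (hqb x hx).1
        rw [abs_lt] at a1 a2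
        rw [abs_le] at b1 b2
        constructor <;> rw [abs_le] <;> constructor <;> linarith [a1.1, a1.2, a2.1, a2.2, b1.1, b1.2, b2.1, b2.2])
      (fun i hi he => hrd i hi s hs he) (fun i hi he => hqd i hi s hs he)
    refine ⟨y', hy, hle.trans ?_⟩
    have hDf : 0 ≤ Df D r1 q1 s := integral_nonneg fun x => by positivity
    have hbdry : |D.ρ 0 s - r 0| + |D.ρ 1 s - r 1| + |D.θ 0 s - q 0| + |D.θ 1 s - q 1| ≤ 8 * η := by
      have tri : ∀ a b c : ℝ, |a - b| ≤ η → |c - b| ≤ η → |a - c| ≤ 2 * η := by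
        intro a b c h1 h2
        rw [abs_le] at h1 h2 ⊢
        constructor <;> linarith [h1.1, h1.2, h2.1, h2.2]
      have a1 := tri _ _ _ (hlip 0 (Or.inl rfl) s hs).1 (hrb 0 (by simp)).1
      have a2 := tri _ _ _ (hlip 1 (Or.inr rfl) s hs).1 (hrb 1 (by simp)).1
      have a3 := tri _ _ _ (hlip 0 (Or.inl rfl) s hs).2 (hqb 0 (by simp)).1
      have a4 := tri _ _ _ (hlip 1 (Or.inr rfl) s hs).2 (hqb 1 (by simp)).1
      linarith
    have hρs := slice_x h.cρ hsI
    have hθs := slice_x h.cθ hsI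
    have hrc := hr.c0
    have hqc := hq.c0
    have c1 : ContinuousOn (fun x => |D.ρ x s - r x| + |D.θ x s - q x|) (Icc 0 1) := by fun_prop
    have c2 : ContinuousOn (fun x => (D.ρ x s - r x)^2) (Icc 0 1) := by fun_prop
    have c3 : ContinuousOn (fun x => (D.θ x s - q x)^2) (Icc 0 1) := by fun_prop
    have i1 := c1.integrableOn_compact (μ := volume) isCompact_Icc
    have i2 := c2.integrableOn_compact (μ := volume) isCompact_Icc
    have i3 := c3.integrableOn_compact (μ := volume) isCompact_Icc
    have i4 : IntegrableOn (fun _ : ℝ => τ / (2 * e)) (Icc 0 1) := integrableOn_const (by simp)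
    have i23 : IntegrableOn (fun x => e / τ * (D.ρ x s - r x)^2 + e / τ * (D.θ x s - q x)^2) (Icc 0 1) :=
      (i2.const_mul _).add (i3.const_mul _)
    have hInteg : ∫ x in Icc 0 1, (|D.ρ x s - r x| + |D.θ x s - q x|) ≤
        (e / τ) * ((1 + 1 / K) * Y sm) + τ / (2 * e) := by
      have : ∫ x in Icc 0 1, (|D.ρ x s - r x| + |D.θ x s - q x|) ≤
          ∫ x in Icc 0 1, (e / τ * (D.ρ x s - r x)^2 + e / τ * (D.θ x s - q x)^2 + τ / (2 * e)) := by
        refine setIntegral_mono_on i1 (((i2.const_mul _).add (i3.const_mul _)).add i4) measurableSet_Icc ?_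
        intro x hx
        have y1 := abs_young e τ (D.ρ x s - r x) he0 hτp
        have y2 := abs_young e τ (D.θ x s - q x) he0 hτp
        have y3 : τ / (2 * e) = τ / (4 * e) + τ / (4 * e) := by field_simp; ring
        linarith
      rw [integral_add i23 i4, integral_add (i2.const_mul _) (i3.const_mul _),
        integral_const_mul, integral_const_mul] at this
      simp only [integral_const, MeasurableSet.univ, measureReal_restrict_apply, univ_inter,
        Real.volume_real_Icc, sub_zero, zero_le_one, sup_of_le_left, smul_eq_mul, one_mul] at this
      obtain ⟨s1, s2⟩ := Yf_split (D := D) hK (r := r) (q := q) s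
      have s3 := hmax' s (Ioo_subset_Icc_self hs)
      have s4 : (∫ x in Icc 0 1, (D.ρ x s - r x)^2) + (∫ x in Icc 0 1, (D.θ x s - q x)^2) ≤
          (1 + 1 / K) * Y sm := by
        have : (1 + 1 / K) * Y s ≤ (1 + 1 / K) * Y sm := by gcongr
        rw [← hY] at s1 s2
        linarith
      have s5 : e / τ * ((∫ x in Icc 0 1, (D.ρ x s - r x)^2) + (∫ x in Icc 0 1, (D.θ x s - q x)^2)) ≤
        e / τ * ((1 + 1 / K) * Y sm) := by gcongr
      linarith
    have : 0 ≤ c0 * Df D r1 q1 s := by positivity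
    have : C * ((∫ x in Icc 0 1, (|D.ρ x s - r x| + |D.θ x s - q x|)) +
          (|D.ρ 0 s - r 0| + |D.ρ 1 s - r 1| + |D.θ 0 s - q 0| + |D.θ 1 s - q 1|)) ≤ φ := by
      rw [hφ]; gcongr
    linarith
  choose! Y' hY' hY'le using hder
  have hinc := intervalIntegral.sub_le_integral_of_hasDeriv_right_of_le hsm.1
    (hYc.mono (Icc_subset_Icc_right hsm.2))
    (fun s hs => hY' s ⟨hs.1, hs.2.trans_le hsm.2⟩)
    (φ := fun _ => φ) (by simp) (fun s hs => hY'le s ⟨hs.1, hs.2.trans_le hsm.2⟩)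
  rw [intervalIntegral.integral_const, smul_eq_mul] at hinc
  have hφ0 : 0 ≤ φ := by have := hYn sm; positivity
  have hstep : (sm - c) * φ ≤ τ * φ := by
    have : sm - c ≤ τ := by linarith [hsm.2]
    gcongr
  have hτφ : τ * φ = C * e * (1 + 1 / K) * Y sm + C * (1 / (2 * e) + 8 * N) * τ^2 := by
    rw [hφ, hη]; field_simp; ring
  have hYc0 : Y c ≤ (1 + K) * N^2 * τ^2 := by
    have c1 : ∫ x in Icc 0 1, (D.ρ x c - r x)^2 ≤ η^2 := by
      have a := slice_x h.cρ hcI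
      have b := hr.c0
      refine int_le_one (by fun_prop) fun x hx => ?_
      rw [← sq_abs, abs_sub_comm]
      exact pow_le_pow_left₀ (abs_nonneg _) (hrb x hx).1 2
    have c2 : ∫ x in Icc 0 1, (D.θ x c - q x)^2 ≤ η^2 := by
      have a := slice_x h.cθ hcI
      have b := hq.c0
      refine int_le_one (by fun_prop) fun x hx => ?_
      rw [← sq_abs, abs_sub_comm]
      exact pow_le_pow_left₀ (abs_nonneg _) (hqb x hx).1 2
    have c3 : K * ∫ x in Icc 0 1, (D.θ x c - q x)^2 ≤ K * η^2 := by gcongr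
    rw [hY]; unfold Yf
    rw [show (1 + K) * N^2 * τ^2 = η^2 + K * η^2 by rw [hη]; ring]
    linarith
  have hYsm : Y sm ≤ A * τ^2 := by
    have h1 : C * e * (1 + 1 / K) * Y sm ≤ 1 / 2 * Y sm := mul_le_mul_of_nonneg_right heC (hYn sm)
    have h2 : A * τ^2 = 2 * ((1 + K) * N^2 * τ^2 + C * (1 / (2 * e) + 8 * N) * τ^2) := by rw [hA]; ring
    linarith
  have hYd : Y d ≤ A * τ^2 := (hmax' d (right_mem_Icc.2 hcd.le)).trans hYsm
  obtain ⟨s1, s2⟩ := Yf_split (D := D) hK (r := r) (q := q) d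
  rw [← hY] at s1 s2
  have f1 := sq_bound_ref (slice_x h.cρ hdI) (slice_x h.cρ hcI) hr.c0 (fun x hx => (hrb x hx).1)
  have f2 := sq_bound_ref (slice_x h.cθ hdI) (slice_x h.cθ hcI) hq.c0 (fun x hx => (hqb x hx).1)
  have g1 : 1 / K * Y d ≤ 1 / K * (A * τ^2) := by gcongr
  have g2 : η^2 = N^2 * τ^2 := by rw [hη]; ring
  have g3 : 0 ≤ 1 / K * (A * τ^2) := by positivity
  have g4 : 0 ≤ A * τ^2 := by positivity
  rw [show (2 * A + 2 * (1 / K * A) + 2 * N^2) * τ^2 =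
    2 * (A * τ^2) + 2 * (1 / K * (A * τ^2)) + 2 * (N^2 * τ^2) by ring]
  constructor <;> linarith

theorem mvt_abs {f f' : ℝ → ℝ} {a b B : ℝ} (hab : a ≤ b) (hf : ContinuousOn f (Icc a b))
    (hd : ∀ x ∈ Ioo a b, HasDerivAt f (f' x) x) (hB : ∀ x ∈ Ioo a b, |f' x| ≤ B) :
    |f b - f a| ≤ B * (b - a) := by
  rcases hab.eq_or_lt with rfl | hlt
  · simp
  obtain ⟨c, hc, he⟩ := exists_hasDerivAt_eq_slope f f' hlt hf hd
  have hp : 0 < b - a := sub_pos.2 hlt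
  rw [eq_div_iff hp.ne'] at he
  rw [← he, abs_mul, abs_of_pos hp]
  exact mul_le_mul_of_nonneg_right (hB c hc) hp.le

theorem mvt_abs' {f f' : ℝ → ℝ} {B : ℝ} (hf : ContinuousOn f (Icc 0 1))
    (hd : ∀ x ∈ Ioo (0:ℝ) 1, HasDerivAt f (f' x) x) (hB : ∀ x ∈ Ioo (0:ℝ) 1, |f' x| ≤ B)
    {x y : ℝ} (hx : x ∈ Icc (0:ℝ) 1) (hy : y ∈ Icc (0:ℝ) 1) :
    |f x - f y| ≤ B * |x - y| := by
  wlog hxy : y ≤ x generalizing x y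
  · rw [abs_sub_comm, abs_sub_comm x]
    exact this hy hx (le_of_not_ge hxy)
  rw [abs_of_nonneg (sub_nonneg.2 hxy)]
  have hs : Ioo y x ⊆ Ioo 0 1 := Ioo_subset_Ioo hy.1 hx.2
  exact mvt_abs hxy (hf.mono (Icc_subset_Icc hy.1 hx.2)) (fun z hz => hd z (hs hz)) (fun z hz => hB z (hs hz))

/-- slice regularity with constant N at time t -/
structure KU (u : ℝ → ℝ → ℝ) (T N t : ℝ) : Prop where
  l1 : ∀ x ∈ Icc (0:ℝ) 1, ∀ y ∈ Icc (0:ℝ) 1, |u x t - u y t| ≤ N * |x - y|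
  l2 : ∀ x ∈ Icc (0:ℝ) 1, ∀ y ∈ Icc (0:ℝ) 1, ∀ h, x + h ∈ Icc (0:ℝ) 1 → y + h ∈ Icc (0:ℝ) 1 →
    |(u (x + h) t - u (y + h) t) - (u x t - u y t)| ≤ N * |x - y| * |h|
  l3 : ∀ i, i = 0 ∨ i = 1 → ∀ s ∈ Icc 0 T, |u i s - u i t| ≤ N * |s - t|

theorem KU.mono {u : ℝ → ℝ → ℝ} {T N N' t : ℝ} (h : KU u T N t) (hN : N ≤ N') : KU u T N' t := by
  refine ⟨fun x hx y hy => (h.l1 x hx y hy).trans (by gcongr),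
    fun x hx y hy e h1 h2 => (h.l2 x hx y hy e h1 h2).trans (by gcongr),
    fun i hi s hs => (h.l3 i hi s hs).trans (by gcongr)⟩

theorem KU_closed {u : ℝ → ℝ → ℝ} {T N : ℝ}
    (hu : ContinuousOn (fun p : ℝ × ℝ => u p.1 p.2) (Icc 0 1 ×ˢ Icc 0 T)) :
    IsClosed {t | t ∈ Icc 0 T ∧ KU u T N t} := by
  refine isClosed_of_closure_subset fun t ht => ?_
  have htI : t ∈ Icc 0 T := closure_minimal (fun s hs => hs.1) isClosed_Icc ht
  have hc : ∀ x ∈ Icc (0:ℝ) 1, ContinuousWithinAt (fun s => u x s) {t | t ∈ Icc 0 T ∧ KU u T N t} t :=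
    fun x hx => ((slice_t hu hx) t htI).mono (fun s hs => hs.1)
  refine ⟨htI, ?_, ?_, ?_⟩
  · intro x hx y hy
    refine ContinuousWithinAt.closure_le ht ((hc x hx).sub (hc y hy)).abs continuousWithinAt_const ?_
    exact fun s hs => hs.2.l1 x hx y hy
  · intro x hx y hy h h1 h2
    refine ContinuousWithinAt.closure_le ht (((hc _ h1).sub (hc _ h2)).sub ((hc x hx).sub (hc y hy))).abs
      continuousWithinAt_const ?_
    exact fun s hs => hs.2.l2 x hx y hy h h1 h2
  · intro i hi s hs
    have hiI : i ∈ Icc (0:ℝ) 1 := by rcases hi with rfl | rfl <;> simp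
    refine ContinuousWithinAt.closure_le ht (continuousWithinAt_const.sub (hc i hiI)).abs
      (g := fun t => N * |s - t|) (by fun_prop) ?_
    exact fun s' hs' => hs'.2.l3 i hi s hs

theorem KU_cover {u u1 u2 : ℝ → ℝ → ℝ} {T t : ℝ}
    (hu : ContinuousOn (fun p : ℝ × ℝ => u p.1 p.2) (Icc 0 1 ×ˢ Icc 0 T)) (ht : t ∈ Ioo 0 T)
    (h2 : C2 (fun x => u x t) (fun x => u1 x t) (fun x => u2 x t))
    (hd : ∀ i, i = 0 ∨ i = 1 → DifferentiableAt ℝ (fun s => u i s) t) : ∃ n : ℕ, KU u T n t := by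
  obtain ⟨c0, c1, c2, d1, d2⟩ := h2
  obtain ⟨B1, hB1⟩ := isCompact_Icc.exists_bound_of_continuousOn c1
  obtain ⟨B2, hB2⟩ := isCompact_Icc.exists_bound_of_continuousOn c2
  obtain ⟨n0, hn0⟩ := pt_lip (slice_t hu (x := 0) (by simp)) ht (hd 0 (Or.inl rfl))
  obtain ⟨n1, hn1⟩ := pt_lip (slice_t hu (x := 1) (by simp)) ht (hd 1 (Or.inr rfl))
  obtain ⟨n, hn⟩ := exists_nat_ge (max (max B1 B2) (max n0 n1))
  have a1 : B1 ≤ n := le_trans (by simp) hn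
  have a2 : B2 ≤ n := le_trans (by simp) hn
  have a3 : (n0:ℝ) ≤ n := le_trans (by simp) hn
  have a4 : (n1:ℝ) ≤ n := le_trans (by simp) hn
  have L1 : ∀ x ∈ Icc (0:ℝ) 1, ∀ y ∈ Icc (0:ℝ) 1, |u x t - u y t| ≤ n * |x - y| := fun x hx y hy =>
    mvt_abs' c0 d1 (fun z hz => (hB1 z (Ioo_subset_Icc_self hz)).trans a1) hx hy
  have L2 : ∀ x ∈ Icc (0:ℝ) 1, ∀ y ∈ Icc (0:ℝ) 1, |u1 x t - u1 y t| ≤ n * |x - y| := fun x hx y hy =>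
    mvt_abs' c1 d2 (fun z hz => (hB2 z (Ioo_subset_Icc_self hz)).trans a2) hx hy
  refine ⟨n, L1, ?_, ?_⟩
  · intro x hx y hy h hxh hyh
    wlog hxy : y ≤ x generalizing x y
    · have := this y hy x hx hyh hxh (le_of_not_ge hxy)
      rw [abs_sub_comm x y]
      convert this using 1
      rw [← abs_neg]; congr 1; ring
    rw [abs_of_nonneg (sub_nonneg.2 hxy)]
    have hs : Icc y x ⊆ Icc 0 1 := Icc_subset_Icc hy.1 hx.2
    have := mvt_abs (f := fun z => u (z + h) t - u z t) (f' := fun z => u1 (z + h) t - u1 z t)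
      (B := n * |h|) hxy ?_ ?_ ?_
    · calc _ = |u (x + h) t - u x t - (u (y + h) t - u y t)| := by congr 1; ring
        _ ≤ _ := this
        _ = _ := by ring
    · refine ContinuousOn.sub ?_ (c0.mono hs)
      refine c0.comp (f := fun z => z + h) (by fun_prop) fun z hz => ?_
      exact ⟨by linarith [hz.1, hyh.1], by linarith [hz.2, hxh.2]⟩
    · intro z hz
      refine HasDerivAt.sub ?_ (d1 z ⟨hy.1.trans_lt hz.1, hz.2.trans_le hx.2⟩)
      exact (d1 (z + h) ⟨by linarith [hz.1, hyh.1], by linarith [hz.2, hxh.2]⟩).comp_add_const z h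
    · intro z hz
      have := L2 (z + h) ⟨by linarith [hz.1, hyh.1], by linarith [hz.2, hxh.2]⟩ z (hs (Ioo_subset_Icc_self hz))
      simpa using this
  · rintro i (rfl | rfl) s hs
    · exact (hn0 s hs).trans (by gcongr)
    · exact (hn1 s hs).trans (by gcongr)

theorem bd_ext {f : ℝ → ℝ} {N : ℝ} (hf : ContinuousOn f (Icc 0 1)) (h : ∀ x ∈ Ioo (0:ℝ) 1, |f x| ≤ N) :
    ∀ x ∈ Icc (0:ℝ) 1, |f x| ≤ N := by
  intro x hx
  refine ContinuousWithinAt.closure_le (s := Ioo 0 1) (by rwa [closure_Ioo (by norm_num)])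
    ((hf x hx).mono Ioo_subset_Icc_self).abs continuousWithinAt_const h

theorem KU_bd {u u1 u2 : ℝ → ℝ → ℝ} {T N t : ℝ} (hN : 0 ≤ N)
    (h2 : C2 (fun x => u x t) (fun x => u1 x t) (fun x => u2 x t)) (hK : KU u T N t) :
    ∀ x ∈ Icc (0:ℝ) 1, |u1 x t| ≤ N ∧ |u2 x t| ≤ N := by
  obtain ⟨c0, c1, c2, d1, d2⟩ := h2
  have n1 : ∀ x ∈ Ioo (0:ℝ) 1, Icc (0:ℝ) 1 ∈ 𝓝 x := fun x hx => Icc_mem_nhds hx.1 hx.2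
  have s1 : ∀ x ∈ Ioo (0:ℝ) 1, |u1 x t| ≤ N := by
    intro x hx
    refine (d1 x hx).le_of_lip' hN ?_
    filter_upwards [n1 x hx] with y hy using hK.l1 y hy x (Ioo_subset_Icc_self hx)
  have s2 : ∀ x ∈ Ioo (0:ℝ) 1, ∀ y ∈ Ioo (0:ℝ) 1, |u1 x t - u1 y t| ≤ N * |x - y| := by
    intro x hx y hy
    have hd : HasDerivAt (fun h => u (x + h) t - u (y + h) t) (u1 x t - u1 y t) 0 := by
      refine HasDerivAt.sub ?_ ?_
      · exact HasDerivAt.comp_const_add x 0 (f := fun x => u x t) (by simpa using d1 x hx)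
      · exact HasDerivAt.comp_const_add y 0 (f := fun x => u x t) (by simpa using d1 y hy)
    refine hd.le_of_lip' (by positivity) ?_
    have e1 : ∀ x ∈ Ioo (0:ℝ) 1, ∀ᶠ h in 𝓝 (0:ℝ), x + h ∈ Icc (0:ℝ) 1 := by
      intro x hx
      have : Tendsto (fun h : ℝ => x + h) (𝓝 0) (𝓝 x) := by
        have : ContinuousAt (fun h : ℝ => x + h) 0 := by fun_prop
        simpa [ContinuousAt] using this
      exact this (n1 x hx)
    filter_upwards [e1 x hx, e1 y hy] with h h1 h2
    have := hK.l2 x (Ioo_subset_Icc_self hx) y (Ioo_subset_Icc_self hy) h h1 h2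
    simpa using this
  have s3 : ∀ x ∈ Ioo (0:ℝ) 1, |u2 x t| ≤ N := by
    intro x hx
    refine (d2 x hx).le_of_lip' hN ?_
    filter_upwards [Ioo_mem_nhds hx.1 hx.2] with y hy using s2 y hy x hx
  exact fun x hx => ⟨bd_ext c1 s1 x hx, bd_ext c2 s3 x hx⟩

theorem Bdd_t {D : Dat} (h : Sol D) (N : ℝ) : ∃ N', 0 ≤ N' ∧ ∀ t ∈ Ioo 0 D.T, Bdd D N t →
    ∀ x ∈ Ioo (0:ℝ) 1, |D.ρt x t| ≤ N' ∧ |D.θt x t| ≤ N' := by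
  have hσ := h.hσ
  have hκ₁ := h.hκ₁
  have hκ₂ := h.hκ₂
  have hlam := h.hlam
  have hP : 0 < D.P := h.hp.trans_le h.hpP
  set A := |N| * (|N| * D.P + D.P * |N|) + D.P * (|N| * D.P + 2 * |N| * |N| + D.P * |N|) + |D.Gb| with hA
  set A2 := (1 / D.σ) * (D.P * (|N| * D.P + D.P * |N|) * |N| +
        ((D.κ₁ + D.κ₂ * D.P^2) * |N| + 2 * D.κ₂ * D.P * |N| * |N|) +
        (D.lam + D.P) * |D.Gb|) with hA2
  refine ⟨A + A2, by positivity, ?_⟩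
  intro t ht hB x hx
  have hA0 : 0 ≤ A := by positivity
  have hA20 : 0 ≤ A2 := by positivity
  have hxI := Ioo_subset_Icc_self hx
  have htI := Ioo_subset_Icc_self ht
  obtain ⟨b1, b2, b3, b4⟩ := h.bd x hxI t htI
  obtain ⟨g1, g2, g3, g4⟩ := hB.b x hxI
  have g5 := (h.bγ x hxI t ht).trans (le_abs_self _)
  have hp := h.hp
  have hN := le_abs_self N
  replace g1 := g1.trans hN
  replace g2 := g2.trans hN
  replace g3 := g3.trans hN
  replace g4 := g4.trans hN
  have b2' : |D.ρ x t| ≤ D.P := by rw [abs_of_pos (by linarith)]; exact b2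
  have b4' : |D.θ x t| ≤ D.P := by rw [abs_of_pos (by linarith)]; exact b4
  have mul2 : ∀ {a b A B : ℝ}, |a| ≤ A → |b| ≤ B → |a * b| ≤ A * B := by
    intro a b A B h1 h2
    rw [abs_mul]; exact mul_le_mul h1 h2 (abs_nonneg _) ((abs_nonneg _).trans h1)
  have add2 : ∀ {a b A B : ℝ}, |a| ≤ A → |b| ≤ B → |a + b| ≤ A + B := fun h1 h2 =>
    (abs_add_le _ _).trans (add_le_add h1 h2)
  have hc : ∀ {a : ℝ}, 0 ≤ a → |a| ≤ a := fun h => (abs_of_nonneg h).le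
  have hF := add2 (mul2 g1 b4') (mul2 b2' g2)
  constructor
  · rw [h.eρ x hx t ht]
    have : |D.ρ1 x t * (D.ρ1 x t * D.θ x t + D.ρ x t * D.θ1 x t) +
        D.ρ x t * (D.ρ2 x t * D.θ x t + 2 * D.ρ1 x t * D.θ1 x t + D.ρ x t * D.θ2 x t) + (- D.γ x t)| ≤ A :=
      add2 (add2 (mul2 g1 hF) (mul2 b2' (add2 (add2 (mul2 g3 b4')
        (mul2 (mul2 (hc (by norm_num)) g1) g2)) (mul2 b2' g4)))) (by rw [abs_neg]; exact g5)
    rw [sub_eq_add_neg]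
    linarith
  · rw [h.eθ x hx t ht]
    have : |(1 / (D.ρ x t + D.σ)) * (D.ρ x t * (D.ρ1 x t * D.θ x t + D.ρ x t * D.θ1 x t) * D.θ1 x t +
        ((D.κ₁ + D.κ₂ * D.ρ x t^2) * D.θ2 x t + 2 * D.κ₂ * D.ρ x t * D.ρ1 x t * D.θ1 x t) +
        (D.lam + D.θ x t) * D.γ x t)| ≤ A2 := by
      refine mul2 ?_ (add2 (add2 (mul2 (mul2 b2' hF) g2) (add2 (mul2 ?_ g4)
        (mul2 (mul2 (mul2 (hc (by positivity)) b2') g1) g2))) (mul2 (add2 (hc hlam.le) b4') g5))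
      · rw [abs_of_pos (by apply one_div_pos.2; linarith)]
        apply one_div_le_one_div_of_le hσ; linarith
      · refine add2 (hc hκ₁.le) (mul2 (hc hκ₂.le) ?_)
        rw [abs_pow]; exact pow_le_pow_left₀ (abs_nonneg _) b2' 2
    linarith

theorem sq_tri {a b c : ℝ → ℝ} (ha : ContinuousOn a (Icc 0 1)) (hb : ContinuousOn b (Icc 0 1))
    (hc : ContinuousOn c (Icc 0 1)) :
    ∫ x in Icc 0 1, (a x - b x)^2 ≤ 2 * (∫ x in Icc 0 1, (a x - c x)^2) + 2 * ∫ x in Icc 0 1, (c x - b x)^2 := by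
  have c1 : ContinuousOn (fun x => (a x - b x)^2) (Icc 0 1) := by fun_prop
  have c2 : ContinuousOn (fun x => (a x - c x)^2) (Icc 0 1) := by fun_prop
  have c3 : ContinuousOn (fun x => (c x - b x)^2) (Icc 0 1) := by fun_prop
  have i1 := c1.integrableOn_compact (μ := volume) isCompact_Icc
  have i2 := c2.integrableOn_compact (μ := volume) isCompact_Icc
  have i3 := c3.integrableOn_compact (μ := volume) isCompact_Icc
  have : ∫ x in Icc 0 1, (a x - b x)^2 ≤ ∫ x in Icc 0 1, (2 * (a x - c x)^2 + 2 * (c x - b x)^2) := by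
    refine setIntegral_mono_on i1 ((i2.const_mul 2).add (i3.const_mul 2)) measurableSet_Icc fun x hx => ?_
    nlinarith [sq_nonneg ((a x - c x) - (c x - b x))]
  rw [integral_add (i2.const_mul 2) (i3.const_mul 2), integral_const_mul, integral_const_mul] at this
  exact this

/-- local step: from the gap estimate and the estimate on S to RGood at t1 -/
theorem rgood_of {u ut : ℝ → ℝ → ℝ} {T : ℝ}
    (hu : ContinuousOn (fun p : ℝ × ℝ => u p.1 p.2) (Icc 0 1 ×ˢ Icc 0 T)) {S : Set ℝ}
    (hS : IsCompact S) (hST : S ⊆ Ioo 0 T)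
    (hd : ∀ x ∈ Icc (0:ℝ) 1, ∀ t ∈ S, HasDerivAt (fun s => u x s) (ut x t) t)
    (C N : ℝ) (hC : 0 ≤ C) (hN0 : 0 ≤ N) (hN : ∀ t ∈ S, ∀ x ∈ Ioo (0:ℝ) 1, |ut x t| ≤ N) {b : ℝ} (hb : b < T)
    (hSb : ∀ s ∈ S, s ≤ b)
    (hgap : ∀ c ∈ S, ∀ d, d ≤ b → c < d → (∀ s ∈ Ioo c d, s ∉ S) →
      ∫ x in Icc 0 1, (u x d - u x c)^2 ≤ C * (d - c)^2) {t1 : ℝ} (ht1 : t1 ∈ S) (htb : t1 < b) :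
    RGood u t1 := by
  obtain ⟨ε, hε, C1, h1⟩ := abs_lip hu hS hST hd (C + N + 1) (by positivity)
    (fun t ht x hx => (hN t ht x hx).trans (by linarith))
    (fun c hc d hd hcd hs => (hgap c hc d (hSb d hd) hcd hs).trans (by gcongr; nlinarith)) ht1
  refine ⟨2 * C + 2 * |C1|, ?_⟩
  have ev : ∀ᶠ s in 𝓝[>] t1, s ∈ Ioo t1 (min b (t1 + ε)) :=
    Ioo_mem_nhdsGT (by simp [htb, hε])
  filter_upwards [ev] with s hs
  have hsb : s < b := hs.2.trans_le (min_le_left _ _)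
  have hse : s < t1 + ε := hs.2.trans_le (min_le_right _ _)
  have hK : IsCompact (S ∩ Icc t1 s) := hS.inter_right isClosed_Icc
  obtain ⟨c, hcm, hcmax⟩ := hK.exists_isGreatest ⟨t1, ht1, left_mem_Icc.2 hs.1.le⟩
  have ht1T := hST ht1
  have hcT := hST hcm.1
  have k0 : t1 ∈ Icc 0 T := Ioo_subset_Icc_self ht1T
  have kc : c ∈ Icc 0 T := Ioo_subset_Icc_self hcT
  have ks : s ∈ Icc 0 T := ⟨ht1T.1.le.trans hs.1.le, hsb.le.trans hb.le⟩
  have e1 := h1 c hcm.1 (by rw [abs_of_nonneg (by linarith [hcm.2.1])]; linarith [hcm.2.2])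
  have e1' : ∫ x in Icc 0 1, (u x c - u x t1)^2 ≤ |C1| * (s - t1)^2 := by
    refine e1.trans ?_
    have : (c - t1)^2 ≤ (s - t1)^2 := pow_le_pow_left₀ (by linarith [hcm.2.1]) (by linarith [hcm.2.2]) 2
    have h3 := le_abs_self C1
    calc C1 * (c - t1)^2 ≤ |C1| * (c - t1)^2 := by gcongr
      _ ≤ _ := by gcongr
  have e2 : ∫ x in Icc 0 1, (u x s - u x c)^2 ≤ C * (s - t1)^2 := by
    rcases hcm.2.2.eq_or_lt with rfl | hlt
    · simp; positivity
    refine (hgap c hcm.1 s hsb.le hlt fun z hz hzS => ?_).trans ?_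
    · exact absurd (hcmax ⟨hzS, hcm.2.1.trans hz.1.le, hz.2.le⟩) (not_le.2 hz.1)
    · have : (s - c)^2 ≤ (s - t1)^2 := pow_le_pow_left₀ (by linarith) (by linarith [hcm.2.1]) 2
      gcongr
  have := sq_tri (slice_x hu ks) (slice_x hu k0) (slice_x hu kc)
  nlinarith

theorem all_good {D : Dat} (h : Sol D) : ∀ t ∈ Ioo 0 D.T, RGood D.ρ t ∧ RGood D.θ t := by
  by_contra hcon
  push Not at hcon
  obtain ⟨t0, ht0, hbad⟩ := hcon
  set B : Set ℝ := {t | t ∈ Ioo 0 D.T ∧ ¬ (RGood D.ρ t ∧ RGood D.θ t)} with hB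
  have ht0B : t0 ∈ B := ⟨ht0, fun hh => hbad hh.1 hh.2⟩
  obtain ⟨a0, ha0, ha0'⟩ := exists_between ht0.1
  obtain ⟨b0, hb0, hb0'⟩ := exists_between ht0.2
  set E := closure (B ∩ Ioo a0 b0) with hE
  have hEs : E ⊆ Icc a0 b0 := closure_minimal (fun s hs => Ioo_subset_Icc_self hs.2) isClosed_Icc
  have hET : Icc a0 b0 ⊆ Ioo 0 D.T := fun s hs => ⟨ha0.trans_le hs.1, hs.2.trans_lt hb0'⟩
  let F : ℕ → Set ℝ := fun n => {t | t ∈ Icc 0 D.T ∧ KU D.ρ D.T n t} ∩ {t | t ∈ Icc 0 D.T ∧ KU D.θ D.T n t}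
  obtain ⟨n, p, hp, r, hr, hK⟩ := baire_closed E isClosed_closure
    ⟨t0, subset_closure ⟨ht0B, ha0', hb0⟩⟩ F
    (fun n => isClosed_closure.inter ((KU_closed h.cρ).inter (KU_closed h.cθ)))
    (fun t ht => by
      have htT := hET (hEs ht)
      have hc : ∀ i : ℝ, i = 0 ∨ i = 1 → i ∈ Icc (0:ℝ) 1 := by rintro i (rfl | rfl) <;> simp
      obtain ⟨n1, h1⟩ := KU_cover h.cρ htT (h.C2ρ t htT) (fun i hi => (h.tρ i (hc i hi) t htT).differentiableAt)
      obtain ⟨n2, h2⟩ := KU_cover h.cθ htT (h.C2θ t htT) (fun i hi => (h.tθ i (hc i hi) t htT).differentiableAt)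
      have htI := Ioo_subset_Icc_self htT
      exact mem_iUnion.2 ⟨max n1 n2, ⟨htI, h1.mono (by simp)⟩, ⟨htI, h2.mono (by simp)⟩⟩)
  have hBdd : ∀ t ∈ E, t ∈ F n → Bdd D n t := by
    intro t ht hF
    have htT := hET (hEs ht)
    have b1 := KU_bd (Nat.cast_nonneg n) (h.C2ρ t htT) hF.1.2
    have b2 := KU_bd (Nat.cast_nonneg n) (h.C2θ t htT) hF.2.2
    exact ⟨fun x hx => ⟨(b1 x hx).1, (b2 x hx).1, (b1 x hx).2, (b2 x hx).2⟩,
      fun i hi s hs => ⟨hF.1.2.l3 i hi s hs, hF.2.2.l3 i hi s hs⟩⟩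
  obtain ⟨τ0, hτ0, C, hC, hgap⟩ := gap h n
  obtain ⟨N', hN', hbt⟩ := Bdd_t h n
  obtain ⟨t1, ht1, hd1⟩ := Metric.mem_closure_iff.1 hp r hr
  rw [dist_comm] at hd1
  have hopen : Ioo a0 b0 ∩ Metric.ball p r ∈ 𝓝 t1 :=
    (isOpen_Ioo.inter Metric.isOpen_ball).mem_nhds ⟨ht1.2, hd1⟩
  obtain ⟨ε, hε, hball⟩ := Metric.mem_nhds_iff.1 hopen
  set e := min (ε / 2) (τ0 / 2) with he
  have he0 : 0 < e := by positivity
  have he1 : e < ε := (min_le_left _ _).trans_lt (by linarith)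
  have he2 : e ≤ τ0 / 2 := min_le_right _ _
  have hab : ∀ s ∈ Icc (t1 - e) (t1 + e), s ∈ Ioo a0 b0 ∩ Metric.ball p r := by
    intro s hs
    apply hball
    rw [Metric.mem_ball, Real.dist_eq, abs_lt]
    constructor <;> linarith [hs.1, hs.2]
  set S := E ∩ Icc (t1 - e) (t1 + e) with hS
  have hSc : IsCompact S := isCompact_Icc.inter_left isClosed_closure
  have hST : S ⊆ Ioo 0 D.T := fun s hs => hET (hEs hs.1)
  have hSB : ∀ s ∈ S, Bdd D n s := fun s hs => hBdd s hs.1 (hK s hs.1 (hab s hs.2).2)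
  have ht1S : t1 ∈ S := ⟨subset_closure ht1, by constructor <;> linarith⟩
  have hnS : ∀ s ∈ Icc (t1 - e) (t1 + e), s ∉ S → RGood D.ρ s ∧ RGood D.θ s := by
    intro s hs hsS
    by_contra hcon
    have h1 := (hab s hs).1
    exact hsS ⟨subset_closure ⟨⟨hET (Ioo_subset_Icc_self h1), hcon⟩, h1⟩, hs⟩
  have hbT : t1 + e < D.T := (hET (Ioo_subset_Icc_self (hab (t1 + e) (by constructor <;> linarith)).1)).2
  have hG : ∀ c ∈ S, ∀ d, d ≤ t1 + e → c < d → (∀ s ∈ Ioo c d, s ∉ S) →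
      (∫ x in Icc 0 1, (D.ρ x d - D.ρ x c)^2) ≤ C * (d - c)^2 ∧
      (∫ x in Icc 0 1, (D.θ x d - D.θ x c)^2) ≤ C * (d - c)^2 := by
    intro c hc d hd hcd hs
    have hcT := hST hc
    refine hgap c hcT d ⟨hcT.1.trans hcd, hd.trans_lt hbT⟩ hcd (by linarith [hc.2.1]) (hSB c hc) ?_
    intro s hsI
    exact hnS s ⟨hc.2.1.trans hsI.1.le, hsI.2.le.trans hd⟩ (hs s hsI)
  refine ht1.1.2 ⟨?_, ?_⟩
  · exact rgood_of h.cρ hSc hST (fun x hx t ht => h.tρ x hx t (hST ht)) C N' hC hN'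
      (fun t ht x hx => (hbt t (hST ht) (hSB t ht) x hx).1) hbT (fun s hs => hs.2.2)
      (fun c hc d hd hcd hs => (hG c hc d hd hcd hs).1) ht1S (by linarith)
  · exact rgood_of h.cθ hSc hST (fun x hx t ht => h.tθ x hx t (hST ht)) C N' hC hN'
      (fun t ht x hx => (hbt t (hST ht) (hSB t ht) x hx).2) hbT (fun s hs => hs.2.2)
      (fun c hc d hd hcd hs => (hG c hc d hd hcd hs).2) ht1S (by linarith)

theorem int_of_min {μ : Measure ℝ} [IsFiniteMeasure μ] {W : ℝ → ℝ} (hW : AEStronglyMeasurable W μ)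
    (h0 : ∀ t, 0 ≤ W t) (B : ℝ) (hB : ∀ n : ℕ, ∫ t, min (W t) n ∂μ ≤ B) : Integrable W μ := by
  refine ⟨hW, ?_⟩
  rw [hasFiniteIntegral_iff_ofReal (Eventually.of_forall h0)]
  have hm : ∀ n : ℕ, AEStronglyMeasurable (fun t => min (W t) n) μ := fun n =>
    (hW.aemeasurable.min aemeasurable_const).aestronglyMeasurable
  have hi : ∀ n : ℕ, Integrable (fun t => min (W t) n) μ := by
    intro n
    refine Integrable.of_bound (hm n) n (Eventually.of_forall fun t => ?_)
    rw [Real.norm_of_nonneg (le_min (h0 t) (Nat.cast_nonneg n))]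
    exact min_le_right _ _
  have hF := lintegral_liminf_le' (μ := μ) (u := atTop) (f := fun (n : ℕ) t => ENNReal.ofReal (min (W t) n))
    (fun n => (hm n).aemeasurable.ennreal_ofReal)
  have e1 : ∀ t, liminf (fun n : ℕ => ENNReal.ofReal (min (W t) n)) atTop = ENNReal.ofReal (W t) := by
    intro t
    refine Tendsto.liminf_eq (tendsto_const_nhds.congr' ?_)
    obtain ⟨n, hn⟩ := exists_nat_ge (W t)
    filter_upwards [eventually_ge_atTop n] with k hk
    rw [min_eq_left (hn.trans (by exact_mod_cast hk))]
  simp only [e1] at hF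
  refine lt_of_le_of_lt (hF.trans ?_) (ENNReal.ofReal_lt_top (r := B))
  refine liminf_le_of_frequently_le' (Frequently.of_forall fun n => ?_)
  rw [← ofReal_integral_eq_lintegral_ofReal (hi n)
    (Eventually.of_forall fun t => le_min (h0 t) (Nat.cast_nonneg n))]
  exact ENNReal.ofReal_le_ofReal (hB n)

/-- clamp to an interval -/
noncomputable def clampI (b x : ℝ) : ℝ := max 0 (min x b)

theorem clampI_eq {b x : ℝ} (hx : x ∈ Icc 0 b) : clampI b x = x := by
  simp [clampI, hx.1, hx.2]

theorem clampI_mem {b x : ℝ} (hb : 0 ≤ b) : clampI b x ∈ Icc 0 b := by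
  simp [clampI, hb]

theorem clampI_cont {b : ℝ} : Continuous (clampI b) := by
  unfold clampI; fun_prop

theorem ext_cont {u : ℝ → ℝ → ℝ} {T : ℝ} (hT : 0 < T)
    (hu : ContinuousOn (fun p : ℝ × ℝ => u p.1 p.2) (Icc 0 1 ×ˢ Icc 0 T)) :
    Continuous (fun p : ℝ × ℝ => u (clampI 1 p.2) (clampI T p.1)) := by
  refine hu.comp_continuous (f := fun p : ℝ × ℝ => (clampI 1 p.2, clampI T p.1)) ?_ ?_
  · exact (clampI_cont.comp continuous_snd).prodMk (clampI_cont.comp continuous_fst)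
  · exact fun p => ⟨clampI_mem zero_le_one, clampI_mem hT.le⟩

theorem meas_W {u u1 v : ℝ → ℝ → ℝ} {T : ℝ} (hT : 0 < T)
    (hu : ContinuousOn (fun p : ℝ × ℝ => u p.1 p.2) (Icc 0 1 ×ˢ Icc 0 T))
    (hv : ContinuousOn (fun p : ℝ × ℝ => v p.1 p.2) (Icc 0 1 ×ˢ Icc 0 T))
    (hd : ∀ t ∈ Ioo 0 T, ∀ x ∈ Ioo (0:ℝ) 1, HasDerivAt (fun x => u x t) (u1 x t) x) :
    AEStronglyMeasurable (fun t => ∫ x in Icc 0 1, v x t * u1 x t^2) (volume.restrict (Icc 0 T)) := by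
  have hU := ext_cont hT hu
  have hV := ext_cont hT hv
  have hm := measurable_deriv_with_param (f := fun t x => u (clampI 1 x) (clampI T t)) hU
  have hJ : StronglyMeasurable (fun p : ℝ × ℝ => v (clampI 1 p.2) (clampI T p.1) *
      (deriv (fun x => u (clampI 1 x) (clampI T p.1)) p.2)^2) :=
    (hV.measurable.mul (hm.pow_const 2)).stronglyMeasurable
  have hI := hJ.integral_prod_right' (ν := volume.restrict (Icc (0:ℝ) 1))
  refine ⟨_, hI, ?_⟩
  rw [← restrict_Ioo_eq_restrict_Icc]
  filter_upwards [ae_restrict_mem measurableSet_Ioo] with t ht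
  refine integral_congr_ae ?_
  filter_upwards [ae_Ioo01] with x hx
  rw [clampI_eq (Ioo_subset_Icc_self hx), clampI_eq (Ioo_subset_Icc_self ht)]
  congr 2
  have : (fun x => u (clampI 1 x) t) =ᶠ[𝓝 x] fun x => u x t := by
    filter_upwards [Ioo_mem_nhds hx.1 hx.2] with y hy
    rw [clampI_eq (Ioo_subset_Icc_self hy)]
  rw [this.deriv_eq, (hd t ht x hx).deriv]

theorem poly_ref {f : ℝ → ℝ} (hf : ContinuousOn f (Icc 0 1)) {ε : ℝ} (hε : 0 < ε) :
    ∃ g g1 g2, C2 g g1 g2 ∧ (∀ x ∈ Icc (0:ℝ) 1, |g x - f x| ≤ ε) ∧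
      ∃ N, ∀ x ∈ Icc (0:ℝ) 1, |g1 x| ≤ N ∧ |g2 x| ≤ N := by
  obtain ⟨p, hp⟩ := exists_polynomial_near_of_continuousOn 0 1 f hf ε hε
  have h1 := (Polynomial.derivative p).continuous.continuousOn (s := Icc (0:ℝ) 1)
  have h2 := (Polynomial.derivative (Polynomial.derivative p)).continuous.continuousOn (s := Icc (0:ℝ) 1)
  obtain ⟨B1, hB1⟩ := isCompact_Icc.exists_bound_of_continuousOn h1
  obtain ⟨B2, hB2⟩ := isCompact_Icc.exists_bound_of_continuousOn h2
  refine ⟨fun x => p.eval x, fun x => p.derivative.eval x, fun x => p.derivative.derivative.eval x,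
    ⟨p.continuous.continuousOn, h1, h2, fun x _ => p.hasDerivAt x, fun x _ => p.derivative.hasDerivAt x⟩,
    fun x hx => (hp x hx).le, max B1 B2, fun x hx => ⟨(hB1 x hx).trans (by simp), (hB2 x hx).trans (by simp)⟩⟩

/-- gradient energy -/
noncomputable def Wf (D : Dat) (t : ℝ) : ℝ := ∫ x in Icc 0 1, (D.ρ1 x t^2 + D.θ1 x t^2)

theorem Wf_meas {D : Dat} (h : Sol D) : AEStronglyMeasurable (Wf D) (volume.restrict (Icc 0 D.T)) := by
  have m1 := meas_W (v := fun _ _ => 1) h.hT h.cρ continuousOn_const (fun t ht => (h.C2ρ t ht).d1)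
  have m2 := meas_W (v := fun _ _ => 1) h.hT h.cθ continuousOn_const (fun t ht => (h.C2θ t ht).d1)
  refine (m1.add m2).congr ?_
  rw [← restrict_Ioo_eq_restrict_Icc]
  filter_upwards [ae_restrict_mem measurableSet_Ioo] with t ht
  have c1 := (h.C2ρ t ht).c1
  have c2 := (h.C2θ t ht).c1
  have k1 : ContinuousOn (fun x => D.ρ1 x t^2) (Icc 0 1) := by fun_prop
  have k2 : ContinuousOn (fun x => D.θ1 x t^2) (Icc 0 1) := by fun_prop
  simp only [Pi.add_apply, one_mul, Wf]
  rw [integral_add (k1.integrableOn_compact isCompact_Icc) (k2.integrableOn_compact isCompact_Icc)]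

theorem Wf_le {D : Dat} (h : Sol D) {t : ℝ} (ht : t ∈ Ioo 0 D.T) {r1 q1 : ℝ → ℝ} {N : ℝ}
    (hr : ContinuousOn r1 (Icc 0 1)) (hq : ContinuousOn q1 (Icc 0 1))
    (hb : ∀ x ∈ Icc (0:ℝ) 1, |r1 x| ≤ N ∧ |q1 x| ≤ N) : Wf D t ≤ 2 * Df D r1 q1 t + 4 * N^2 := by
  have c1 := (h.C2ρ t ht).c1
  have c2 := (h.C2θ t ht).c1
  have k1 : ContinuousOn (fun x => D.ρ1 x t^2 + D.θ1 x t^2) (Icc 0 1) := by fun_prop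
  have k2 : ContinuousOn (fun x => (D.ρ1 x t - r1 x)^2 + (D.θ1 x t - q1 x)^2) (Icc 0 1) := by fun_prop
  have i1 := k1.integrableOn_compact (μ := volume) isCompact_Icc
  have i2 := k2.integrableOn_compact (μ := volume) isCompact_Icc
  have i3 : IntegrableOn (fun _ : ℝ => 4 * N^2) (Icc 0 1) := integrableOn_const (by simp)
  have : Wf D t ≤ ∫ x in Icc 0 1, (2 * ((D.ρ1 x t - r1 x)^2 + (D.θ1 x t - q1 x)^2) + 4 * N^2) := by
    refine setIntegral_mono_on i1 ((i2.const_mul 2).add i3) measurableSet_Icc fun x hx => ?_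
    obtain ⟨h1, h2⟩ := hb x hx
    have h3 : (r1 x)^2 ≤ N^2 := by rw [← sq_abs]; exact pow_le_pow_left₀ (abs_nonneg _) h1 2
    have h4 : (q1 x)^2 ≤ N^2 := by rw [← sq_abs]; exact pow_le_pow_left₀ (abs_nonneg _) h2 2
    nlinarith [sq_nonneg (D.ρ1 x t - r1 x - r1 x), sq_nonneg (D.θ1 x t - q1 x - q1 x)]
  rw [integral_add (i2.const_mul 2) i3, integral_const_mul] at this
  simpa [Df] using this

theorem W_loc {D : Dat} (h : Sol D) {t0 : ℝ} (ht0 : t0 ∈ Icc 0 D.T) :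
    IntegrableAtFilter (Wf D) (𝓝[Icc 0 D.T] t0) := by
  obtain ⟨K, hK, δ, hδ, hδ1, c0, hc0, hE⟩ := energy_time h
  obtain ⟨f, f1, f2, hf, hfa, Nf, hNf⟩ := poly_ref (slice_x h.cρ ht0) (show 0 < δ / 8 by positivity)
  obtain ⟨g, g1, g2, hg, hga, Ng, hNg⟩ := poly_ref (slice_x h.cθ ht0) (show 0 < δ / 8 by positivity)
  set N := max Nf Ng + 2 * (δ / 4) with hN
  have hN1 : Nf + 2 * (δ / 4) ≤ N := by rw [hN]; gcongr; exact le_max_left _ _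
  have hN2 : Ng + 2 * (δ / 4) ≤ N := by rw [hN]; gcongr; exact le_max_right _ _
  obtain ⟨C, hC, hE⟩ := hE N
  obtain ⟨e1, he1, hu1⟩ := unif_t h.cρ (show 0 < δ / 8 by positivity)
  obtain ⟨e2, he2, hu2⟩ := unif_t h.cθ (show 0 < δ / 8 by positivity)
  set e := min (e1 / 2) (e2 / 2) with he
  have he0 : 0 < e := by positivity
  have hee1 : e < e1 := (min_le_left _ _).trans_lt (by linarith)
  have hee2 : e < e2 := (min_le_right _ _).trans_lt (by linarith)
  set a := max 0 (t0 - e) with ha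
  set b := min D.T (t0 + e) with hb
  have hat : a ≤ t0 := max_le ht0.1 (by linarith)
  have hbt : t0 ≤ b := le_min ht0.2 (by linarith)
  have hab : a ≤ b := hat.trans hbt
  have hsub : Icc a b ⊆ Icc 0 D.T := Icc_subset_Icc (le_max_left _ _) (min_le_left _ _)
  have hdist : ∀ s ∈ Icc a b, |s - t0| ≤ e := by
    intro s hs
    have h1 := (le_max_right 0 (t0 - e)).trans hs.1
    have h2 := hs.2.trans (min_le_right D.T (t0 + e))
    rw [abs_le]; constructor <;> linarith
  have hcl1 : ∀ s ∈ Icc a b, ∀ x ∈ Icc (0:ℝ) 1, |D.ρ x s - f x| ≤ δ / 4 := by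
    intro s hs x hx
    have b1 := hu1 x hx s (hsub hs) t0 ht0 ((hdist s hs).trans_lt hee1)
    have b2 := hfa x hx
    rw [abs_lt] at b1; rw [abs_le] at b2 ⊢
    constructor <;> linarith [b1.1, b1.2, b2.1, b2.2]
  have hcl2 : ∀ s ∈ Icc a b, ∀ x ∈ Icc (0:ℝ) 1, |D.θ x s - g x| ≤ δ / 4 := by
    intro s hs x hx
    have b1 := hu2 x hx s (hsub hs) t0 ht0 ((hdist s hs).trans_lt hee2)
    have b2 := hga x hx
    rw [abs_lt] at b1; rw [abs_le] at b2 ⊢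
    constructor <;> linarith [b1.1, b1.2, b2.1, b2.2]
  have hc : ∀ i : ℝ, i = 0 ∨ i = 1 → i ∈ Icc (0:ℝ) 1 := by rintro i (rfl | rfl) <;> simp
  obtain ⟨r, r1, hr, hrb, hrd⟩ := ref_dir (u := D.ρ) (rb := D.rb) (I := Icc a b) hf (show 0 ≤ δ / 4 by positivity)
    (fun i hi s hs => hcl1 s hs i (hc i hi))
  obtain ⟨q, q1, hq, hqb, hqd⟩ := ref_dir (u := D.θ) (rb := D.qb) (I := Icc a b) hg (show 0 ≤ δ / 4 by positivity)
    (fun i hi s hs => hcl2 s hs i (hc i hi))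
  have hd1 : ∀ s ∈ Icc a b, ∀ x ∈ Icc (0:ℝ) 1, |D.ρ x s - r x| ≤ δ := by
    intro s hs x hx
    have b1 := hcl1 s hs x hx
    have b2 := (hrb x hx).1
    rw [abs_le] at b1 b2 ⊢
    constructor <;> linarith [b1.1, b1.2, b2.1, b2.2]
  have hd2 : ∀ s ∈ Icc a b, ∀ x ∈ Icc (0:ℝ) 1, |D.θ x s - q x| ≤ δ := by
    intro s hs x hx
    have b1 := hcl2 s hs x hx
    have b2 := (hqb x hx).1
    rw [abs_le] at b1 b2 ⊢
    constructor <;> linarith [b1.1, b1.2, b2.1, b2.2]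
  have hbd : ∀ x ∈ Icc (0:ℝ) 1, |r1 x| ≤ N ∧ |q1 x| ≤ N ∧ |f2 x| ≤ N ∧ |g2 x| ≤ N := by
    intro x hx
    exact ⟨by linarith [(hrb x hx).2, (hNf x hx).1], by linarith [(hqb x hx).2, (hNg x hx).1],
      by linarith [(hNf x hx).2], by linarith [(hNg x hx).2]⟩
  set Y := Yf D K r q with hY
  have hder : ∀ s ∈ Ioo a b, ∃ y', HasDerivWithinAt Y y' (Ioi s) s ∧
      c0 / 2 * Wf D s ≤ (c0 * 2 * N^2 + C * (6 * δ)) - y' := by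
    intro s hs
    have hsI := Ioo_subset_Icc_self hs
    have hsT : s ∈ Ioo 0 D.T := ⟨(le_max_left _ _).trans_lt hs.1, hs.2.trans_le (min_le_left _ _)⟩
    obtain ⟨g1, g2⟩ := all_good h s hsT
    obtain ⟨y', hy, hle⟩ := hE r q r1 q1 _ _ hr hq hbd s hsT g1 g2
      (fun x hx => ⟨hd1 s hsI x hx, hd2 s hsI x hx⟩) (fun i hi he => hrd i hi s hsI he)
      (fun i hi he => hqd i hi s hsI he)
    refine ⟨y', hy, ?_⟩
    have w := Wf_le h hsT hr.c1 hq.c1 (N := N) (fun x hx => ⟨(hbd x hx).1, (hbd x hx).2.1⟩)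
    have k1 := slice_x h.cρ (Ioo_subset_Icc_self hsT)
    have k2 := slice_x h.cθ (Ioo_subset_Icc_self hsT)
    have k3 := hr.c0
    have k4 := hq.c0
    have i1 : ∫ x in Icc 0 1, (|D.ρ x s - r x| + |D.θ x s - q x|) ≤ 2 * δ := by
      refine int_le_one (by fun_prop) fun x hx => ?_
      linarith [hd1 s hsI x hx, hd2 s hsI x hx]
    have i2 := hd1 s hsI 0 (by simp)
    have i3 := hd1 s hsI 1 (by simp)
    have i4 := hd2 s hsI 0 (by simp)
    have i5 := hd2 s hsI 1 (by simp)
    have i6 : C * ((∫ x in Icc 0 1, (|D.ρ x s - r x| + |D.θ x s - q x|)) +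
          (|D.ρ 0 s - r 0| + |D.ρ 1 s - r 1| + |D.θ 0 s - q 0| + |D.θ 1 s - q 1|)) ≤ C * (6 * δ) := by
      apply mul_le_mul_of_nonneg_left _ hC
      linarith
    have i7 : c0 / 2 * Wf D s ≤ c0 / 2 * (2 * Df D r1 q1 s + 4 * N^2) := by gcongr
    linarith
  choose! Y' hY' hY'le using hder
  set C' := c0 * 2 * N^2 + C * (6 * δ) with hC'
  have hYc : ContinuousOn Y (Icc a b) := (Yf_cont h hr.c0 hq.c0).mono hsub
  have hWm : AEStronglyMeasurable (Wf D) (volume.restrict (Icc a b)) := (Wf_meas h).mono_set hsub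
  have hW0 : ∀ t, 0 ≤ Wf D t := fun t => integral_nonneg fun x => by positivity
  refine ⟨Icc a b, ?_, ?_⟩
  · rw [mem_nhdsWithin]
    refine ⟨Ioo (t0 - e) (t0 + e), isOpen_Ioo, ⟨by linarith, by linarith⟩, ?_⟩
    rintro s ⟨h1, h2⟩
    exact ⟨max_le h2.1 h1.1.le, le_min h2.2 h1.2.le⟩
  · refine int_of_min hWm hW0 (2 / c0 * ((C' * b - Y b) - (C' * a - Y a))) fun n => ?_
    have hφ : IntegrableOn (fun t => c0 / 2 * min (Wf D t) n) (Icc a b) := by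
      refine Integrable.const_mul ?_ _
      refine Integrable.of_bound (hWm.aemeasurable.min aemeasurable_const).aestronglyMeasurable n
        (Eventually.of_forall fun t => ?_)
      rw [Real.norm_of_nonneg (le_min (hW0 t) (Nat.cast_nonneg n))]
      exact min_le_right _ _
    have := intervalIntegral.integral_le_sub_of_hasDeriv_right_of_le (g := fun t => C' * t - Y t)
      (g' := fun t => C' - Y' t) (φ := fun t => c0 / 2 * min (Wf D t) n) hab
      (by fun_prop)
      (fun s hs => by
        have := ((hasDerivWithinAt_id s (Ioi s)).const_mul C').sub (hY' s hs)
        refine this.congr_deriv (by simp)) hφ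
      (fun s hs => by
        have h1 : c0 / 2 * min (Wf D s) n ≤ c0 / 2 * Wf D s := by gcongr; exact min_le_left _ _
        exact h1.trans (hY'le s hs))
    rw [intervalIntegral.integral_of_le hab, ← integral_Icc_eq_integral_Ioc, integral_const_mul] at this
    rw [div_mul_eq_mul_div, le_div_iff₀ hc0]
    linarith

theorem W_int {D : Dat} (h : Sol D) : IntegrableOn (Wf D) (Icc 0 D.T) :=
  LocallyIntegrableOn.integrableOn_isCompact (fun _ ht => W_loc h ht) isCompact_Icc

theorem neg_mul_log_le {v : ℝ} (hv : 0 < v) : -(v * Real.log v) ≤ 1 := by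
  have h := Real.one_sub_inv_le_log_of_pos hv
  have h2 := mul_le_mul_of_nonneg_left h hv.le
  rw [mul_sub, mul_inv_cancel₀ hv.ne'] at h2
  linarith

theorem sup_bd {f f1 f2 : ℝ → ℝ} (h : C2 f f1 f2) {x : ℝ} (hx : x ∈ Icc (0:ℝ) 1) :
    f x ≤ (∫ y in Icc 0 1, f y) + ∫ y in Icc 0 1, |f1 y| := by
  have c1 := h.c1
  have c0 := h.c0
  have ca : ContinuousOn (fun y => |f1 y|) (Icc 0 1) := by fun_prop
  have ia := ca.integrableOn_compact (μ := volume) isCompact_Icc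
  have i0 := c0.integrableOn_compact (μ := volume) isCompact_Icc
  have key : ∀ a ∈ Icc (0:ℝ) 1, ∀ b ∈ Icc (0:ℝ) 1, a ≤ b → |f b - f a| ≤ ∫ y in Icc 0 1, |f1 y| := by
    intro a ha b hb hab
    have hs : Icc a b ⊆ Icc 0 1 := Icc_subset_Icc ha.1 hb.2
    have e := intervalIntegral.integral_eq_sub_of_hasDerivAt_of_le hab (c0.mono hs)
      (fun z hz => h.d1 z ⟨ha.1.trans_lt hz.1, hz.2.trans_le hb.2⟩)
      ((c1.mono hs).intervalIntegrable_of_Icc hab)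
    rw [← e]
    refine (intervalIntegral.abs_integral_le_integral_abs hab).trans ?_
    rw [intervalIntegral.integral_of_le hab]
    exact setIntegral_mono_set ia (Eventually.of_forall fun z => abs_nonneg _)
      (Eventually.of_forall (Ioc_subset_Icc_self.trans hs))
  have key2 : ∀ y ∈ Icc (0:ℝ) 1, f x ≤ f y + ∫ y in Icc 0 1, |f1 y| := by
    intro y hy
    rcases le_total x y with hxy | hxy
    · have := abs_le.1 (key x hx y hy hxy); linarith [this.1]
    · have := abs_le.1 (key y hy x hx hxy); linarith [this.2]
  have i1 : IntegrableOn (fun _ : ℝ => ∫ y in Icc 0 1, |f1 y|) (Icc 0 1) := integrableOn_const (by simp)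
  have i2 : IntegrableOn (fun _ : ℝ => f x) (Icc 0 1) := integrableOn_const (by simp)
  have := setIntegral_mono_on i2 (i0.add i1) measurableSet_Icc key2
  simp only [Pi.add_apply] at this
  rw [integral_add i0 i1] at this
  simpa using this

theorem entropy_alg (m M k : ℝ) (hm : 0 < m) (r r1 q q1 : ℝ) (hr : 0 < r) (hq : m ≤ q) (hqM : q ≤ M) :
    -((r1 - k * r) * (r1 * q + r * q1)) ≤
      -(3/4) * (q * r1^2) + (2 / m + 1/2) * (r^2 * q1^2) + (2 * k^2 * M + k^2 / 2) * r^2 := by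
  have hq0 : 0 < q := hm.trans_le hq
  have e1 : -(r * r1 * q1) ≤ q / 8 * r1^2 + 2 / m * (r^2 * q1^2) := by
    have h1 : 2 / q * (r^2 * q1^2) ≤ 2 / m * (r^2 * q1^2) := by gcongr
    have h2 : q / 8 * r1^2 + 2 / q * (r^2 * q1^2) + r * r1 * q1 = (q * r1 + 4 * (r * q1))^2 / (8 * q) := by
      field_simp; ring
    have h3 : 0 ≤ (q * r1 + 4 * (r * q1))^2 / (8 * q) := by positivity
    linarith
  have e2 : k * r * r1 * q ≤ q / 8 * r1^2 + 2 * k^2 * M * r^2 := by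
    have h1 : 2 * k^2 * q * r^2 ≤ 2 * k^2 * M * r^2 := by gcongr
    nlinarith [mul_nonneg hq0.le (sq_nonneg (r1 - 4 * (k * r)))]
  have e3 : k * r^2 * q1 ≤ 1/2 * k^2 * r^2 + 1/2 * (r^2 * q1^2) := by
    nlinarith [mul_nonneg (sq_nonneg r) (sq_nonneg (k - q1))]
  linarith

theorem source_alg (M ps pM Φ l r q : ℝ) (hr : 0 < r) (hqM : q ≤ M)
    (hps : 0 ≤ ps) (hpM : ps ≤ pM) (hl : |l| ≤ Φ) :
    -((Real.log r - l) * (r * Real.sqrt q - ps)) ≤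
      Real.sqrt M + (Φ * Real.sqrt M + pM) * r + Φ * pM := by
  have hs : Real.sqrt q ≤ Real.sqrt M := Real.sqrt_le_sqrt hqM
  have hs0 := Real.sqrt_nonneg q
  have hΦ : 0 ≤ Φ := (abs_nonneg _).trans hl
  have e1 : -(r * Real.log r) * Real.sqrt q ≤ Real.sqrt M :=
    (mul_le_mul_of_nonneg_right (neg_mul_log_le hr) hs0).trans (by linarith)
  have hl' := abs_le.1 hl
  have e2 : l * (r * Real.sqrt q) ≤ Φ * Real.sqrt M * r := by
    calc l * (r * Real.sqrt q) ≤ Φ * (r * Real.sqrt q) := by gcongr; exact hl'.2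
      _ ≤ Φ * (r * Real.sqrt M) := by gcongr
      _ = _ := by ring
  have e3 : Real.log r * ps ≤ pM * r := by
    have := Real.log_le_self hr.le
    calc Real.log r * ps ≤ r * ps := by gcongr
      _ ≤ r * pM := by gcongr
      _ = _ := by ring
  have e4 : -l * ps ≤ Φ * pM := by
    calc -l * ps ≤ Φ * ps := by gcongr; linarith [hl'.1]
      _ ≤ _ := by gcongr
  nlinarith

theorem entropy_slice {m M M₁ k L Φ pM : ℝ} (hm : 0 < m) (hmM : m ≤ M) (hM₁ : 0 ≤ M₁) (hpM : 0 ≤ pM)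
    {r r1 r2 q q1 q2 rt ps : ℝ → ℝ} (hr : C2 r r1 r2) (hq : C2 q q1 q2)
    (hpsc : ContinuousOn ps (Icc 0 1))
    (hpos : ∀ x ∈ Icc (0:ℝ) 1, 0 < r x) (hqm : ∀ x ∈ Icc (0:ℝ) 1, m ≤ q x ∧ q x ≤ M)
    (hps : ∀ x ∈ Icc (0:ℝ) 1, 0 ≤ ps x ∧ ps x ≤ pM) (hl : ∀ x ∈ Icc (0:ℝ) 1, |L + k * x| ≤ Φ)
    (hrt : ∀ x ∈ Ioo (0:ℝ) 1, rt x = r1 x * (r1 x * q x + r x * q1 x) +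
        r x * (r2 x * q x + 2 * r1 x * q1 x + r x * q2 x) - (r x * Real.sqrt (q x) - ps x))
    (hmass : ∫ x in Icc 0 1, r x ≤ M₁)
    (hb1 : (Real.log (r 1) - (L + k)) * (r 1 * (r1 1 * q 1 + r 1 * q1 1)) ≤ 0)
    (hb0 : 0 ≤ (Real.log (r 0) - L) * (r 0 * (r1 0 * q 0 + r 0 * q1 0))) :
    ∫ x in Icc 0 1, (Real.log (r x) - (L + k * x)) * rt x ≤
      -(1/2) * (∫ x in Icc 0 1, q x * r1 x^2) + (2 / m + 1/2) * (∫ x in Icc 0 1, r x^2 * q1 x^2) +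
      ((2 * k^2 * M + k^2 / 2) * M₁^2 + ((2 * k^2 * M + k^2 / 2) * M₁)^2 / m + Real.sqrt M +
        (Φ * Real.sqrt M + pM) * M₁ + Φ * pM) := by
  set A2 := 2 * k^2 * M + k^2 / 2 with hA2
  have hM : 0 < M := hm.trans_le hmM
  have hA20 : 0 ≤ A2 := by positivity
  have a0 := hr.c0
  have a1 := hr.c1
  have a2 := hr.c2
  have b0 := hq.c0
  have b1 := hq.c1
  have b2 := hq.c2
  have cl : ContinuousOn (fun x => Real.log (r x)) (Icc 0 1) := a0.log fun x hx => (hpos x hx).ne'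
  have csq : ContinuousOn (fun x => Real.sqrt (q x)) (Icc 0 1) := Real.continuous_sqrt.comp_continuousOn b0
  set F' := fun x => r1 x * (r1 x * q x + r x * q1 x) +
        r x * (r2 x * q x + 2 * r1 x * q1 x + r x * q2 x) with hF'
  set P := fun x => (Real.log (r x) - (L + k * x)) * (r x * (r1 x * q x + r x * q1 x)) with hP
  set P' := fun x => (r1 x - k * r x) * (r1 x * q x + r x * q1 x) + (Real.log (r x) - (L + k * x)) * F' x with hP'
  have cF' : ContinuousOn F' (Icc 0 1) := by fun_prop
  have cP : ContinuousOn P (Icc 0 1) := by fun_prop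
  have cP' : ContinuousOn P' (Icc 0 1) := by fun_prop
  have hPd : ∀ x ∈ Ioo (0:ℝ) 1, HasDerivAt P (P' x) x := by
    intro x hx
    have hrp := hpos x (Ioo_subset_Icc_self hx)
    have d1 := hr.d1 x hx
    have d2 := hr.d2 x hx
    have e1 := hq.d1 x hx
    have e2 := hq.d2 x hx
    have := ((d1.log hrp.ne').sub (((hasDerivAt_id x).const_mul k).const_add L)).mul
      (d1.mul ((d2.mul e1).add (d1.mul e2)))
    refine this.congr_deriv ?_
    simp only [hP', hF', id, mul_one, Pi.sub_apply, Pi.mul_apply, Pi.add_apply]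
    field_simp
    ring
  have hPint : ∫ x in Icc 0 1, P' x = P 1 - P 0 := by
    rw [integral_Icc_eq_integral_Ioc, ← intervalIntegral.integral_of_le zero_le_one]
    exact intervalIntegral.integral_eq_sub_of_hasDerivAt_of_le zero_le_one cP hPd
      (cP'.intervalIntegrable_of_Icc zero_le_one)
  have hP10 : P 1 - P 0 ≤ 0 := by
    simp only [hP, mul_one, mul_zero, add_zero]
    linarith
  have iP := cP'.integrableOn_compact (μ := volume) isCompact_Icc
  have c3 : ContinuousOn (fun x => q x * r1 x^2) (Icc 0 1) := by fun_prop
  have c4 : ContinuousOn (fun x => r x^2 * q1 x^2) (Icc 0 1) := by fun_prop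
  have c5 : ContinuousOn (fun x => r x^2) (Icc 0 1) := by fun_prop
  have c6 : ContinuousOn (fun x => |r1 x|) (Icc 0 1) := by fun_prop
  have i3 := c3.integrableOn_compact (μ := volume) isCompact_Icc
  have i4 := c4.integrableOn_compact (μ := volume) isCompact_Icc
  have i5 := c5.integrableOn_compact (μ := volume) isCompact_Icc
  have i6 := c6.integrableOn_compact (μ := volume) isCompact_Icc
  have i0 := a0.integrableOn_compact (μ := volume) isCompact_Icc
  -- pointwise bound
  have hcomb : ContinuousOn (fun x => P' x + -(3/4) * (q x * r1 x^2) + (2 / m + 1/2) * (r x^2 * q1 x^2) +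
      A2 * r x^2 + (Φ * Real.sqrt M + pM) * r x + (Real.sqrt M + Φ * pM)) (Icc 0 1) := by fun_prop
  have hEq : ∫ x in Icc 0 1, (Real.log (r x) - (L + k * x)) * rt x =
      ∫ x in Icc 0 1, (Real.log (r x) - (L + k * x)) * (F' x - (r x * Real.sqrt (q x) - ps x)) := by
    refine integral_congr_ae ?_
    filter_upwards [ae_Ioo01] with x hx
    rw [hrt x hx]
  have hcE : ContinuousOn (fun x => (Real.log (r x) - (L + k * x)) * (F' x - (r x * Real.sqrt (q x) - ps x)))
    (Icc 0 1) := by fun_prop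
  have hle : ∫ x in Icc 0 1, (Real.log (r x) - (L + k * x)) * rt x ≤
      ∫ x in Icc 0 1, (P' x + -(3/4) * (q x * r1 x^2) + (2 / m + 1/2) * (r x^2 * q1 x^2) +
      A2 * r x^2 + (Φ * Real.sqrt M + pM) * r x + (Real.sqrt M + Φ * pM)) := by
    rw [hEq]
    refine setIntegral_mono_on (hcE.integrableOn_compact isCompact_Icc)
      (hcomb.integrableOn_compact isCompact_Icc) measurableSet_Icc fun x hx => ?_
    have s1 := entropy_alg m M k hm (r x) (r1 x) (q x) (q1 x) (hpos x hx) (hqm x hx).1 (hqm x hx).2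
    have s2 := source_alg M (ps x) pM Φ (L + k * x) (r x) (q x) (hpos x hx) (hqm x hx).2 (hps x hx).1
      (hps x hx).2 (hl x hx)
    rw [← hA2] at s1
    simp only [hP']
    rw [mul_sub]
    linarith
  have j1 : IntegrableOn (fun x => P' x + -(3/4) * (q x * r1 x^2)) (Icc 0 1) := iP.add (i3.const_mul _)
  have j2 : IntegrableOn (fun x => P' x + -(3/4) * (q x * r1 x^2) + (2 / m + 1/2) * (r x^2 * q1 x^2)) (Icc 0 1) :=
    j1.add (i4.const_mul _)
  have j3 : IntegrableOn (fun x => P' x + -(3/4) * (q x * r1 x^2) + (2 / m + 1/2) * (r x^2 * q1 x^2) +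
      A2 * r x^2) (Icc 0 1) := j2.add (i5.const_mul _)
  have j4 : IntegrableOn (fun x => P' x + -(3/4) * (q x * r1 x^2) + (2 / m + 1/2) * (r x^2 * q1 x^2) +
      A2 * r x^2 + (Φ * Real.sqrt M + pM) * r x) (Icc 0 1) := j3.add (i0.const_mul _)
  have j5 : IntegrableOn (fun _ : ℝ => Real.sqrt M + Φ * pM) (Icc 0 1) := integrableOn_const (by simp)
  rw [integral_add j4 j5, integral_add j3 (i0.const_mul _), integral_add j2 (i5.const_mul _),
    integral_add j1 (i4.const_mul _), integral_add iP (i3.const_mul _), integral_const_mul,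
    integral_const_mul, integral_const_mul, integral_const_mul, hPint] at hle
  have hc1 : ∫ _x in Icc (0:ℝ) 1, (Real.sqrt M + Φ * pM) = Real.sqrt M + Φ * pM := by simp
  rw [hc1] at hle
  -- bound of the square
  set R := ∫ x in Icc 0 1, |r1 x| with hR
  have hR0 : 0 ≤ R := integral_nonneg fun x => abs_nonneg _
  have hmass0 : 0 ≤ ∫ x in Icc 0 1, r x := setIntegral_nonneg measurableSet_Icc fun x hx => (hpos x hx).le
  have hsq : ∫ x in Icc 0 1, r x^2 ≤ M₁^2 + M₁ * R := by
    have : ∫ x in Icc 0 1, r x^2 ≤ ∫ x in Icc 0 1, (M₁ + R) * r x := by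
      refine setIntegral_mono_on i5 (i0.const_mul _) measurableSet_Icc fun x hx => ?_
      have := sup_bd hr hx
      rw [sq]
      exact mul_le_mul_of_nonneg_right (by linarith) (hpos x hx).le
    rw [integral_const_mul] at this
    have h2 : (M₁ + R) * ∫ x in Icc 0 1, r x ≤ (M₁ + R) * M₁ := by gcongr
    linarith
  have hRb : A2 * M₁ * R ≤ 1/4 * (∫ x in Icc 0 1, q x * r1 x^2) + (A2 * M₁)^2 / m := by
    have j7 : IntegrableOn (fun _ : ℝ => (A2 * M₁)^2 / m) (Icc 0 1) := integrableOn_const (by simp)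
    have : ∫ x in Icc 0 1, A2 * M₁ * |r1 x| ≤ ∫ x in Icc 0 1, (1/4 * (q x * r1 x^2) + (A2 * M₁)^2 / m) := by
      refine setIntegral_mono_on (i6.const_mul _) ((i3.const_mul _).add j7) measurableSet_Icc fun x hx => ?_
      have h1 : m * r1 x^2 ≤ q x * r1 x^2 := by gcongr; exact (hqm x hx).1
      have h2 : 1/4 * (m * r1 x^2) + (A2 * M₁)^2 / m - A2 * M₁ * |r1 x| = (m * |r1 x| - 2 * (A2 * M₁))^2 / (4 * m) := by
        rw [← sq_abs (r1 x)]; field_simp; ring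
      have h3 : 0 ≤ (m * |r1 x| - 2 * (A2 * M₁))^2 / (4 * m) := by positivity
      linarith
    rw [integral_const_mul, integral_add (i3.const_mul _) j7, integral_const_mul] at this
    have hc2 : ∫ _x in Icc (0:ℝ) 1, (A2 * M₁)^2 / m = (A2 * M₁)^2 / m := by simp
    rw [hc2] at this
    exact this
  have h1 : A2 * ∫ x in Icc 0 1, r x^2 ≤ A2 * (M₁^2 + M₁ * R) := by gcongr
  have hΦ0 : 0 ≤ Φ := (abs_nonneg _).trans (hl 0 (by simp))
  have h2 : (Φ * Real.sqrt M + pM) * ∫ x in Icc 0 1, r x ≤ (Φ * Real.sqrt M + pM) * M₁ := by gcongr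
  linarith

theorem ent_lip {p P l Φ a b : ℝ} (hp : 0 < p) (hl : |l| ≤ Φ) (ha : a ∈ Icc p P) (hb : b ∈ Icc p P) :
    |(a * Real.log a - a - l * a) - (b * Real.log b - b - l * b)| ≤
      (|Real.log p| + |Real.log P| + Φ) * |a - b| := by
  have := Convex.norm_image_sub_le_of_norm_hasDerivWithin_le (f := fun v => v * Real.log v - v - l * v)
    (f' := fun v => Real.log v - l) (s := Icc p P) (C := |Real.log p| + |Real.log P| + Φ) ?_ ?_
    (convex_Icc p P) hb ha
  · simpa using this
  · intro v hv
    have hv0 : 0 < v := hp.trans_le hv.1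
    have := ((Real.hasDerivAt_mul_log hv0.ne').sub (hasDerivAt_id v)).sub ((hasDerivAt_id v).const_mul l)
    exact (this.congr_deriv (by simp)).hasDerivWithinAt
  · intro v hv
    have hv0 : 0 < v := hp.trans_le hv.1
    have h1 := Real.log_le_log hp hv.1
    have h2 := Real.log_le_log hv0 hv.2
    have h3 : |Real.log v| ≤ |Real.log p| + |Real.log P| := by
      rw [abs_le]
      constructor
      · linarith [neg_abs_le (Real.log p), abs_nonneg (Real.log P)]
      · linarith [le_abs_self (Real.log P), abs_nonneg (Real.log p)]
    exact (norm_sub_le _ _).trans (by simp only [Real.norm_eq_abs]; linarith)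

theorem entropy_main {D : Dat} (h : Sol D) {m M M₁ M₂ M₃ k L Φ pM : ℝ} (hm : 0 < m) (hmM : m ≤ M) (hM₁ : 0 ≤ M₁)
    (hpM : 0 ≤ pM) {ps : ℝ → ℝ → ℝ}
    (hpsc : ∀ t ∈ Ioo 0 D.T, ContinuousOn (fun x => ps x t) (Icc 0 1))
    (hqm : ∀ x ∈ Icc (0:ℝ) 1, ∀ t ∈ Icc 0 D.T, m ≤ D.θ x t ∧ D.θ x t ≤ M)
    (hps : ∀ x ∈ Icc (0:ℝ) 1, ∀ t ∈ Icc 0 D.T, 0 ≤ ps x t ∧ ps x t ≤ pM)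
    (hl : ∀ x ∈ Icc (0:ℝ) 1, |L + k * x| ≤ Φ)
    (hγ : ∀ x t, D.γ x t = D.ρ x t * Real.sqrt (D.θ x t) - ps x t)
    (hmass : ∀ t ∈ Icc 0 D.T, ∫ x in Icc 0 1, D.ρ x t ≤ M₁)
    (hb1 : ∀ t ∈ Ioo 0 D.T, (Real.log (D.ρ 1 t) - (L + k)) *
      (D.ρ 1 t * (D.ρ1 1 t * D.θ 1 t + D.ρ 1 t * D.θ1 1 t)) ≤ 0)
    (hb0 : ∀ t ∈ Ioo 0 D.T, 0 ≤ (Real.log (D.ρ 0 t) - L) *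
      (D.ρ 0 t * (D.ρ1 0 t * D.θ 0 t + D.ρ 0 t * D.θ1 0 t)))
    (hM₂ : ∫ t in Icc 0 D.T, ∫ x in Icc 0 1, D.ρ x t^2 * D.θ1 x t^2 ≤ M₂)
    (hM₃ : ∫ x in Icc 0 1, D.ρ x 0 * |Real.log (D.ρ x 0)| ≤ M₃)
    {A3 C : ℝ} (hA3 : A3 = (2 * k^2 * M + k^2 / 2) * M₁^2 + ((2 * k^2 * M + k^2 / 2) * M₁)^2 / m + Real.sqrt M +
        (Φ * Real.sqrt M + pM) * M₁ + Φ * pM)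
    (hC : C = 2 * (M₃ + 2 * Φ * M₁ + M₁ + 2 + (2 / m + 1/2) * M₂ + A3 * D.T)) :
    (∀ t ∈ Icc 0 D.T, ∫ x in Icc 0 1, D.ρ x t * |Real.log (D.ρ x t)| ≤ C) ∧
    (∫ t in Icc 0 D.T, ∫ x in Icc 0 1, D.θ x t * D.ρ1 x t^2 ≤ C) ∧
    (∫ t in Icc 0 D.T, ∫ x in Icc 0 1, D.ρ1 x t^2 ≤ C / m) := by
  have hM : 0 < M := hm.trans_le hmM
  have hT := h.hT
  have hΦ0 : 0 ≤ Φ := (abs_nonneg _).trans (hl 0 (by simp))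
  have hA30 : 0 ≤ A3 := by rw [hA3]; positivity
  have hpos : ∀ x ∈ Icc (0:ℝ) 1, ∀ t ∈ Icc 0 D.T, 0 < D.ρ x t := fun x hx t ht =>
    h.hp.trans_le (h.bd x hx t ht).1
  set A1 := 2 / m + 1/2 with hA1
  have hA10 : 0 ≤ A1 := by positivity
  set G := fun t => ∫ x in Icc 0 1, D.θ x t * D.ρ1 x t^2 with hG
  set R := fun t => ∫ x in Icc 0 1, D.ρ x t^2 * D.θ1 x t^2 with hR
  set V := fun t => ∫ x in Icc 0 1, D.ρ1 x t^2 with hV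
  have hP0 : 0 < D.P := h.hp.trans_le h.hpP
  -- integrability in time
  have hcmp : ∀ (f : ℝ → ℝ) (c : ℝ), AEStronglyMeasurable f (volume.restrict (Icc 0 D.T)) →
      (∀ t ∈ Ioo 0 D.T, |f t| ≤ c * Wf D t) → IntegrableOn f (Icc 0 D.T) := by
    intro f c hf hc
    refine Integrable.mono' ((W_int h).const_mul c) hf ?_
    rw [← restrict_Ioo_eq_restrict_Icc]
    filter_upwards [ae_restrict_mem measurableSet_Ioo] with t ht using hc t ht
  have hslice : ∀ (f : ℝ → ℝ → ℝ) (c : ℝ), (∀ t ∈ Ioo 0 D.T, ContinuousOn (fun x => f x t) (Icc 0 1)) →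
      (∀ t ∈ Ioo 0 D.T, ∀ x ∈ Icc (0:ℝ) 1, 0 ≤ f x t ∧ f x t ≤ c * (D.ρ1 x t^2 + D.θ1 x t^2)) →
      ∀ t ∈ Ioo 0 D.T, |∫ x in Icc 0 1, f x t| ≤ c * Wf D t := by
    intro f c hf hb t ht
    have c1 := (h.C2ρ t ht).c1
    have c2 := (h.C2θ t ht).c1
    have k1 : ContinuousOn (fun x => D.ρ1 x t^2 + D.θ1 x t^2) (Icc 0 1) := by fun_prop
    rw [abs_of_nonneg (setIntegral_nonneg measurableSet_Icc fun x hx => (hb t ht x hx).1), Wf,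
      ← integral_const_mul]
    exact setIntegral_mono_on ((hf t ht).integrableOn_compact isCompact_Icc)
      ((k1.integrableOn_compact isCompact_Icc).const_mul c) measurableSet_Icc fun x hx => (hb t ht x hx).2
  have iG : IntegrableOn G (Icc 0 D.T) := by
    refine hcmp G D.P (meas_W hT h.cρ h.cθ (fun t ht => (h.C2ρ t ht).d1)) (hslice _ _ ?_ ?_)
    · intro t ht
      have := (h.C2ρ t ht).c1
      have := (h.C2θ t ht).c0
      fun_prop
    · intro t ht x hx
      obtain ⟨_, _, b3, b4⟩ := h.bd x hx t (Ioo_subset_Icc_self ht)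
      have := h.hp.trans_le b3
      refine ⟨by positivity, ?_⟩
      have h1 : D.θ x t * D.ρ1 x t^2 ≤ D.P * D.ρ1 x t^2 := by gcongr
      have h2 : 0 ≤ D.P * D.θ1 x t^2 := by positivity
      linarith
  have iV : IntegrableOn V (Icc 0 D.T) := by
    have := meas_W (v := fun _ _ => 1) h.hT h.cρ continuousOn_const (fun t ht => (h.C2ρ t ht).d1)
    simp only [one_mul] at this
    refine hcmp V 1 this (hslice _ _ ?_ ?_)
    · intro t ht
      have := (h.C2ρ t ht).c1
      fun_prop
    · intro t ht x hx
      refine ⟨by positivity, ?_⟩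
      have h2 : 0 ≤ D.θ1 x t^2 := by positivity
      linarith
  have iR : IntegrableOn R (Icc 0 D.T) := by
    refine hcmp R (D.P^2) (meas_W (v := fun x t => D.ρ x t^2) hT h.cθ (h.cρ.pow 2)
      (fun t ht => (h.C2θ t ht).d1)) (hslice (fun x t => D.ρ x t^2 * D.θ1 x t^2) _ ?_ ?_)
    · intro t ht
      have := (h.C2ρ t ht).c0
      have := (h.C2θ t ht).c1
      fun_prop
    · intro t ht x hx
      obtain ⟨b1, b2, _, _⟩ := h.bd x hx t (Ioo_subset_Icc_self ht)
      have := h.hp.trans_le b1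
      refine ⟨by positivity, ?_⟩
      have h1 : D.ρ x t^2 * D.θ1 x t^2 ≤ D.P^2 * D.θ1 x t^2 := by gcongr
      have h2 : 0 ≤ D.P^2 * D.ρ1 x t^2 := by positivity
      linarith
  have hR0 : ∀ t, 0 ≤ R t := fun t => integral_nonneg fun x => by positivity
  have hG0 : ∀ t ∈ Icc 0 D.T, 0 ≤ G t := fun t ht => setIntegral_nonneg measurableSet_Icc fun x hx =>
    mul_nonneg (hm.le.trans (hqm x hx t ht).1) (sq_nonneg _)
  -- the entropy functional
  set I := fun t => ∫ x in Icc 0 1, (D.ρ x t * Real.log (D.ρ x t) - D.ρ x t - (L + k * x) * D.ρ x t) with hI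
  have hjc : ContinuousOn (fun p : ℝ × ℝ => D.ρ p.1 p.2 * Real.log (D.ρ p.1 p.2) - D.ρ p.1 p.2 -
      (L + k * p.1) * D.ρ p.1 p.2) (Icc 0 1 ×ˢ Icc 0 D.T) := by
    have c1 := h.cρ
    have c2 : ContinuousOn (fun p : ℝ × ℝ => Real.log (D.ρ p.1 p.2)) (Icc 0 1 ×ˢ Icc 0 D.T) :=
      c1.log fun p hp => (hpos p.1 hp.1 p.2 hp.2).ne'
    fun_prop
  have hIc : ContinuousOn I (Icc 0 D.T) :=
    cont_int (F := fun x t => D.ρ x t * Real.log (D.ρ x t) - D.ρ x t - (L + k * x) * D.ρ x t) hjc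
      measurableSet_Icc subset_rfl
  have hId : ∀ t ∈ Ioo 0 D.T, HasDerivWithinAt I
      (∫ x in Icc 0 1, (Real.log (D.ρ x t) - (L + k * x)) * D.ρt x t) (Ioi t) t := by
    intro t ht
    have htI := Ioo_subset_Icc_self ht
    have c0 := slice_x h.cρ htI
    have cl : ContinuousOn (fun x => Real.log (D.ρ x t)) (Icc 0 1) := c0.log fun x hx => (hpos x hx t htI).ne'
    have ct := cont_ρt h ht
    obtain ⟨N, hN⟩ := bdd_of_cont (g := fun x => (Real.log (D.ρ x t) - (L + k * x)) * D.ρt x t)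
      (ContinuousOn.mul (f := fun x => Real.log (D.ρ x t) - (L + k * x)) (by fun_prop) ct)
      (fun x hx => by rw [h.eρ x hx t ht]; rfl)
    refine rd (g := fun x v => v * Real.log v - v - (L + k * x) * v) h.cρ ht (all_good h t ht).1 hjc
      (|Real.log D.p| + |Real.log D.P| + Φ) ?_ _ ?_ N hN
    · intro x hx s hs
      have b1 := h.bd x hx s hs
      have b2 := h.bd x hx t htI
      exact ent_lip h.hp (hl x hx) ⟨b1.1, b1.2.1⟩ ⟨b2.1, b2.2.1⟩
    · intro x hx
      have hxI := Ioo_subset_Icc_self hx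
      have hp := hpos x hxI t htI
      have d := h.tρ x hxI t ht
      have := ((d.mul (d.log hp.ne')).sub d).sub (d.const_mul (L + k * x))
      refine this.congr_deriv ?_
      field_simp
      ring
  have hIb : ∀ t ∈ Ioo 0 D.T, (∫ x in Icc 0 1, (Real.log (D.ρ x t) - (L + k * x)) * D.ρt x t) ≤
      -(1/2) * G t + A1 * R t + A3 := by
    intro t ht
    have htI := Ioo_subset_Icc_self ht
    rw [hA3]
    exact entropy_slice hm hmM hM₁ hpM (h.C2ρ t ht) (h.C2θ t ht) (hpsc t ht) (fun x hx => hpos x hx t htI)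
      (fun x hx => hqm x hx t htI) (fun x hx => hps x hx t htI) hl
      (fun x hx => by rw [h.eρ x hx t ht, hγ]) (hmass t htI) (hb1 t ht) (hb0 t ht)
  have hInteg : ∀ t ∈ Icc 0 D.T, I t - I 0 ≤ -(1/2) * (∫ s in Icc 0 t, G s) + A1 * M₂ + A3 * D.T := by
    intro t ht
    have hs : Icc 0 t ⊆ Icc 0 D.T := Icc_subset_Icc_right ht.2
    have iG' := iG.mono_set hs
    have iR' := iR.mono_set hs
    have j1 : IntegrableOn (fun t => -(1/2) * G t + A1 * R t) (Icc 0 t) := (iG'.const_mul _).add (iR'.const_mul _)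
    have j2 : IntegrableOn (fun _ : ℝ => A3) (Icc 0 t) := integrableOn_const (by simp)
    have := intervalIntegral.sub_le_integral_of_hasDeriv_right_of_le ht.1 (hIc.mono hs)
      (fun s hs' => hId s ⟨hs'.1, hs'.2.trans_le ht.2⟩)
      (φ := fun t => -(1/2) * G t + A1 * R t + A3) (j1.add j2) (fun s hs' => hIb s ⟨hs'.1, hs'.2.trans_le ht.2⟩)
    rw [intervalIntegral.integral_of_le ht.1, ← integral_Icc_eq_integral_Ioc, integral_add j1 j2,
      integral_add (iG'.const_mul _) (iR'.const_mul _), integral_const_mul, integral_const_mul] at this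
    have e1 : ∫ s in Icc 0 t, R s ≤ M₂ :=
      (setIntegral_mono_set iR (Eventually.of_forall hR0) (Eventually.of_forall hs)).trans hM₂
    have e2 : A1 * ∫ s in Icc 0 t, R s ≤ A1 * M₂ := by gcongr
    have e3 : ∫ _s in Icc 0 t, A3 = t * A3 := by simp [ht.1]
    have e4 : t * A3 ≤ D.T * A3 := by gcongr; exact ht.2
    linarith
  -- comparison of the entropy functional
  have hcont : ∀ t ∈ Icc 0 D.T, ContinuousOn (fun x => D.ρ x t) (Icc 0 1) ∧
      ContinuousOn (fun x => Real.log (D.ρ x t)) (Icc 0 1) := fun t ht =>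
    ⟨slice_x h.cρ ht, (slice_x h.cρ ht).log fun x hx => (hpos x hx t ht).ne'⟩
  have hlow : ∀ t ∈ Icc 0 D.T, ∫ x in Icc 0 1, D.ρ x t * |Real.log (D.ρ x t)| ≤
      I t + (1 + Φ) * M₁ + 2 := by
    intro t ht
    obtain ⟨c0, cl⟩ := hcont t ht
    have k1 : ContinuousOn (fun x => D.ρ x t * |Real.log (D.ρ x t)|) (Icc 0 1) := by fun_prop
    have k2 : ContinuousOn (fun x => D.ρ x t * Real.log (D.ρ x t) - D.ρ x t - (L + k * x) * D.ρ x t) (Icc 0 1) := by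
      fun_prop
    have i1 := k1.integrableOn_compact (μ := volume) isCompact_Icc
    have i2 := k2.integrableOn_compact (μ := volume) isCompact_Icc
    have i0 := c0.integrableOn_compact (μ := volume) isCompact_Icc
    have i3 : IntegrableOn (fun _ : ℝ => (2:ℝ)) (Icc 0 1) := integrableOn_const (by simp)
    have j1 : IntegrableOn (fun x => (D.ρ x t * Real.log (D.ρ x t) - D.ρ x t - (L + k * x) * D.ρ x t) +
      (1 + Φ) * D.ρ x t) (Icc 0 1) := i2.add (i0.const_mul _)
    have := setIntegral_mono_on i1 (j1.add i3) measurableSet_Icc fun x hx => by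
      have hp := hpos x hx t ht
      have e1 := neg_mul_log_le hp
      have e2 : -(Φ * D.ρ x t) ≤ (L + k * x) * D.ρ x t ∧ (L + k * x) * D.ρ x t ≤ Φ * D.ρ x t := by
        have := abs_le.1 (hl x hx)
        constructor <;> nlinarith
      simp only [Pi.add_apply]
      rcases abs_cases (Real.log (D.ρ x t)) with ⟨e, _⟩ | ⟨e, _⟩ <;> rw [e] <;> linarith [e2.1, e2.2]
    simp only [Pi.add_apply] at this
    rw [integral_add j1 i3, integral_add i2 (i0.const_mul _), integral_const_mul] at this
    have e3 : ∫ _x in Icc (0:ℝ) 1, (2:ℝ) = 2 := by simp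
    have e4 : (1 + Φ) * ∫ x in Icc 0 1, D.ρ x t ≤ (1 + Φ) * M₁ := by gcongr; exact hmass t ht
    rw [e3] at this
    have e5 : I t = ∫ x in Icc 0 1, (D.ρ x t * Real.log (D.ρ x t) - D.ρ x t - (L + k * x) * D.ρ x t) := rfl
    linarith
  have h0T : (0:ℝ) ∈ Icc 0 D.T := ⟨le_rfl, hT.le⟩
  have hTT : D.T ∈ Icc 0 D.T := ⟨hT.le, le_rfl⟩
  have hup : I 0 ≤ M₃ + Φ * M₁ := by
    obtain ⟨c0, cl⟩ := hcont 0 h0T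
    have k1 : ContinuousOn (fun x => D.ρ x 0 * |Real.log (D.ρ x 0)|) (Icc 0 1) := by fun_prop
    have k2 : ContinuousOn (fun x => D.ρ x 0 * Real.log (D.ρ x 0) - D.ρ x 0 - (L + k * x) * D.ρ x 0) (Icc 0 1) := by
      fun_prop
    have i1 := k1.integrableOn_compact (μ := volume) isCompact_Icc
    have i2 := k2.integrableOn_compact (μ := volume) isCompact_Icc
    have i0 := c0.integrableOn_compact (μ := volume) isCompact_Icc
    have := setIntegral_mono_on i2 (i1.add (i0.const_mul Φ)) measurableSet_Icc fun x hx => by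
      have hp := hpos x hx 0 h0T
      have e2 : -(Φ * D.ρ x 0) ≤ (L + k * x) * D.ρ x 0 := by
        have := abs_le.1 (hl x hx)
        nlinarith
      have e3 : D.ρ x 0 * Real.log (D.ρ x 0) ≤ D.ρ x 0 * |Real.log (D.ρ x 0)| := by
        gcongr; exact le_abs_self _
      simp only [Pi.add_apply]
      linarith
    simp only [Pi.add_apply] at this
    rw [integral_add i1 (i0.const_mul _), integral_const_mul] at this
    have e4 : Φ * ∫ x in Icc 0 1, D.ρ x 0 ≤ Φ * M₁ := by gcongr; exact hmass 0 h0T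
    have e5 : I 0 = ∫ x in Icc 0 1, (D.ρ x 0 * Real.log (D.ρ x 0) - D.ρ x 0 - (L + k * x) * D.ρ x 0) := rfl
    linarith
  have hM₃0 : 0 ≤ M₃ := le_trans (setIntegral_nonneg measurableSet_Icc fun x hx =>
    mul_nonneg (hpos x hx 0 h0T).le (abs_nonneg _)) hM₃
  have hM₂0 : 0 ≤ M₂ := le_trans (setIntegral_nonneg measurableSet_Icc fun t _ => hR0 t) hM₂
  have hAM : 0 ≤ A1 * M₂ := by positivity
  have hAT : 0 ≤ A3 * D.T := by positivity
  have hΦM : 0 ≤ Φ * M₁ := by positivity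
  have f2 : ∫ t in Icc 0 D.T, G t ≤ C := by
    have a1 := hInteg D.T hTT
    have a2 := hlow D.T hTT
    have a3 : 0 ≤ ∫ x in Icc 0 1, D.ρ x D.T * |Real.log (D.ρ x D.T)| :=
      setIntegral_nonneg measurableSet_Icc fun x hx => mul_nonneg (hpos x hx D.T hTT).le (abs_nonneg _)
    rw [hC]
    linarith
  refine ⟨?_, f2, ?_⟩
  · intro t ht
    have a1 := hInteg t ht
    have a2 := hlow t ht
    have a3 : 0 ≤ ∫ s in Icc 0 t, G s :=
      setIntegral_nonneg measurableSet_Icc fun s hs => hG0 s ⟨hs.1, hs.2.trans ht.2⟩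
    rw [hC]
    linarith
  · rw [le_div_iff₀ hm, mul_comm, ← integral_const_mul]
    refine le_trans ?_ f2
    rw [← restrict_Ioo_eq_restrict_Icc]
    refine setIntegral_mono_on ((iV.mono_set Ioo_subset_Icc_self).const_mul m) (iG.mono_set Ioo_subset_Icc_self)
      measurableSet_Ioo fun t ht => ?_
    have c1 := (h.C2ρ t ht).c1
    have c2 := (h.C2θ t ht).c0
    have k1 : ContinuousOn (fun x => D.ρ1 x t^2) (Icc 0 1) := by fun_prop
    have k2 : ContinuousOn (fun x => D.θ x t * D.ρ1 x t^2) (Icc 0 1) := by fun_prop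
    simp only [hV, hG]
    rw [← integral_const_mul]
    refine setIntegral_mono_on ((k1.integrableOn_compact isCompact_Icc).const_mul m)
      (k2.integrableOn_compact isCompact_Icc) measurableSet_Icc fun x hx => ?_
    have := (hqm x hx t (Ioo_subset_Icc_self ht)).1
    gcongr

theorem C2_of_contDiffOn {f : ℝ → ℝ} (hf : ContDiffOn ℝ 2 f (Icc 0 1)) :
    C2 f (derivWithin f (Icc 0 1)) (derivWithin (derivWithin f (Icc 0 1)) (Icc 0 1)) := by
  have u : UniqueDiffOn ℝ (Icc (0:ℝ) 1) := uniqueDiffOn_Icc zero_lt_one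
  have h1 : ContDiffOn ℝ 1 (derivWithin f (Icc 0 1)) (Icc 0 1) := by
    have := (contDiffOn_succ_iff_derivWithin (n := 1) u).1 (by simpa [one_add_one_eq_two] using hf)
    exact this.2.2
  have h2 : ContinuousOn (derivWithin (derivWithin f (Icc 0 1)) (Icc 0 1)) (Icc 0 1) :=
    h1.continuousOn_derivWithin u le_rfl
  refine ⟨hf.continuousOn, h1.continuousOn, h2, fun x hx => ?_, fun x hx => ?_⟩
  · exact ((hf.differentiableOn (by simp)) x (Ioo_subset_Icc_self hx)).hasDerivWithinAt.hasDerivAt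
      (Icc_mem_nhds hx.1 hx.2)
  · exact ((h1.differentiableOn (by simp)) x (Ioo_subset_Icc_self hx)).hasDerivWithinAt.hasDerivAt
      (Icc_mem_nhds hx.1 hx.2)

theorem flux_deriv {r r1 r2 q q1 q2 : ℝ → ℝ} (hr : C2 r r1 r2) (hq : C2 q q1 q2) {x : ℝ}
    (hx : x ∈ Ioo (0:ℝ) 1) :
    HasDerivAt (fun y => deriv (fun z => r z * q z) y * r y)
      (r1 x * (r1 x * q x + r x * q1 x) + r x * (r2 x * q x + 2 * r1 x * q1 x + r x * q2 x)) x := by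
  have e : (fun y => deriv (fun z => r z * q z) y * r y) =ᶠ[𝓝 x]
      fun y => (r1 y * q y + r y * q1 y) * r y := by
    filter_upwards [Ioo_mem_nhds hx.1 hx.2] with y hy
    rw [((hr.d1 y hy).fun_mul (hq.d1 y hy)).deriv]
  refine HasDerivAt.congr_of_eventuallyEq ?_ e
  have := (((hr.d2 x hx).mul (hq.d1 x hx)).add ((hr.d1 x hx).mul (hq.d2 x hx))).mul (hr.d1 x hx)
  exact this.congr_deriv (by simp only [Pi.add_apply, Pi.mul_apply]; ring)

theorem heat_deriv {r r1 r2 q q1 q2 : ℝ → ℝ} {κ₁ κ₂ : ℝ} (hr : C2 r r1 r2) (hq : C2 q q1 q2) {x : ℝ}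
    (hx : x ∈ Ioo (0:ℝ) 1) :
    HasDerivAt (fun y => (κ₁ + κ₂ * (r y) ^ 2) * deriv (fun z => q z) y)
      ((κ₁ + κ₂ * r x ^ 2) * q2 x + 2 * κ₂ * r x * r1 x * q1 x) x := by
  have e : (fun y => (κ₁ + κ₂ * (r y) ^ 2) * deriv (fun z => q z) y) =ᶠ[𝓝 x]
      fun y => (κ₁ + κ₂ * (r y) ^ 2) * q1 y := by
    filter_upwards [Ioo_mem_nhds hx.1 hx.2] with y hy
    rw [(hq.d1 y hy).deriv]
  refine HasDerivAt.congr_of_eventuallyEq ?_ e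
  have := ((((hr.d1 x hx).fun_pow 2).const_mul κ₂).const_add κ₁).mul (hq.d2 x hx)
  exact this.congr_deriv (by norm_num; ring)

/-- two-sided derivative at an end point: either it is the one-sided one or it is zero -/
theorem deriv_end {f : ℝ → ℝ} {d x : ℝ} (hx : x ∈ Icc (0:ℝ) 1) (hf : HasDerivWithinAt f d (Icc 0 1) x) :
    deriv f x = d ∨ deriv f x = 0 := by
  by_cases h : DifferentiableAt ℝ f x
  · left
    have u := uniqueDiffOn_Icc (zero_lt_one (α := ℝ)) x hx
    rw [← h.derivWithin u, hf.derivWithin u]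
  · right; exact deriv_zero_of_not_differentiableAt h

theorem log_sign {a b c : ℝ} (ha : 0 < a) (hb : 0 < b) (hc : 0 < c) :
    (Real.log a - Real.log b) * (c * (b - a)) ≤ 0 := by
  rcases le_total a b with h | h
  · have := Real.log_le_log ha h
    exact mul_nonpos_of_nonpos_of_nonneg (by linarith) (mul_nonneg hc.le (by linarith))
  · have := Real.log_le_log hb h
    exact mul_nonpos_of_nonneg_of_nonpos (by linarith) (mul_nonpos_of_nonneg_of_nonpos hc.le (by linarith))

theorem heat_alg {r r1 r2 q q1 q2 rt qt g s l K : ℝ} (hrs : r + s ≠ 0)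
    (h1 : rt = r1 * (r1 * q + r * q1) + r * (r2 * q + 2 * r1 * q1 + r * q2) - g)
    (h2 : (rt * q + r * qt + s * qt) - ((r1 * (r1 * q + r * q1) + r * (r2 * q + 2 * r1 * q1 + r * q2)) * q +
      ((r1 * q + r * q1) * r) * q1) - K = l * g) :
    qt = (1 / (r + s)) * (r * (r1 * q + r * q1) * q1 + K + (l + q) * g) := by
  field_simp
  subst h1
  linarith

theorem conv_int {b : ℝ} (hb : 0 ≤ b) {F G : ℝ → ℝ} (h : ∀ x ∈ Ioo 0 b, F x = G x) :
    ∫ x in (0:ℝ)..b, F x = ∫ x in Icc 0 b, G x := by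
  rw [intervalIntegral.integral_of_le hb, ← integral_Icc_eq_integral_Ioc, ← restrict_Ioo_eq_restrict_Icc]
  exact setIntegral_congr_fun measurableSet_Ioo h

theorem log_sign' {a b c : ℝ} (ha : 0 < a) (hb : 0 < b) (hc : 0 < c) :
    0 ≤ (Real.log a - Real.log b) * (c * (a - b)) := by
  have := log_sign ha hb hc
  have e : (Real.log a - Real.log b) * (c * (a - b)) = -((Real.log a - Real.log b) * (c * (b - a))) := by ring
  rw [e]; exact neg_nonneg.2 this

set_option maxHeartbeats 1000000 in
theorem textile_entropy_estimate
    (T σ lam κ₁ κ₂ α0 α1 β0 β1 ρb0 ρb1 θb0 θb1 : ℝ)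
    (hT : 0 < T) (hσ : 0 < σ) (hlam : 0 < lam)
    (hκ₁ : 0 < κ₁) (hκ₂ : 0 < κ₂)
    (hα0 : 0 < α0) (hα1 : 0 < α1) (hβ0 : 0 < β0) (hβ1 : 0 < β1)
    (hρb0 : 0 < ρb0) (hρb1 : 0 < ρb1) (hθb0 : 0 < θb0) (hθb1 : 0 < θb1)
    (p_s : ℝ → ℝ)
    (hps_smooth : ContDiff ℝ (⊤ : ℕ∞) p_s)
    (hps_mono : Monotone p_s)
    (hps_nonneg : ∀ s, 0 ≤ p_s s)
    (hps_zero : ∀ s ≤ 0, p_s s = 0)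
    (m M M₁ M₂ M₃ : ℝ) (hm : 0 < m) (hmM : m ≤ M)
    (hM₁ : 0 ≤ M₁) (hM₂ : 0 ≤ M₂) (hM₃ : 0 ≤ M₃) :
    ∃ C : ℝ, ∀ (ρ θ : ℝ → ℝ → ℝ) (ρ₀ θ₀ : ℝ → ℝ),
      ContinuousOn ρ₀ (Set.Icc 0 1) →
      ContinuousOn θ₀ (Set.Icc 0 1) →
      (∀ x ∈ Set.Icc (0:ℝ) 1, 0 ≤ ρ₀ x) →
      (∀ x ∈ Set.Icc (0:ℝ) 1, 0 ≤ θ₀ x) →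
      ContinuousOn (fun p : ℝ × ℝ => ρ p.1 p.2) (Set.Icc 0 1 ×ˢ Set.Icc 0 T) →
      (∀ t ∈ Set.Ioc (0:ℝ) T, ContDiffOn ℝ 2 (fun x => ρ x t) (Set.Icc 0 1)) →
      (∀ x ∈ Set.Icc (0:ℝ) 1, ∀ t ∈ Set.Ioc (0:ℝ) T, DifferentiableAt ℝ (fun s => ρ x s) t) →
      ContinuousOn (fun p : ℝ × ℝ => θ p.1 p.2) (Set.Icc 0 1 ×ˢ Set.Icc 0 T) →
      (∀ t ∈ Set.Ioc (0:ℝ) T, ContDiffOn ℝ 2 (fun x => θ x t) (Set.Icc 0 1)) →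
      (∀ x ∈ Set.Icc (0:ℝ) 1, ∀ t ∈ Set.Ioc (0:ℝ) T, DifferentiableAt ℝ (fun s => θ x s) t) →
      (∀ x ∈ Set.Ioo (0:ℝ) 1, ∀ t ∈ Set.Ioc (0:ℝ) T,
      deriv (fun s => ρ x s) t
        - deriv (fun y => deriv (fun z => ρ z t * θ z t) y * ρ y t) x
      = -(ρ x t * Real.sqrt (θ x t) - p_s (θ x t))) →
      (∀ x ∈ Set.Ioo (0:ℝ) 1, ∀ t ∈ Set.Ioc (0:ℝ) T,
      deriv (fun s => ρ x s * θ x s + σ * θ x s) t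
        - deriv (fun y => deriv (fun z => ρ z t * θ z t) y * ρ y t * θ y t) x
        - deriv (fun y => (κ₁ + κ₂ * (ρ y t) ^ 2) * deriv (fun z => θ z t) y) x
      = lam * (ρ x t * Real.sqrt (θ x t) - p_s (θ x t))) →
      (∀ t ∈ Set.Ioc (0:ℝ) T,
      deriv (fun z => ρ z t * θ z t) 1 * ρ 1 t = α1 * (ρb1 - ρ 1 t)) →
      (∀ t ∈ Set.Ioc (0:ℝ) T,
      deriv (fun z => ρ z t * θ z t) 0 * ρ 0 t = α0 * (ρ 0 t - ρb0)) →
      (∀ t ∈ Set.Ioc (0:ℝ) T,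
      (κ₁ + κ₂ * (ρ 1 t) ^ 2) * deriv (fun z => θ z t) 1 = β1 * (θb1 - θ 1 t)) →
      (∀ t ∈ Set.Ioc (0:ℝ) T,
      (κ₁ + κ₂ * (ρ 0 t) ^ 2) * deriv (fun z => θ z t) 0 = β0 * (θ 0 t - θb0)) →
      (∀ x ∈ Set.Icc (0:ℝ) 1, ρ x 0 = ρ₀ x) →
      (∀ x ∈ Set.Icc (0:ℝ) 1, θ x 0 = θ₀ x) →
      (∀ x ∈ Set.Icc (0:ℝ) 1, ∀ t ∈ Set.Icc (0:ℝ) T, 0 < ρ x t) →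
      (∀ x ∈ Set.Icc (0:ℝ) 1, ∀ t ∈ Set.Icc (0:ℝ) T, m ≤ θ x t) →
      (∀ x ∈ Set.Icc (0:ℝ) 1, ∀ t ∈ Set.Icc (0:ℝ) T, θ x t ≤ M) →
      (∀ t ∈ Set.Icc (0:ℝ) T, (∫ x in (0:ℝ)..1, ρ x t) ≤ M₁) →
      ((∫ t in (0:ℝ)..T, ∫ x in (0:ℝ)..1,
        (ρ x t) ^ 2 * (deriv (fun z => θ z t) x) ^ 2) ≤ M₂) →
      ((∫ x in (0:ℝ)..1, ρ₀ x * |Real.log (ρ₀ x)|) ≤ M₃) →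
      (∀ t ∈ Set.Icc (0:ℝ) T,
          (∫ x in (0:ℝ)..1, ρ x t * |Real.log (ρ x t)|) ≤ C) ∧
        ((∫ t in (0:ℝ)..T, ∫ x in (0:ℝ)..1,
            θ x t * (deriv (fun z => ρ z t) x) ^ 2) ≤ C) ∧
        ((∫ t in (0:ℝ)..T, ∫ x in (0:ℝ)..1,
            (deriv (fun z => ρ z t) x) ^ 2) ≤ C / m) := by
  set Φ := |Real.log ρb0| + |Real.log ρb1| with hΦ
  set k := Real.log ρb1 - Real.log ρb0 with hk
  set A3 := (2*k^2*M+k^2/2)*M₁^2 + ((2*k^2*M+k^2/2)*M₁)^2/m + √M + (Φ*√M+p_s M)*M₁ + Φ*p_s M with hA3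
  refine ⟨2 * (M₃ + 2 * Φ * M₁ + M₁ + 2 + (2 / m + 1/2) * M₂ + A3 * T), ?_⟩
  intro ρ θ ρ₀ θ₀ _ _ _ _ cρ sρ tρ cθ sθ tθ pde1 pde2 bc1 bc0 bh1 bh0 iρ _ ρpos θm θM mass hR h3
  have hIoc : ∀ t ∈ Ioo 0 T, t ∈ Ioc 0 T := fun t ht => ⟨ht.1, ht.2.le⟩
  have hIcc : ∀ t ∈ Ioo 0 T, t ∈ Icc 0 T := fun t ht => ⟨ht.1.le, ht.2.le⟩
  have h01 : (0:ℝ) ∈ Icc (0:ℝ) 1 := by simp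
  have h11 : (1:ℝ) ∈ Icc (0:ℝ) 1 := by simp
  have hcomp : IsCompact (Icc (0:ℝ) 1 ×ˢ Icc 0 T) := isCompact_Icc.prod isCompact_Icc
  have hne : (Icc (0:ℝ) 1 ×ˢ Icc 0 T).Nonempty := ⟨(0, 0), h01, ⟨le_rfl, hT.le⟩⟩
  obtain ⟨z0, hz0, hz0'⟩ := hcomp.exists_isMinOn hne cρ
  obtain ⟨z1, hz1, hz1'⟩ := hcomp.exists_isMaxOn hne cρ
  obtain ⟨Pmin, hPmin0, hPmin⟩ : ∃ P0 : ℝ, 0 < P0 ∧ ∀ x ∈ Icc (0:ℝ) 1, ∀ t ∈ Icc 0 T, P0 ≤ ρ x t :=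
    ⟨ρ z0.1 z0.2, ρpos _ hz0.1 _ hz0.2, fun x hx t ht => hz0' (show (x, t) ∈ _ from ⟨hx, ht⟩)⟩
  obtain ⟨Pmax, hPmax⟩ : ∃ P0 : ℝ, ∀ x ∈ Icc (0:ℝ) 1, ∀ t ∈ Icc 0 T, ρ x t ≤ P0 :=
    ⟨ρ z1.1 z1.2, fun x hx t ht => hz1' (show (x, t) ∈ _ from ⟨hx, ht⟩)⟩
  have h0T : (0:ℝ) ∈ Icc 0 T := ⟨le_rfl, hT.le⟩
  have hPmM : 0 < Pmax := hPmin0.trans_le ((hPmin 0 h01 0 h0T).trans (hPmax 0 h01 0 h0T))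
  have hM0 : 0 < M := hm.trans_le hmM
  have hpsM : ∀ x ∈ Icc (0:ℝ) 1, ∀ t ∈ Icc 0 T, 0 ≤ p_s (θ x t) ∧ p_s (θ x t) ≤ p_s M :=
    fun x hx t ht => ⟨hps_nonneg _, hps_mono (θM x hx t ht)⟩
  set D : Dat :=
    { T := T, p := min Pmin m, P := max Pmax M, σ := σ, κ₁ := κ₁, κ₂ := κ₂, lam := lam
      Gb := Pmax * √M + p_s M
      Cb := α0 * (Pmax + ρb0) + α1 * (Pmax + ρb1) + β0 * (M + θb0) + β1 * (M + θb1)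
      rb := fun x => if x = 0 then ρb0 else ρb1
      qb := fun x => if x = 0 then θb0 else θb1
      ρ := ρ, θ := θ
      ρ1 := fun x t => derivWithin (fun x => ρ x t) (Icc 0 1) x
      θ1 := fun x t => derivWithin (fun x => θ x t) (Icc 0 1) x
      ρ2 := fun x t => derivWithin (derivWithin (fun x => ρ x t) (Icc 0 1)) (Icc 0 1) x
      θ2 := fun x t => derivWithin (derivWithin (fun x => θ x t) (Icc 0 1)) (Icc 0 1) x
      ρt := fun x t => deriv (fun s => ρ x s) t
      θt := fun x t => deriv (fun s => θ x s) t
      γ := fun x t => ρ x t * √(θ x t) - p_s (θ x t) } with hD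
  have C2ρ : ∀ t ∈ Ioo 0 T, C2 (fun x => ρ x t) (fun x => D.ρ1 x t) (fun x => D.ρ2 x t) := fun t ht =>
    C2_of_contDiffOn (sρ t (hIoc t ht))
  have C2θ : ∀ t ∈ Ioo 0 T, C2 (fun x => θ x t) (fun x => D.θ1 x t) (fun x => D.θ2 x t) := fun t ht =>
    C2_of_contDiffOn (sθ t (hIoc t ht))
  have wρ : ∀ t ∈ Ioo 0 T, ∀ x ∈ Icc (0:ℝ) 1, HasDerivWithinAt (fun x => ρ x t) (D.ρ1 x t) (Icc 0 1) x :=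
    fun t ht x hx => ((sρ t (hIoc t ht)).differentiableOn (by simp) x hx).hasDerivWithinAt
  have wθ : ∀ t ∈ Ioo 0 T, ∀ x ∈ Icc (0:ℝ) 1, HasDerivWithinAt (fun x => θ x t) (D.θ1 x t) (Icc 0 1) x :=
    fun t ht x hx => ((sθ t (hIoc t ht)).differentiableOn (by simp) x hx).hasDerivWithinAt
  have wF : ∀ t ∈ Ioo 0 T, ∀ x ∈ Icc (0:ℝ) 1, deriv (fun z => ρ z t * θ z t) x =
      D.ρ1 x t * θ x t + ρ x t * D.θ1 x t ∨ deriv (fun z => ρ z t * θ z t) x = 0 := fun t ht x hx =>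
    deriv_end hx ((wρ t ht x hx).mul (wθ t ht x hx))
  have wH : ∀ t ∈ Ioo 0 T, ∀ x ∈ Icc (0:ℝ) 1, deriv (fun z => θ z t) x = D.θ1 x t ∨
      deriv (fun z => θ z t) x = 0 := fun t ht x hx => deriv_end hx (wθ t ht x hx)
  -- boundary alternatives
  have B1 : ∀ t ∈ Ioo 0 T, ρ 1 t * (D.ρ1 1 t * θ 1 t + ρ 1 t * D.θ1 1 t) = α1 * (ρb1 - ρ 1 t) ∨ ρ 1 t = ρb1 := by
    intro t ht
    have b := bc1 t (hIoc t ht)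
    rcases wF t ht 1 h11 with e | e <;> rw [e] at b
    · left; linarith
    · right
      have := (mul_eq_zero.1 ((zero_mul (ρ 1 t)).symm.trans b).symm).resolve_left hα1.ne'
      linarith
  have B0 : ∀ t ∈ Ioo 0 T, ρ 0 t * (D.ρ1 0 t * θ 0 t + ρ 0 t * D.θ1 0 t) = α0 * (ρ 0 t - ρb0) ∨ ρ 0 t = ρb0 := by
    intro t ht
    have b := bc0 t (hIoc t ht)
    rcases wF t ht 0 h01 with e | e <;> rw [e] at b
    · left; linarith
    · right
      have := (mul_eq_zero.1 ((zero_mul (ρ 0 t)).symm.trans b).symm).resolve_left hα0.ne'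
      linarith
  have H1 : ∀ t ∈ Ioo 0 T, (κ₁ + κ₂ * ρ 1 t^2) * D.θ1 1 t = β1 * (θb1 - θ 1 t) ∨ θ 1 t = θb1 := by
    intro t ht
    have b := bh1 t (hIoc t ht)
    rcases wH t ht 1 h11 with e | e <;> rw [e] at b
    · left; exact b
    · right
      have := (mul_eq_zero.1 ((mul_zero _).symm.trans b).symm).resolve_left hβ1.ne'
      linarith
  have H0 : ∀ t ∈ Ioo 0 T, (κ₁ + κ₂ * ρ 0 t^2) * D.θ1 0 t = β0 * (θ 0 t - θb0) ∨ θ 0 t = θb0 := by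
    intro t ht
    have b := bh0 t (hIoc t ht)
    rcases wH t ht 0 h01 with e | e <;> rw [e] at b
    · left; exact b
    · right
      have := (mul_eq_zero.1 ((mul_zero _).symm.trans b).symm).resolve_left hβ0.ne'
      linarith
  have Eρ : ∀ x ∈ Ioo (0:ℝ) 1, ∀ t ∈ Ioo 0 T, D.ρt x t =
      D.ρ1 x t * (D.ρ1 x t * θ x t + ρ x t * D.θ1 x t) +
        ρ x t * (D.ρ2 x t * θ x t + 2 * D.ρ1 x t * D.θ1 x t + ρ x t * D.θ2 x t) - D.γ x t := by
    intro x hx t ht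
    have a := pde1 x hx t (hIoc t ht)
    rw [(flux_deriv (C2ρ t ht) (C2θ t ht) hx).deriv] at a
    have e1 : D.ρt x t = deriv (fun s => ρ x s) t := rfl
    have e2 : D.γ x t = ρ x t * √(θ x t) - p_s (θ x t) := rfl
    rw [e1, e2]; linarith
  have hαP0 : 0 ≤ α0 * (Pmax + ρb0) := by positivity
  have hαP1 : 0 ≤ α1 * (Pmax + ρb1) := by positivity
  have hβP0 : 0 ≤ β0 * (M + θb0) := by positivity
  have hβP1 : 0 ≤ β1 * (M + θb1) := by positivity
  have habs : ∀ a b c d : ℝ, 0 < a → 0 < b → 0 < c → b ≤ d → |a * (c - b)| ≤ a * (d + c) := by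
    intro a b c d ha hb hc hd
    rw [abs_mul, abs_of_pos ha]
    gcongr
    rw [abs_le]; constructor <;> linarith
  have hCbD : D.Cb = α0 * (Pmax + ρb0) + α1 * (Pmax + ρb1) + β0 * (M + θb0) + β1 * (M + θb1) := rfl
  have hS : Sol D := by
    refine
      { hT := hT
        hp := lt_min hPmin0 hm
        hpP := (min_le_right _ _).trans (hmM.trans (le_max_right _ _))
        hσ := hσ, hκ₁ := hκ₁, hκ₂ := hκ₂, hlam := hlam
        cρ := cρ, cθ := cθ, C2ρ := C2ρ, C2θ := C2θ
        cγ := ?_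
        tρ := fun x hx t ht => (tρ x hx t (hIoc t ht)).hasDerivAt
        tθ := fun x hx t ht => (tθ x hx t (hIoc t ht)).hasDerivAt
        bd := fun x hx t ht => ⟨(min_le_left _ _).trans (hPmin x hx t ht), (hPmax x hx t ht).trans (le_max_left _ _),
          (min_le_right _ _).trans (θm x hx t ht), (θM x hx t ht).trans (le_max_right _ _)⟩
        bγ := ?_
        eρ := Eρ
        eθ := ?_
        bρ := ?_
        bθ := ?_ }
    · intro t ht
      have c1 := (C2ρ t ht).c0
      have c2 := (C2θ t ht).c0
      have c3 : ContinuousOn (fun x => p_s (θ x t)) (Icc 0 1) := hps_smooth.continuous.comp_continuousOn c2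
      have c4 : ContinuousOn (fun x => √(θ x t)) (Icc 0 1) := Real.continuous_sqrt.comp_continuousOn c2
      exact (c1.mul c4).sub c3
    · intro x hx t ht
      have ht' := hIcc t ht
      have a1 := ρpos x hx t ht'
      have a2 : ρ x t * √(θ x t) ≤ Pmax * √M :=
        mul_le_mul (hPmax x hx t ht') (Real.sqrt_le_sqrt (θM x hx t ht')) (Real.sqrt_nonneg _) hPmM.le
      have a3 : 0 ≤ ρ x t * √(θ x t) := mul_nonneg a1.le (Real.sqrt_nonneg _)
      have a4 := hpsM x hx t ht'
      change |ρ x t * √(θ x t) - p_s (θ x t)| ≤ Pmax * √M + p_s M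
      rw [abs_le]; constructor <;> linarith [a4.1, a4.2]
    · intro x hx t ht
      have hx' := Ioo_subset_Icc_self hx
      have a := pde2 x hx t (hIoc t ht)
      have f1 := flux_deriv (C2ρ t ht) (C2θ t ht) hx
      have dr := (tρ x hx' t (hIoc t ht)).hasDerivAt
      have dq := (tθ x hx' t (hIoc t ht)).hasDerivAt
      rw [(f1.fun_mul ((C2θ t ht).d1 x hx)).deriv, (heat_deriv (C2ρ t ht) (C2θ t ht) hx).deriv,
        ((dr.fun_mul dq).fun_add (dq.const_mul σ)).deriv,
        (((C2ρ t ht).d1 x hx).fun_mul ((C2θ t ht).d1 x hx)).deriv] at a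
      exact heat_alg (by have := ρpos x hx' t (hIcc t ht); change ρ x t + σ ≠ 0; positivity) (Eρ x hx t ht) a
    · rintro x (rfl | rfl) t ht
      · rcases B0 t ht with e | e
        · left
          refine (congrArg abs e).le.trans ?_
          have := habs α0 (ρ 0 t) ρb0 Pmax hα0 (ρpos 0 h01 t (hIcc t ht)) hρb0 (hPmax 0 h01 t (hIcc t ht))
          rw [← abs_neg, show -(α0 * (ρ 0 t - ρb0)) = α0 * (ρb0 - ρ 0 t) by ring, hCbD]
          linarith
        · right; simpa [hD] using e
      · rcases B1 t ht with e | e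
        · left
          refine (congrArg abs e).le.trans ?_
          have := habs α1 (ρ 1 t) ρb1 Pmax hα1 (ρpos 1 h11 t (hIcc t ht)) hρb1 (hPmax 1 h11 t (hIcc t ht))
          rw [hCbD]
          linarith
        · right; simpa [hD] using e
    · rintro x (rfl | rfl) t ht
      · rcases H0 t ht with e | e
        · left
          refine (congrArg abs e).le.trans ?_
          have := habs β0 (θ 0 t) θb0 M hβ0 (hm.trans_le (θm 0 h01 t (hIcc t ht))) hθb0 (θM 0 h01 t (hIcc t ht))
          rw [← abs_neg, show -(β0 * (θ 0 t - θb0)) = β0 * (θb0 - θ 0 t) by ring, hCbD]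
          linarith
        · right; simpa [hD] using e
      · rcases H1 t ht with e | e
        · left
          refine (congrArg abs e).le.trans ?_
          have := habs β1 (θ 1 t) θb1 M hβ1 (hm.trans_le (θm 1 h11 t (hIcc t ht))) hθb1 (θM 1 h11 t (hIcc t ht))
          rw [hCbD]
          linarith
        · right; simpa [hD] using e
  have dρ : ∀ t ∈ Ioo 0 T, ∀ x ∈ Ioo (0:ℝ) 1, deriv (fun z => ρ z t) x = D.ρ1 x t := fun t ht x hx =>
    ((C2ρ t ht).d1 x hx).deriv
  have dθ : ∀ t ∈ Ioo 0 T, ∀ x ∈ Ioo (0:ℝ) 1, deriv (fun z => θ z t) x = D.θ1 x t := fun t ht x hx =>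
    ((C2θ t ht).d1 x hx).deriv
  have hl : ∀ x ∈ Icc (0:ℝ) 1, |Real.log ρb0 + k * x| ≤ Φ := by
    intro x hx
    have e : Real.log ρb0 + k * x = (1 - x) * Real.log ρb0 + x * Real.log ρb1 := by rw [hk]; ring
    rw [e, hΦ]
    refine (abs_add_le _ _).trans ?_
    rw [abs_mul, abs_mul, abs_of_nonneg hx.1, abs_of_nonneg (sub_nonneg.2 hx.2)]
    have := abs_nonneg (Real.log ρb0)
    have := abs_nonneg (Real.log ρb1)
    have := hx.1
    have := hx.2
    nlinarith
  have key := entropy_main hS (m := m) (M := M) (M₁ := M₁) (M₂ := M₂) (M₃ := M₃) (k := k) (L := Real.log ρb0)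
    (Φ := Φ) (pM := p_s M) hm hmM hM₁ (hps_nonneg M) (ps := fun x t => p_s (θ x t))
    (fun t ht => hps_smooth.continuous.comp_continuousOn (C2θ t ht).c0)
    (fun x hx t ht => ⟨θm x hx t ht, θM x hx t ht⟩) hpsM hl (fun x t => rfl)
    (fun t ht => by rw [← conv_int zero_le_one (fun x _ => rfl)]; exact mass t ht)
    (fun t ht => by
      have hp := ρpos 1 h11 t (hIcc t ht)
      rw [hk, add_sub_cancel]
      rcases B1 t ht with e | e
      · exact (congrArg (fun z => (Real.log (ρ 1 t) - Real.log ρb1) * z) e).le.trans (log_sign hp hρb1 hα1)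
      · have : Real.log (D.ρ 1 t) - Real.log ρb1 = 0 := sub_eq_zero.2 (congrArg Real.log e)
        rw [this, zero_mul])
    (fun t ht => by
      have hp := ρpos 0 h01 t (hIcc t ht)
      rcases B0 t ht with e | e
      · refine le_trans ?_ (congrArg (fun z => (Real.log (ρ 0 t) - Real.log ρb0) * z) e).ge
        exact log_sign' hp hρb0 hα0
      · have : Real.log (D.ρ 0 t) - Real.log ρb0 = 0 := sub_eq_zero.2 (congrArg Real.log e)
        rw [this, zero_mul])
    (by
      refine le_trans (le_of_eq ?_) hR
      refine (conv_int hT.le fun t ht => ?_).symm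
      exact conv_int zero_le_one fun x hx => by rw [dθ t ht x hx])
    (by
      refine le_trans (le_of_eq ?_) h3
      refine (conv_int zero_le_one fun x hx => ?_).symm
      rw [← iρ x (Ioo_subset_Icc_self hx)])
    hA3 rfl
  obtain ⟨k1, k2, k3⟩ := key
  refine ⟨fun t ht => ?_, ?_, ?_⟩
  · rw [conv_int zero_le_one (fun x _ => rfl)]; exact k1 t ht
  · refine le_trans (le_of_eq ?_) k2
    refine conv_int hT.le fun t ht => ?_
    exact conv_int zero_le_one fun x hx => by rw [dρ t ht x hx]
  · refine le_trans (le_of_eq ?_) k3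
    refine conv_int hT.le fun t ht => ?_
    exact conv_int zero_le_one fun x hx => by rw [dρ t ht x hx]
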